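/- Let N ≥ 3, let p, q > 0 with pq > 1, let a, b > −2, and assume the quadruple (p,q,a,b) is subcritical. If the Lane–Emden system (LE) with the same parameters p, q admits no bounded positive solution (u,v) ∈ C^∞(ℝ^N) × C^∞(ℝ^N) that is stable in every bounded open subset of ℝ^N, then the Hénon–Lane–Emden system (HLE) admits no positive solution that is stable outside a compact set. -/

import Mathlib

open MeasureTheory Metric Set

noncomputable section

/-- Euclidean space `ℝ^N`. -/
abbrev Euc (N : ℕ) := EuclideanSpace ℝ (Fin N)

/-- The Laplacian of a function `f : ℝ^N → ℝ`, as the sum of the pure second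
partial derivatives. -/
def lap {N : ℕ} (f : Euc N → ℝ) (x : Euc N) : ℝ :=
  ∑ i : Fin N, iteratedFDeriv ℝ 2 f x ![EuclideanSpace.single i 1, EuclideanSpace.single i 1]

/-- `(u, v)` is a solution of the Hénon–Lane–Emden system
`-Δu = |x|^a |v|^{p-1} v`, `-Δv = |x|^b |u|^{q-1} u` on `ℝ^N \ {0}`:
`u, v` are `C²` on `ℝ^N \ {0}`, continuous on `ℝ^N`, and satisfy the equations pointwise. -/
def IsHLESol {N : ℕ} (p q a b : ℝ) (u v : Euc N → ℝ) : Prop :=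
  ContDiffOn ℝ 2 u {x : Euc N | x ≠ 0} ∧ ContDiffOn ℝ 2 v {x : Euc N | x ≠ 0} ∧
  Continuous u ∧ Continuous v ∧
  (∀ x : Euc N, x ≠ 0 → -lap u x = ‖x‖ ^ a * (|v x| ^ (p - 1) * v x)) ∧
  (∀ x : Euc N, x ≠ 0 → -lap v x = ‖x‖ ^ b * (|u x| ^ (q - 1) * u x))

/-- Stability of a (positive) solution of the Hénon–Lane–Emden system on an open set `Ω`:
there exist positive `C²` functions `ξ, ζ` on `Ω` with
`-Δξ ≥ p |x|^a v^{p-1} ζ` and `-Δζ ≥ q |x|^b u^{q-1} ξ` on `Ω`. -/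
def HLEStableOn {N : ℕ} (p q a b : ℝ) (u v : Euc N → ℝ) (Ω : Set (Euc N)) : Prop :=
  ∃ ξ ζ : Euc N → ℝ, ContDiffOn ℝ 2 ξ Ω ∧ ContDiffOn ℝ 2 ζ Ω ∧
    (∀ x ∈ Ω, 0 < ξ x) ∧ (∀ x ∈ Ω, 0 < ζ x) ∧
    (∀ x ∈ Ω, p * ‖x‖ ^ a * v x ^ (p - 1) * ζ x ≤ -lap ξ x) ∧
    (∀ x ∈ Ω, q * ‖x‖ ^ b * u x ^ (q - 1) * ξ x ≤ -lap ζ x)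

/-- Stability outside a compact set `K`: stability on every open set whose closure is
compact and contained in `ℝ^N \ K`. -/
def HLEStableOutside {N : ℕ} (p q a b : ℝ) (u v : Euc N → ℝ) (K : Set (Euc N)) : Prop :=
  IsCompact K ∧
    ∀ Ω : Set (Euc N), IsOpen Ω → IsCompact (closure Ω) → closure Ω ⊆ Kᶜ →
      HLEStableOn p q a b u v Ω

/-- `(u, v)` solves the Lane–Emden system `-Δu = |v|^{p-1} v`, `-Δv = |u|^{q-1} u` on `ℝ^N`. -/
def IsLESol {N : ℕ} (p q : ℝ) (u v : Euc N → ℝ) : Prop :=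
  (∀ x : Euc N, -lap u x = |v x| ^ (p - 1) * v x) ∧
  (∀ x : Euc N, -lap v x = |u x| ^ (q - 1) * u x)

/-- Stability of a (positive) solution of the Lane–Emden system on an open set `Ω`. -/
def LEStableOn {N : ℕ} (p q : ℝ) (u v : Euc N → ℝ) (Ω : Set (Euc N)) : Prop :=
  ∃ ξ ζ : Euc N → ℝ, ContDiffOn ℝ 2 ξ Ω ∧ ContDiffOn ℝ 2 ζ Ω ∧
    (∀ x ∈ Ω, 0 < ξ x) ∧ (∀ x ∈ Ω, 0 < ζ x) ∧
    (∀ x ∈ Ω, p * v x ^ (p - 1) * ζ x ≤ -lap ξ x) ∧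
    (∀ x ∈ Ω, q * u x ^ (q - 1) * ξ x ≤ -lap ζ x)

/-- A function on `ℝ^N` is polynomially bounded. -/
def PolyBounded {N : ℕ} (w : Euc N → ℝ) : Prop :=
  ∃ K L R : ℝ, 0 < K ∧ 0 < L ∧ ∀ x : Euc N, R ≤ ‖x‖ → |w x| ≤ K * ‖x‖ ^ L

/-- The polynomial `G` from Theorem 1.4 (iii). -/
def Gpoly (p q x : ℝ) : ℝ :=
  x ^ 4 - (4 * p * q * (q + 1) / (p + 1)) * x ^ 2 +
    (2 * p * q * (q + 1) * (p + q + 2) / (p + 1) ^ 2) * x -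
    p * q * (q + 1) ^ 2 / (p + 1) ^ 2

open Filter Topology

/-- The `i`-th partial derivative. -/
def pd {N : ℕ} (i : Fin N) (f : Euc N → ℝ) (x : Euc N) : ℝ :=
  fderiv ℝ f x (EuclideanSpace.single i 1)

lemma lap_eq_sum_pd {N : ℕ} {f : Euc N → ℝ} {x : Euc N} (hf : ContDiffAt ℝ 2 f x) :
    lap f x = ∑ i, pd i (pd i f) x := by
  unfold lap
  refine Finset.sum_congr rfl fun i _ => ?_
  rw [iteratedFDeriv_two_apply]
  have h1 : DifferentiableAt ℝ (fderiv ℝ f) x :=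
    (hf.fderiv_right (m := 1) (by norm_num)).differentiableAt (by norm_num)
  unfold pd
  rw [fderiv_clm_apply h1 (differentiableAt_const _)]
  simp

lemma lap_congr {N : ℕ} {f g : Euc N → ℝ} {x : Euc N} (h : f =ᶠ[𝓝 x] g) : lap f x = lap g x := by
  unfold lap
  refine Finset.sum_congr rfl fun i _ => ?_
  rw [(h.iteratedFDeriv ℝ 2).eq_of_nhds]

lemma contDiff_pd {N : ℕ} {f : Euc N → ℝ} {m n : WithTop ℕ∞} (hf : ContDiff ℝ n f) (hmn : m + 1 ≤ n)
    (i : Fin N) : ContDiff ℝ m (pd i f) :=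
  (hf.fderiv_right hmn).clm_apply contDiff_const

lemma continuous_pd {N : ℕ} {f : Euc N → ℝ} (hf : ContDiff ℝ 1 f) (i : Fin N) :
    Continuous (pd i f) :=
  (contDiff_pd (m := 0) hf (by norm_num) i).continuous

lemma continuous_lap {N : ℕ} {f : Euc N → ℝ} (hf : ContDiff ℝ 2 f) : Continuous (lap f) := by
  have : lap f = fun x => ∑ i, pd i (pd i f) x := funext fun x => lap_eq_sum_pd hf.contDiffAt
  rw [this]
  exact continuous_finsetSum _ fun i _ =>
    continuous_pd (contDiff_pd (m := 1) hf (by norm_num) i) i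

lemma fderiv_eq_sum_pd {N : ℕ} (f : Euc N → ℝ) (x y : Euc N) :
    fderiv ℝ f x y = ∑ i, y i * pd i f x := by
  conv_lhs => rw [← (EuclideanSpace.basisFun (Fin N) ℝ).sum_repr y]
  simp [pd, map_sum]

/-- Differentiation under an integral over a compact set. -/
lemma hasFDerivAt_setIntegral_param {P Q : Type*} [NormedAddCommGroup P] [NormedSpace ℝ P]
    [ProperSpace P]
    [TopologicalSpace Q] [MeasurableSpace Q] [OpensMeasurableSpace Q] [SecondCountableTopology Q]
    [T2Space Q]
    {μ : Measure Q} [IsFiniteMeasureOnCompacts μ] {s : Set Q} (hs : IsCompact s)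
    {F : P → Q → ℝ} {F' : P → Q → P →L[ℝ] ℝ} (hF : Continuous (Function.uncurry F))
    (hF' : Continuous (Function.uncurry F')) (hd : ∀ p q, HasFDerivAt (F · q) (F' p q) p) (p : P) :
    HasFDerivAt (fun p => ∫ q in s, F p q ∂μ) (∫ q in s, F' p q ∂μ) p := by
  obtain ⟨C, hC⟩ := ((isCompact_closedBall p 1).prod hs).bddAbove_image hF'.norm.continuousOn
  refine hasFDerivAt_integral_of_dominated_of_fderiv_le (bound := fun _ => C)
    (closedBall_mem_nhds p one_pos) ?_ ?_ ?_ ?_ ?_ ?_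
  · exact Eventually.of_forall fun x =>
      ((by fun_prop : Continuous (F x)).aestronglyMeasurable)
  · exact (by fun_prop : Continuous (F p)).continuousOn.integrableOn_compact hs
  · exact (by fun_prop : Continuous (F' p)).aestronglyMeasurable
  · filter_upwards [ae_restrict_mem hs.measurableSet] with q hq x hx
    exact hC ⟨(x, q), ⟨hx, hq⟩, rfl⟩
  · exact continuous_const.continuousOn.integrableOn_compact hs
  · exact Eventually.of_forall fun q x _ => hd x q

/-- The weighted average of `f` around `x` at scale `σ`. -/
def avg {N : ℕ} (w : Euc N → ℝ) (σ : ℝ) (f : Euc N → ℝ) (x : Euc N) : ℝ :=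
  ∫ z, w z * f (x + σ • z)

lemma avg_eq_setIntegral {N : ℕ} {w : Euc N → ℝ} (hw1 : ∀ z, 1 < ‖z‖ → w z = 0)
    (σ : ℝ) (f : Euc N → ℝ) (x : Euc N) :
    avg w σ f x = ∫ z in closedBall 0 1, w z * f (x + σ • z) := by
  unfold avg
  rw [setIntegral_eq_integral_of_forall_compl_eq_zero]
  intro z hz
  rw [hw1 z (by simpa using hz), zero_mul]

lemma continuous_avg {N : ℕ} {w f : Euc N → ℝ} (hw : Continuous w)
    (hw1 : ∀ z, 1 < ‖z‖ → w z = 0) (hf : Continuous f) :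
    Continuous (fun p : Euc N × ℝ => avg w p.2 f p.1) := by
  simp_rw [avg_eq_setIntegral hw1]
  exact continuous_parametric_integral_of_continuous
    (f := fun (p : Euc N × ℝ) z => w z * f (p.1 + p.2 • z)) (by fun_prop) (isCompact_closedBall _ _)

lemma avg_integrable {N : ℕ} {w f : Euc N → ℝ} (hw : Continuous w)
    (hw1 : ∀ z, 1 < ‖z‖ → w z = 0) (hf : Continuous f) (σ : ℝ) (x : Euc N) :
    Integrable (fun z => w z * f (x + σ • z)) := by
  refine Continuous.integrable_of_hasCompactSupport (by fun_prop) ?_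
  refine HasCompactSupport.intro (isCompact_closedBall (0 : Euc N) 1) fun z hz => ?_
  rw [hw1 z (by simpa using hz), zero_mul]

lemma avg_mono {N : ℕ} {w f g : Euc N → ℝ} (hw : Continuous w) (hw0 : ∀ z, 0 ≤ w z)
    (hw1 : ∀ z, 1 < ‖z‖ → w z = 0) (hf : Continuous f) (hg : Continuous g) {σ : ℝ} {x : Euc N}
    (h : ∀ y ∈ closedBall x |σ|, f y ≤ g y) : avg w σ f x ≤ avg w σ g x := by
  unfold avg
  refine integral_mono (avg_integrable hw hw1 hf σ x) (avg_integrable hw hw1 hg σ x) fun z => ?_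
  by_cases hz : 1 < ‖z‖
  · simp [hw1 z hz]
  · refine mul_le_mul_of_nonneg_left (h _ ?_) (hw0 z)
    simp only [mem_closedBall, dist_eq_norm, add_sub_cancel_left, norm_smul, Real.norm_eq_abs]
    exact mul_le_of_le_one_right (abs_nonneg _) (not_lt.1 hz)

lemma avg_const {N : ℕ} (w : Euc N → ℝ) (σ c : ℝ) (x : Euc N) :
    avg w σ (fun _ => c) x = (∫ z, w z) * c := by
  simp [avg, integral_mul_const]

lemma avg_zero_scale {N : ℕ} (w f : Euc N → ℝ) (x : Euc N) :
    avg w 0 f x = (∫ z, w z) * f x := by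
  simp [avg, integral_mul_const]

lemma abs_avg_le {N : ℕ} {w f : Euc N → ℝ} (hw : Continuous w)
    (hw1 : ∀ z, 1 < ‖z‖ → w z = 0) {σ C : ℝ} {x : Euc N}
    (h : ∀ y ∈ closedBall x |σ|, |f y| ≤ C) : |avg w σ f x| ≤ (∫ z, |w z|) * C := by
  unfold avg
  rw [← integral_mul_const, ← Real.norm_eq_abs]
  refine norm_integral_le_of_norm_le ?_ (Eventually.of_forall fun z => ?_)
  · refine Integrable.mul_const ?_ _
    refine Continuous.integrable_of_hasCompactSupport (by fun_prop) ?_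
    refine HasCompactSupport.intro (isCompact_closedBall (0 : Euc N) 1) fun z hz => ?_
    rw [hw1 z (by simpa using hz), abs_zero]
  · rw [Real.norm_eq_abs, abs_mul]
    by_cases hz : 1 < ‖z‖
    · simp [hw1 z hz]
    · refine mul_le_mul_of_nonneg_left (h _ ?_) (abs_nonneg _)
      simp only [mem_closedBall, dist_eq_norm, add_sub_cancel_left, norm_smul, Real.norm_eq_abs]
      exact mul_le_of_le_one_right (abs_nonneg _) (not_lt.1 hz)

lemma hasFDerivAt_avg {N : ℕ} {w f : Euc N → ℝ} (hw : Continuous w)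
    (hw1 : ∀ z, 1 < ‖z‖ → w z = 0) (hf : ContDiff ℝ 1 f) (σ : ℝ) (x : Euc N) :
    HasFDerivAt (avg w σ f)
      (∫ z in closedBall 0 1, w z • fderiv ℝ f (x + σ • z)) x := by
  have : avg w σ f = fun x => ∫ z in closedBall 0 1, w z * f (x + σ • z) :=
    funext fun x => avg_eq_setIntegral hw1 σ f x
  rw [this]
  have hc : Continuous (fderiv ℝ f) := hf.continuous_fderiv (by norm_num)
  refine hasFDerivAt_setIntegral_param (isCompact_closedBall _ _)
    (F := fun x z => w z * f (x + σ • z)) (F' := fun x z => w z • fderiv ℝ f (x + σ • z))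
    ?_ (by fun_prop) ?_ x
  · have := hf.continuous
    fun_prop
  · intro p q
    have := (hf.differentiable (by norm_num) (p + σ • q)).hasFDerivAt
    exact HasFDerivAt.const_mul (HasFDerivAt.comp (f := fun p => p + σ • q) (g := f) p this
      ((hasFDerivAt_id p).add_const _)) (w q)

lemma pd_avg {N : ℕ} {w f : Euc N → ℝ} (hw : Continuous w)
    (hw1 : ∀ z, 1 < ‖z‖ → w z = 0) (hf : ContDiff ℝ 1 f) (i : Fin N) (σ : ℝ) (x : Euc N) :
    pd i (avg w σ f) x = avg w σ (pd i f) x := by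
  have hc : Continuous (fderiv ℝ f) := hf.continuous_fderiv (by norm_num)
  rw [pd, (hasFDerivAt_avg hw hw1 hf σ x).fderiv, avg_eq_setIntegral hw1,
    ContinuousLinearMap.integral_apply]
  · rfl
  · exact (by fun_prop : Continuous _).continuousOn.integrableOn_compact (isCompact_closedBall _ _)

lemma hasDerivAt_avg_scale {N : ℕ} {w f : Euc N → ℝ} (hw : Continuous w)
    (hw1 : ∀ z, 1 < ‖z‖ → w z = 0) (hf : ContDiff ℝ 1 f) (σ : ℝ) (x : Euc N) :
    HasDerivAt (fun σ => avg w σ f x) (∑ i, avg (fun z => w z * z i) σ (pd i f) x) σ := by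
  have : (fun σ => avg w σ f x) = fun σ => ∫ z in closedBall 0 1, w z * f (x + σ • z) :=
    funext fun σ => avg_eq_setIntegral hw1 σ f x
  rw [this]
  have hc : Continuous (fderiv ℝ f) := hf.continuous_fderiv (by norm_num)
  have hfc := hf.continuous
  have h := hasFDerivAt_setIntegral_param (μ := volume) (isCompact_closedBall (0 : Euc N) 1)
    (F := fun (σ : ℝ) z => w z * f (x + σ • z))
    (F' := fun (σ : ℝ) z => (w z * fderiv ℝ f (x + σ • z) z) • ContinuousLinearMap.id ℝ ℝ)
    (by fun_prop) (by fun_prop) ?_ σ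
  · convert h.hasDerivAt using 1
    rw [ContinuousLinearMap.integral_apply]
    · have h2 : ∀ i ∈ Finset.univ, Integrable
          (fun z => w z * z i * pd i f (x + σ • z)) (volume.restrict (closedBall 0 1)) := by
        intro i _
        have := continuous_pd hf i
        exact (by fun_prop : Continuous _).continuousOn.integrableOn_compact
          (isCompact_closedBall _ _)
      have h3 : ∀ i, avg (fun z => w z * z i) σ (pd i f) x
          = ∫ z in closedBall 0 1, w z * z i * pd i f (x + σ • z) := fun i =>
        avg_eq_setIntegral (fun z hz => by simp [hw1 z hz]) _ _ _
      simp_rw [h3]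
      rw [← integral_finsetSum _ h2]
      congr 1
      ext z
      simp [fderiv_eq_sum_pd f (x + σ • z) z, Finset.mul_sum, mul_assoc]
    · exact (by fun_prop : Continuous fun z : Euc N => (w z * fderiv ℝ f (x + σ • z) z) •
        ContinuousLinearMap.id ℝ ℝ).continuousOn.integrableOn_compact (isCompact_closedBall _ _)
  · intro σ z
    have h1 := (hf.differentiable (by norm_num) (x + σ • z)).hasFDerivAt
    have h2 : HasDerivAt (fun σ : ℝ => x + σ • z) z σ := by
      simpa using ((hasDerivAt_id σ).smul_const z).const_add x
    have h3 := ((h1.comp_hasDerivAt σ h2).const_mul (w z)).hasFDerivAt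
    have h4 : ContinuousLinearMap.toSpanSingleton ℝ (w z * (fderiv ℝ f (x + σ • z)) z)
        = (w z * fderiv ℝ f (x + σ • z) z) • ContinuousLinearMap.id ℝ ℝ := by
      ext; simp
    exact h4 ▸ h3

/-- A radial bump, equal to `1` on the ball of radius `1/2` and supported in the unit ball. -/
def kerK {N : ℕ} (z : Euc N) : ℝ := Real.smoothTransition (4 / 3 * (1 - ‖z‖ ^ 2))

/-- The radial weight `ρ` with `∇ kerK = -(ρ / 2) z`. -/
def kerR {N : ℕ} (z : Euc N) : ℝ :=
  16 / 3 * deriv Real.smoothTransition (4 / 3 * (1 - ‖z‖ ^ 2))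

/-- The total mass of `kerR`. -/
def kerM (N : ℕ) : ℝ := ∫ z : Euc N, kerR z

lemma contDiff_kerK {N : ℕ} {n : ℕ∞} : ContDiff ℝ n (kerK (N := N)) :=
  Real.smoothTransition.contDiff.comp
    (contDiff_const.mul (contDiff_const.sub (contDiff_norm_sq ℝ)))

lemma contDiff_kerR {N : ℕ} {n : ℕ∞} : ContDiff ℝ n (kerR (N := N)) := by
  have h : ContDiff ℝ n (deriv Real.smoothTransition) := by
    have h1 : ContDiff ℝ (n + 1 : ℕ∞) Real.smoothTransition := Real.smoothTransition.contDiff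
    exact (contDiff_succ_iff_deriv.1 (by exact_mod_cast h1)).2.2
  exact contDiff_const.mul (h.comp (contDiff_const.mul (contDiff_const.sub (contDiff_norm_sq ℝ))))

lemma continuous_kerK {N : ℕ} : Continuous (kerK (N := N)) := (contDiff_kerK (n := 0)).continuous

lemma continuous_kerR {N : ℕ} : Continuous (kerR (N := N)) := (contDiff_kerR (n := 0)).continuous

lemma kerK_nonneg {N : ℕ} (z : Euc N) : 0 ≤ kerK z := Real.smoothTransition.nonneg _

lemma kerK_le_one {N : ℕ} (z : Euc N) : kerK z ≤ 1 := Real.smoothTransition.le_one _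

lemma kerK_eq_one {N : ℕ} {z : Euc N} (hz : ‖z‖ ≤ 1 / 2) : kerK z = 1 := by
  refine Real.smoothTransition.one_of_one_le ?_
  nlinarith [norm_nonneg z]

lemma kerK_eq_zero {N : ℕ} {z : Euc N} (hz : 1 ≤ ‖z‖) : kerK z = 0 := by
  refine Real.smoothTransition.zero_of_nonpos ?_
  nlinarith [norm_nonneg z]

lemma kerK_zero' {N : ℕ} (z : Euc N) (hz : 1 < ‖z‖) : kerK z = 0 := kerK_eq_zero hz.le

lemma kerK_pos {N : ℕ} {z : Euc N} (hz : ‖z‖ < 1) : 0 < kerK z := by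
  refine Real.smoothTransition.pos_of_pos ?_
  nlinarith [norm_nonneg z]

lemma kerR_nonneg {N : ℕ} (z : Euc N) : 0 ≤ kerR z :=
  mul_nonneg (by norm_num) Real.smoothTransition.monotone.deriv_nonneg

lemma kerR_eq_zero {N : ℕ} (z : Euc N) (hz : 1 < ‖z‖) : kerR z = 0 := by
  have : Real.smoothTransition =ᶠ[𝓝 (4 / 3 * (1 - ‖z‖ ^ 2))] fun _ => 0 := by
    have : 4 / 3 * (1 - ‖z‖ ^ 2) < 0 := by nlinarith
    filter_upwards [Iio_mem_nhds this] with y hy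
    exact Real.smoothTransition.zero_of_nonpos (le_of_lt hy)
  rw [kerR, this.deriv_eq]
  simp

lemma kerR_eq_zero_of_lt {N : ℕ} (z : Euc N) (hz : ‖z‖ < 1 / 2) : kerR z = 0 := by
  have : Real.smoothTransition =ᶠ[𝓝 (4 / 3 * (1 - ‖z‖ ^ 2))] fun _ => 1 := by
    have : 1 < 4 / 3 * (1 - ‖z‖ ^ 2) := by nlinarith [norm_nonneg z]
    filter_upwards [Ioi_mem_nhds this] with y hy
    exact Real.smoothTransition.one_of_one_le (le_of_lt hy)
  rw [kerR, this.deriv_eq]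
  simp

lemma pd_kerK {N : ℕ} (i : Fin N) (z : Euc N) : pd i kerK z = -(1 / 2) * (kerR z * z i) := by
  have h1 : HasDerivAt Real.smoothTransition
      (deriv Real.smoothTransition (4 / 3 * (1 - ‖z‖ ^ 2))) (4 / 3 * (1 - ‖z‖ ^ 2)) :=
    ((Real.smoothTransition.contDiff (n := 1)).differentiable (by norm_num) _).hasDerivAt
  have h2 : HasFDerivAt (fun z : Euc N => 4 / 3 * (1 - ‖z‖ ^ 2)) _ z :=
    (((hasStrictFDerivAt_norm_sq z).hasFDerivAt).const_sub 1).const_mul (4 / 3)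
  have h3 := (h1.comp_hasFDerivAt z h2).fderiv
  have h4 : (kerK : Euc N → ℝ) = Real.smoothTransition ∘ fun z : Euc N => 4 / 3 * (1 - ‖z‖ ^ 2) :=
    rfl
  rw [pd, h4, h3]
  simp [kerR, EuclideanSpace.inner_single_right]
  ring

lemma integral_mul_pd {N : ℕ} {f g : Euc N → ℝ} (hf : ContDiff ℝ 1 f) (hg : ContDiff ℝ 1 g)
    (hfs : HasCompactSupport f) (i : Fin N) :
    ∫ z, f z * pd i g z = -∫ z, pd i f z * g z := by
  have h1 := continuous_pd hf i
  have h2 := continuous_pd hg i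
  have hfc := hf.continuous
  have hgc := hg.continuous
  have hps : HasCompactSupport (pd i f) := hfs.fderiv_apply ℝ _
  refine integral_mul_fderiv_eq_neg_fderiv_mul_of_integrable ?_ ?_ ?_
    (fun x _ => hf.differentiable (by norm_num) x) (fun x _ => hg.differentiable (by norm_num) x)
  · exact (h1.mul hgc).integrable_of_hasCompactSupport hps.mul_right
  · exact (hfc.mul h2).integrable_of_hasCompactSupport hfs.mul_right
  · exact (hfc.mul hgc).integrable_of_hasCompactSupport hfs.mul_right

lemma hasCompactSupport_of_zero {N : ℕ} {w : Euc N → ℝ} (hw1 : ∀ z, 1 < ‖z‖ → w z = 0) :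
    HasCompactSupport w :=
  HasCompactSupport.intro (isCompact_closedBall (0 : Euc N) 1) fun z hz =>
    hw1 z (by simpa using hz)

lemma kerM_pos {N : ℕ} (hN : 0 < N) : 0 < kerM N := by
  suffices h : ∃ x : Euc N, kerR x ≠ 0 by
    obtain ⟨x, hx⟩ := h
    exact continuous_kerR.integral_pos_of_hasCompactSupport_nonneg_nonzero
      (hasCompactSupport_of_zero kerR_eq_zero) kerR_nonneg hx
  by_contra! h
  have hdiff : Differentiable ℝ (kerK (N := N)) :=
    (contDiff_kerK (n := 1)).differentiable (by norm_num)
  have h0 : ∀ x, fderiv ℝ (kerK (N := N)) x = 0 := by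
    intro x
    ext y
    rw [fderiv_eq_sum_pd]
    simp [pd_kerK, h]
  have h1 := is_const_of_fderiv_eq_zero hdiff h0 0 (EuclideanSpace.single ⟨0, hN⟩ 1)
  rw [kerK_eq_one (by simp), kerK_eq_zero (by simp)] at h1
  exact one_ne_zero h1

lemma pd_comp_affine {N : ℕ} {g : Euc N → ℝ} (hg : ContDiff ℝ 1 g) (i : Fin N) (σ : ℝ)
    (x z : Euc N) : pd i (fun z => g (x + σ • z)) z = σ * pd i g (x + σ • z) := by
  have h1 := (hg.differentiable (by norm_num) (x + σ • z)).hasFDerivAt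
  have h2 : HasFDerivAt (fun z : Euc N => x + σ • z) (σ • ContinuousLinearMap.id ℝ (Euc N)) z :=
    ((hasFDerivAt_id z).const_smul σ).const_add x
  have h3 : fderiv ℝ (fun z => g (x + σ • z)) z = _ := (h1.comp z h2).fderiv
  rw [pd, h3]
  simp [pd]

lemma avg_kerR_mul {N : ℕ} {g : Euc N → ℝ} (hg : ContDiff ℝ 1 g) (i : Fin N) (σ : ℝ) (x : Euc N) :
    avg (fun z => kerR z * z i) σ g x = 2 * σ * avg kerK σ (pd i g) x := by
  have h := integral_mul_pd (contDiff_kerK (n := 1)) (g := fun z => g (x + σ • z))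
    (hg.comp (by fun_prop)) (hasCompactSupport_of_zero (kerK_zero' (N := N))) i
  simp_rw [pd_comp_affine hg, pd_kerK] at h
  have e1 : ∫ z : Euc N, kerK z * (σ * pd i g (x + σ • z)) = σ * avg kerK σ (pd i g) x := by
    rw [avg, ← integral_const_mul]
    congr 1; ext z; ring
  have e2 : ∫ z : Euc N, -(1 / 2) * (kerR z * z i) * g (x + σ • z)
      = -(1 / 2) * avg (fun z => kerR z * z i) σ g x := by
    rw [avg, ← integral_const_mul]
    congr 1; ext z; ring
  rw [e1, e2] at h
  linarith

/-- The (truncated) potential of `h`. -/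
def pot {N : ℕ} (a b : ℝ) (h : Euc N → ℝ) (x : Euc N) : ℝ :=
  ∫ σ in a..b, 2 * σ * avg kerK σ h x

lemma continuous_avg_scale {N : ℕ} {w h : Euc N → ℝ} (hw : Continuous w)
    (hw1 : ∀ z, 1 < ‖z‖ → w z = 0) (hh : Continuous h) (x : Euc N) :
    Continuous (fun σ => avg w σ h x) :=
  (continuous_avg hw hw1 hh).comp (by fun_prop : Continuous fun σ : ℝ => (x, σ))

lemma continuous_pot_integrand {N : ℕ} {h : Euc N → ℝ} (hh : Continuous h) (x : Euc N) :
    Continuous (fun σ => 2 * σ * avg kerK σ h x) := by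
  have := continuous_avg_scale continuous_kerK (kerK_zero' (N := N)) hh x
  fun_prop

lemma rep_global {N : ℕ} {U : Euc N → ℝ} (hU : ContDiff ℝ 2 U) (R : ℝ) (x : Euc N) :
    kerM N * U x = avg kerR R U x + pot 0 R (fun y => -lap U y) x := by
  have hd : ∀ σ, HasDerivAt (fun σ => avg kerR σ U x) (2 * σ * avg kerK σ (lap U) x) σ := by
    intro σ
    convert hasDerivAt_avg_scale continuous_kerR kerR_eq_zero (hU.of_le (by norm_num)) σ x using 1
    have h1 : ∀ i, ContDiff ℝ 1 (pd i U) := fun i => contDiff_pd hU (by norm_num) i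
    simp_rw [avg_kerR_mul (h1 _)]
    rw [← Finset.mul_sum]
    congr 1
    unfold avg
    rw [← integral_finsetSum _ fun i _ => avg_integrable continuous_kerK kerK_zero'
      (continuous_pd (h1 i) i) σ x]
    congr 1; ext z
    rw [lap_eq_sum_pd hU.contDiffAt, Finset.mul_sum]
  have h2 := intervalIntegral.integral_eq_sub_of_hasDerivAt (a := 0) (b := R) (fun σ _ => hd σ)
    ((continuous_pot_integrand (continuous_lap hU) x).intervalIntegrable _ _)
  have h3 : pot 0 R (fun y => -lap U y) x = -∫ σ in (0 : ℝ)..R, 2 * σ * avg kerK σ (lap U) x := by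
    rw [pot, ← intervalIntegral.integral_neg]
    congr 1; ext σ
    simp [avg, integral_neg]
  rw [h3, h2, avg_zero_scale, kerM]
  ring

lemma exists_global_ext {N : ℕ} {U : Euc N → ℝ} {x : Euc N} {R R' : ℝ} (hR : 0 ≤ R) (hRR : R < R')
    (hU : ContDiffOn ℝ 2 U (ball x R')) :
    ∃ V : Euc N → ℝ, ContDiff ℝ 2 V ∧ (∀ y ∈ closedBall x R, V =ᶠ[𝓝 y] U) ∧
      ((∀ y ∈ ball x R', 0 ≤ U y) → ∀ y, 0 ≤ V y) := by
  let χ : ContDiffBump x := ⟨R + (R' - R) / 3, R + 2 * (R' - R) / 3, by linarith, by linarith⟩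
  have hsupp : ∀ y, y ∉ ball x R' → χ y = 0 := fun y hy => by
    refine χ.zero_of_le_dist ?_
    have : R' ≤ dist y x := by simpa using hy
    have h2 : χ.rOut = R + 2 * (R' - R) / 3 := rfl
    linarith
  refine ⟨fun y => χ y * U y, ?_, ?_, ?_⟩
  · rw [contDiff_iff_contDiffAt]
    intro y
    by_cases hy : y ∈ ball x R'
    · exact χ.contDiff.contDiffAt.mul (hU.contDiffAt (isOpen_ball.mem_nhds hy))
    · have h2 : χ.rOut = R + 2 * (R' - R) / 3 := rfl
      have : (fun y => χ y * U y) =ᶠ[𝓝 y] fun _ => 0 := by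
        have hmem : y ∈ (closedBall x χ.rOut)ᶜ := by
          have : R' ≤ dist y x := by simpa using hy
          simp only [mem_compl_iff, mem_closedBall, not_le]
          linarith
        filter_upwards [isClosed_closedBall.isOpen_compl.mem_nhds hmem] with z hz
        rw [χ.zero_of_le_dist, zero_mul]
        simp only [mem_compl_iff, mem_closedBall, not_le] at hz
        exact hz.le
      exact contDiffAt_const.congr_of_eventuallyEq this
  · intro y hy
    have h1 : χ.rIn = R + (R' - R) / 3 := rfl
    have hy' : y ∈ ball x χ.rIn := by
      simp only [mem_closedBall] at hy
      simp only [mem_ball]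
      linarith
    filter_upwards [isOpen_ball.mem_nhds hy'] with z hz
    rw [χ.one_of_mem_closedBall (ball_subset_closedBall hz), one_mul]
  · intro h y
    by_cases hy : y ∈ ball x R'
    · exact mul_nonneg χ.nonneg (h y hy)
    · simp [hsupp y hy]

/-- The covector with components `d`. -/
def covec {N : ℕ} (d : Fin N → ℝ) : Euc N →L[ℝ] ℝ :=
  ∑ i, d i • (EuclideanSpace.proj i : Euc N →L[ℝ] ℝ)

lemma covec_apply {N : ℕ} (d : Fin N → ℝ) (y : Euc N) : covec d y = ∑ i, d i * y i := by
  simp [covec]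

lemma covec_sub {N : ℕ} (d e : Fin N → ℝ) : covec d - covec e = covec (d - e) := by
  ext y
  simp [covec_apply, sub_mul]

lemma abs_coord_le {N : ℕ} (y : Euc N) (i : Fin N) : |y i| ≤ ‖y‖ := by
  simpa using PiLp.norm_apply_le y i

lemma norm_covec_le {N : ℕ} {d : Fin N → ℝ} {C : ℝ} (hC : 0 ≤ C) (h : ∀ i, |d i| ≤ C) :
    ‖covec d‖ ≤ N * C := by
  refine ContinuousLinearMap.opNorm_le_bound _ (by positivity) fun y => ?_
  rw [covec_apply, Real.norm_eq_abs]
  calc |∑ i, d i * y i| ≤ ∑ i, |d i * y i| := Finset.abs_sum_le_sum_abs _ _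
    _ ≤ ∑ _i : Fin N, C * ‖y‖ := Finset.sum_le_sum fun i _ => by
        rw [abs_mul]
        exact mul_le_mul (h i) (abs_coord_le y i) (abs_nonneg _) hC
    _ = N * C * ‖y‖ := by simp [mul_assoc]

lemma pd_of_hasFDerivAt_covec {N : ℕ} {f : Euc N → ℝ} {d : Fin N → ℝ} {x : Euc N}
    (h : HasFDerivAt f (covec d) x) (i : Fin N) : pd i f x = d i := by
  rw [pd, h.fderiv, covec_apply]
  simp

lemma fderiv_eq_covec {N : ℕ} (f : Euc N → ℝ) (x : Euc N) :
    fderiv ℝ f x = covec fun i => pd i f x := by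
  ext y
  rw [fderiv_eq_sum_pd, covec_apply]
  simp [mul_comm]

lemma contDiff_succ_of_covec {N : ℕ} {f : Euc N → ℝ} {d : Fin N → Euc N → ℝ} {n : ℕ}
    (h : ∀ x, HasFDerivAt f (covec fun i => d i x) x) (hd : ∀ i, ContDiff ℝ n (d i)) :
    ContDiff ℝ (n + 1 : ℕ) f := by
  push_cast
  refine contDiff_succ_iff_hasFDerivAt.2 ⟨_, ?_, h⟩
  unfold covec
  exact ContDiff.sum fun i _ => (hd i).smul contDiff_const

lemma hasFDerivAt_covec_of_approx {N : ℕ} {f : Euc N → ℝ} {d : Fin N → Euc N → ℝ}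
    (h : ∀ ε > 0, ∃ (g : Euc N → ℝ) (e : Fin N → Euc N → ℝ),
      (∀ x, HasFDerivAt g (covec fun i => e i x) x) ∧ (∀ x, |g x - f x| ≤ ε) ∧
        ∀ i x, |e i x - d i x| ≤ ε) (x : Euc N) : HasFDerivAt f (covec fun i => d i x) x := by
  have hpos : ∀ n : ℕ, (0 : ℝ) < 1 / (n + 1) := fun n => by positivity
  choose g e hge hgf hed using fun n : ℕ => h _ (hpos n)
  have hlim : Tendsto (fun n : ℕ => 1 / ((n : ℝ) + 1)) atTop (𝓝 0) :=
    tendsto_one_div_add_atTop_nhds_zero_nat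
  refine hasFDerivAt_of_tendstoUniformly (l := atTop) (f := g)
    (f' := fun n x => covec fun i => e n i x) (g' := fun x => covec fun i => d i x) ?_ hge ?_ x
  · rw [Metric.tendstoUniformly_iff]
    intro ε hε
    have h2 : Tendsto (fun n : ℕ => N * (1 / ((n : ℝ) + 1))) atTop (𝓝 0) := by
      simpa using hlim.const_mul (N : ℝ)
    filter_upwards [h2.eventually_lt_const hε] with n hn y
    rw [dist_comm, dist_eq_norm, covec_sub]
    exact (norm_covec_le (hpos n).le fun i => hed n i y).trans_lt hn
  · intro y
    rw [tendsto_iff_dist_tendsto_zero]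
    exact squeeze_zero (fun _ => dist_nonneg) (fun n => hgf n y) hlim

lemma exists_smooth_approx {N : ℕ} {h : Euc N → ℝ} (hh : Continuous h) {ε : ℝ} (hε : 0 < ε) :
    ∃ g : Euc N → ℝ, ContDiff ℝ 1 g ∧ ∀ x, |g x - h x| ≤ ε := by
  obtain ⟨g, hg, hgh, -⟩ := hh.exists_contDiff_approx 1 (ε := fun _ => ε) (by fun_prop)
    (fun _ => hε)
  exact ⟨g, by exact_mod_cast hg, fun x => (hgh x).le⟩

lemma avg_sub {N : ℕ} {w f g : Euc N → ℝ} (hw : Continuous w)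
    (hw1 : ∀ z, 1 < ‖z‖ → w z = 0) (hf : Continuous f) (hg : Continuous g) (σ : ℝ) (x : Euc N) :
    avg w σ (fun y => f y - g y) x = avg w σ f x - avg w σ g x := by
  unfold avg
  rw [← integral_sub (avg_integrable hw hw1 hf σ x) (avg_integrable hw hw1 hg σ x)]
  congr 1; ext z; ring

lemma avg_const_mul {N : ℕ} (w f : Euc N → ℝ) (c σ : ℝ) (x : Euc N) :
    avg w σ (fun y => c * f y) x = c * avg w σ f x := by
  unfold avg
  rw [← integral_const_mul]
  congr 1; ext z; ring

lemma pd_zero_outside {N : ℕ} {w : Euc N → ℝ} (hw1 : ∀ z, 1 < ‖z‖ → w z = 0) (i : Fin N)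
    (z : Euc N) (hz : 1 < ‖z‖) : pd i w z = 0 := by
  have : w =ᶠ[𝓝 z] fun _ => 0 := by
    filter_upwards [continuous_norm.continuousAt.eventually (lt_mem_nhds hz)] with y hy
    exact hw1 y hy
  rw [pd, this.fderiv_eq]
  simp

lemma avg_pd {N : ℕ} {w g : Euc N → ℝ} (hw : ContDiff ℝ 1 w) (hw1 : ∀ z, 1 < ‖z‖ → w z = 0)
    (hg : ContDiff ℝ 1 g) (i : Fin N) (σ : ℝ) (x : Euc N) :
    σ * avg w σ (pd i g) x = -avg (pd i w) σ g x := by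
  have h := integral_mul_pd hw (g := fun z => g (x + σ • z))
    (hg.comp (by fun_prop)) (hasCompactSupport_of_zero hw1) i
  simp_rw [pd_comp_affine hg] at h
  rw [avg, avg, ← h, ← integral_const_mul]
  congr 1; ext z; ring

lemma hasFDerivAt_avg_of_continuous {N : ℕ} {w h : Euc N → ℝ} (hw : ContDiff ℝ 1 w)
    (hw1 : ∀ z, 1 < ‖z‖ → w z = 0) (hh : Continuous h) {σ : ℝ} (hσ : σ ≠ 0) (x : Euc N) :
    HasFDerivAt (avg w σ h) (covec fun i => -σ⁻¹ * avg (pd i w) σ h x) x := by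
  revert x
  refine hasFDerivAt_covec_of_approx fun ε hε => ?_
  let A := (∫ z, |w z|) + ∑ i, |σ⁻¹| * ∫ z, |pd i w z|
  have hA : 0 ≤ A := by positivity
  obtain ⟨g, hg, hgh⟩ := exists_smooth_approx hh (ε := ε / (A + 1)) (by positivity)
  have hε' : A * (ε / (A + 1)) ≤ ε := by
    rw [mul_div_assoc', div_le_iff₀ (by positivity)]
    nlinarith
  have hε0 : 0 ≤ ε / (A + 1) := by positivity
  refine ⟨avg w σ g, fun i x => -σ⁻¹ * avg (pd i w) σ g x, ?_, ?_, ?_⟩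
  · intro x
    have h1 := (hasFDerivAt_avg hw.continuous hw1 hg σ x).differentiableAt.hasFDerivAt
    rw [fderiv_eq_covec] at h1
    convert h1 using 2
    ext i
    have h2 := avg_pd hw hw1 hg i σ x
    rw [pd_avg hw.continuous hw1 hg]
    beta_reduce
    rw [neg_mul_comm, ← h2, inv_mul_cancel_left₀ hσ]
  · intro x
    rw [← avg_sub hw.continuous hw1 hg.continuous hh]
    refine (abs_avg_le hw.continuous hw1 fun y _ => hgh y).trans (le_trans ?_ hε')
    gcongr
    exact le_add_of_nonneg_right (by positivity)
  · intro i x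
    have hp := pd_zero_outside hw1 i
    rw [← mul_sub, ← avg_sub (continuous_pd hw i) hp hg.continuous hh, abs_mul, abs_neg]
    refine le_trans (mul_le_mul_of_nonneg_left (abs_avg_le (continuous_pd hw i) hp
      fun y _ => hgh y) (abs_nonneg _)) (le_trans ?_ hε')
    rw [← mul_assoc]
    refine mul_le_mul_of_nonneg_right ?_ hε0
    refine le_trans ?_ (le_add_of_nonneg_left (by positivity))
    exact Finset.single_le_sum (f := fun i => |σ⁻¹| * ∫ z, |pd i w z|)
      (fun _ _ => by positivity) (Finset.mem_univ i)

lemma contDiff_avg {N : ℕ} {h : Euc N → ℝ} (hh : Continuous h) {σ : ℝ} (hσ : σ ≠ 0) (n : ℕ) :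
    ∀ {w : Euc N → ℝ}, ContDiff ℝ n w → (∀ z, 1 < ‖z‖ → w z = 0) → ContDiff ℝ n (avg w σ h) := by
  induction n with
  | zero =>
    intro w hw hw1
    exact contDiff_zero.2 ((continuous_avg hw.continuous hw1 hh).comp
      (by fun_prop : Continuous fun x : Euc N => (x, σ)))
  | succ n ih =>
    intro w hw hw1
    refine contDiff_succ_of_covec (d := fun i x => -σ⁻¹ * avg (pd i w) σ h x)
      (hasFDerivAt_avg_of_continuous (hw.of_le (by norm_cast; omega)) hw1 hh hσ) fun i => ?_
    exact contDiff_const.mul (ih (contDiff_pd hw (by norm_cast) i) (pd_zero_outside hw1 i))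

/-- The formal partial derivative of the potential `pot 0 R h`. -/
def dpot {N : ℕ} (i : Fin N) (R : ℝ) (h : Euc N → ℝ) (x : Euc N) : ℝ :=
  ∫ σ in 0..R, avg (fun z => kerR z * z i) σ h x

lemma continuous_kerR_mul {N : ℕ} (i : Fin N) : Continuous fun z : Euc N => kerR z * z i :=
  continuous_kerR.mul (by fun_prop)

lemma kerR_mul_eq_zero {N : ℕ} (i : Fin N) (z : Euc N) (hz : 1 < ‖z‖) : kerR z * z i = 0 := by
  rw [kerR_eq_zero z hz, zero_mul]

lemma continuous_dpot {N : ℕ} {h : Euc N → ℝ} (hh : Continuous h) (i : Fin N) (R : ℝ) :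
    Continuous (dpot i R h) := by
  unfold dpot
  refine intervalIntegral.continuous_parametric_intervalIntegral_of_continuous' ?_ 0 R
  exact continuous_avg (continuous_kerR_mul i) (kerR_mul_eq_zero i) hh

lemma continuous_pot {N : ℕ} {h : Euc N → ℝ} (hh : Continuous h) (a b : ℝ) :
    Continuous (pot a b h) := by
  unfold pot
  refine intervalIntegral.continuous_parametric_intervalIntegral_of_continuous' ?_ a b
  have := continuous_avg continuous_kerK (kerK_zero' (N := N)) hh
  exact (continuous_const.mul continuous_snd).mul this

lemma pot_sub {N : ℕ} {f g : Euc N → ℝ} (hf : Continuous f) (hg : Continuous g) (a b : ℝ)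
    (x : Euc N) : pot a b (fun y => f y - g y) x = pot a b f x - pot a b g x := by
  unfold pot
  rw [← intervalIntegral.integral_sub ((continuous_pot_integrand hf x).intervalIntegrable _ _)
    ((continuous_pot_integrand hg x).intervalIntegrable _ _)]
  congr 1; ext σ
  rw [avg_sub continuous_kerK kerK_zero' hf hg]
  ring

lemma dpot_sub {N : ℕ} {f g : Euc N → ℝ} (hf : Continuous f) (hg : Continuous g) (i : Fin N)
    (R : ℝ) (x : Euc N) : dpot i R (fun y => f y - g y) x = dpot i R f x - dpot i R g x := by
  have hc := fun {h : Euc N → ℝ} (hh : Continuous h) =>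
    continuous_avg_scale (continuous_kerR_mul i) (kerR_mul_eq_zero i) hh x
  unfold dpot
  rw [← intervalIntegral.integral_sub ((hc hf).intervalIntegrable _ _)
    ((hc hg).intervalIntegrable _ _)]
  congr 1; ext σ
  rw [avg_sub (continuous_kerR_mul i) (kerR_mul_eq_zero i) hf hg]

lemma abs_dpot_le {N : ℕ} {h : Euc N → ℝ} (i : Fin N) {R C : ℝ} (hR : 0 ≤ R)
    {x : Euc N} (hC : ∀ y ∈ closedBall x R, |h y| ≤ C) :
    |dpot i R h x| ≤ R * ((∫ z : Euc N, |kerR z * z i|) * C) := by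
  have := intervalIntegral.norm_integral_le_of_norm_le_const (a := 0) (b := R)
    (f := fun σ => avg (fun z => kerR z * z i) σ h x)
    (C := (∫ z : Euc N, |kerR z * z i|) * C) fun σ hσ => by
      rw [uIoc_of_le hR] at hσ
      refine abs_avg_le (continuous_kerR_mul i) (kerR_mul_eq_zero i) fun y hy => hC y ?_
      rw [abs_of_pos hσ.1] at hy
      exact closedBall_subset_closedBall hσ.2 hy
  rw [sub_zero, abs_of_nonneg hR, mul_comm] at this
  exact this

lemma abs_pot_le {N : ℕ} {h : Euc N → ℝ} {R C : ℝ} (hR : 0 ≤ R)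
    {x : Euc N} (hC : ∀ y ∈ closedBall x R, |h y| ≤ C) :
    |pot 0 R h x| ≤ 2 * R ^ 2 * ((∫ z : Euc N, |kerK z|) * C) := by
  have hC0 : 0 ≤ C := (abs_nonneg _).trans (hC x (mem_closedBall_self hR))
  have := intervalIntegral.norm_integral_le_of_norm_le_const (a := 0) (b := R)
    (f := fun σ => 2 * σ * avg kerK σ h x)
    (C := 2 * R * ((∫ z : Euc N, |kerK z|) * C)) fun σ hσ => by
      rw [uIoc_of_le hR] at hσ
      rw [Real.norm_eq_abs, abs_mul, abs_of_pos (by linarith [hσ.1] : 0 < 2 * σ)]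
      refine mul_le_mul (by linarith [hσ.2]) ?_ (abs_nonneg _) (by positivity)
      refine abs_avg_le continuous_kerK kerK_zero' fun y hy => hC y ?_
      rw [abs_of_pos hσ.1] at hy
      exact closedBall_subset_closedBall hσ.2 hy
  rw [sub_zero, abs_of_nonneg hR] at this
  refine this.trans (le_of_eq (by ring))

lemma hasFDerivAt_pot_of_contDiff {N : ℕ} {h : Euc N → ℝ} (hh : ContDiff ℝ 1 h) {R : ℝ}
    (hR : 0 ≤ R) (x : Euc N) : HasFDerivAt (pot 0 R h) (covec fun i => dpot i R h x) x := by
  have h1 : pot 0 R h = fun x => ∫ σ in Icc 0 R, 2 * σ * avg kerK σ h x := by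
    ext x
    rw [pot, intervalIntegral.integral_of_le hR, integral_Icc_eq_integral_Ioc]
  have hcK : ∀ {g : Euc N → ℝ}, Continuous g → Continuous fun p : Euc N × ℝ => avg kerK p.2 g p.1 :=
    fun hg => continuous_avg continuous_kerK (kerK_zero' (N := N)) hg
  have h2 := hasFDerivAt_setIntegral_param (μ := volume) (isCompact_Icc (a := (0 : ℝ)) (b := R))
    (F := fun (x : Euc N) σ => 2 * σ * avg kerK σ h x)
    (F' := fun x σ => covec fun i => avg (fun z => kerR z * z i) σ h x)
    (by
      exact (continuous_const.mul continuous_snd).mul (hcK hh.continuous))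
    (by
      unfold covec
      exact continuous_finsetSum _ fun i _ => (continuous_avg (continuous_kerR_mul i)
        (kerR_mul_eq_zero i) hh.continuous).smul continuous_const)
    (fun x σ => by
      have h1 := (hasFDerivAt_avg continuous_kerK kerK_zero' hh σ x).differentiableAt.hasFDerivAt
      have h3 := h1.const_mul (2 * σ)
      rw [fderiv_eq_covec] at h3
      refine h3.congr_fderiv (ContinuousLinearMap.ext fun y => ?_)
      simp only [covec_apply, smul_apply, smul_eq_mul, Finset.mul_sum]
      refine Finset.sum_congr rfl fun i _ => ?_
      rw [pd_avg continuous_kerK kerK_zero' hh, avg_kerR_mul hh]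
      ring) x
  rw [h1]
  refine h2.congr_fderiv (ContinuousLinearMap.ext fun y => ?_)
  have hint : ∀ i : Fin N, IntegrableOn (fun σ => avg (fun z => kerR z * z i) σ h x) (Icc 0 R) :=
    fun i => (continuous_avg_scale (continuous_kerR_mul i) (kerR_mul_eq_zero i)
      hh.continuous x).continuousOn.integrableOn_compact isCompact_Icc
  rw [ContinuousLinearMap.integral_apply]
  · simp only [covec_apply, dpot]
    rw [integral_finsetSum _ fun i _ => (hint i).mul_const _]
    refine Finset.sum_congr rfl fun i _ => ?_
    rw [intervalIntegral.integral_of_le hR, ← integral_Icc_eq_integral_Ioc, integral_mul_const]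
  · refine ContinuousOn.integrableOn_compact isCompact_Icc (Continuous.continuousOn ?_)
    unfold covec
    exact continuous_finsetSum _ fun i _ => (continuous_avg_scale (continuous_kerR_mul i)
      (kerR_mul_eq_zero i) hh.continuous x).smul continuous_const

lemma hasFDerivAt_pot {N : ℕ} {h : Euc N → ℝ} (hh : Continuous h) {R : ℝ}
    (hR : 0 ≤ R) (x : Euc N) : HasFDerivAt (pot 0 R h) (covec fun i => dpot i R h x) x := by
  revert x
  refine hasFDerivAt_covec_of_approx fun ε hε => ?_
  let A := 2 * R ^ 2 * (∫ z : Euc N, |kerK z|) + ∑ i, R * ∫ z : Euc N, |kerR z * z i|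
  have hA : 0 ≤ A := by positivity
  obtain ⟨g, hg, hgh⟩ := exists_smooth_approx hh (ε := ε / (A + 1)) (by positivity)
  have hε' : A * (ε / (A + 1)) ≤ ε := by
    rw [mul_div_assoc', div_le_iff₀ (by positivity)]
    nlinarith
  have hε0 : 0 ≤ ε / (A + 1) := by positivity
  refine ⟨pot 0 R g, fun i => dpot i R g, hasFDerivAt_pot_of_contDiff hg hR, fun x => ?_,
    fun i x => ?_⟩
  · rw [← pot_sub hg.continuous hh]
    refine (abs_pot_le hR fun y _ => hgh y).trans (le_trans ?_ hε')
    rw [← mul_assoc]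
    gcongr
    exact le_add_of_nonneg_right (by positivity)
  · rw [← dpot_sub hg.continuous hh]
    refine (abs_dpot_le i hR fun y _ => hgh y).trans (le_trans ?_ hε')
    rw [← mul_assoc]
    refine mul_le_mul_of_nonneg_right ?_ hε0
    refine le_trans ?_ (le_add_of_nonneg_left (by positivity))
    exact Finset.single_le_sum (f := fun i => R * ∫ z : Euc N, |kerR z * z i|)
      (fun _ _ => by positivity) (Finset.mem_univ i)

lemma pd_pot {N : ℕ} {h : Euc N → ℝ} (hh : Continuous h) {R : ℝ}
    (hR : 0 ≤ R) (i : Fin N) : pd i (pot 0 R h) = dpot i R h :=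
  funext fun x => pd_of_hasFDerivAt_covec (hasFDerivAt_pot hh hR x) i

lemma dpot_eq_pot {N : ℕ} {h : Euc N → ℝ} (hh : ContDiff ℝ 1 h) (i : Fin N) (R : ℝ) :
    dpot i R h = pot 0 R (pd i h) := by
  ext x
  simp only [dpot, pot, avg_kerR_mul hh]

lemma contDiff_pot {N : ℕ} {R : ℝ} (hR : 0 ≤ R) (n : ℕ) :
    ∀ {h : Euc N → ℝ}, ContDiff ℝ n h → ContDiff ℝ (n + 1 : ℕ) (pot 0 R h) := by
  induction n with
  | zero =>
    intro h hh
    exact contDiff_succ_of_covec (hasFDerivAt_pot hh.continuous hR) fun i =>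
      contDiff_zero.2 (continuous_dpot hh.continuous i R)
  | succ n ih =>
    intro h hh
    have hh1 : ContDiff ℝ 1 h := hh.of_le (by norm_cast; omega)
    refine contDiff_succ_of_covec (hasFDerivAt_pot hh.continuous hR) fun i => ?_
    rw [dpot_eq_pot hh1]
    exact ih (contDiff_pd hh (by norm_cast) i)

lemma contDiff_of_rep {N : ℕ} (hN : 0 < N) {U h : Euc N → ℝ} (hU : Continuous U)
    (hrep : ∀ x, kerM N * U x = avg kerR 1 U x + pot 0 1 h x) {n : ℕ} (hh : ContDiff ℝ n h) :
    ContDiff ℝ (n + 1 : ℕ) U := by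
  have : U = fun x => (kerM N)⁻¹ * (avg kerR 1 U x + pot 0 1 h x) := by
    ext x
    rw [← hrep, inv_mul_cancel_left₀ (kerM_pos hN).ne']
  rw [this]
  refine contDiff_const.mul (ContDiff.add ?_ (contDiff_pot zero_le_one n hh))
  exact contDiff_avg hU one_ne_zero _ (contDiff_kerR (n := ((n + 1 : ℕ) : ℕ∞))) kerR_eq_zero

lemma neg_lap_eq_of_rep {N : ℕ} {U h : Euc N → ℝ} (hU : ContDiff ℝ 2 U)
    (hh : Continuous h)
    (hrep : ∀ R ≥ 0, ∀ x, kerM N * U x = avg kerR R U x + pot 0 R h x) (x : Euc N) :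
    -lap U x = h x := by
  have hl : Continuous fun y => -lap U y := (continuous_lap hU).neg
  let g := fun y => -lap U y - h y
  have hg : Continuous g := hl.sub hh
  have h0 : ∀ R ≥ 0, pot 0 R g x = 0 := fun R hR => by
    rw [pot_sub hl hh]
    linarith [hrep R hR x, rep_global hU R x]
  have hc := continuous_pot_integrand hg x
  have hz : ∀ R > 0, avg kerK R g x = 0 := fun R hR => by
    have hd := (hc.integral_hasStrictDerivAt 0 R).hasDerivAt
    have hd0 : HasDerivAt (fun R => pot 0 R g x) 0 R := by
      refine (hasDerivAt_const R (0 : ℝ)).congr_of_eventuallyEq ?_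
      filter_upwards [lt_mem_nhds hR] with s hs
      exact h0 s hs.le
    have := hd.unique hd0
    have h2 : 2 * R ≠ 0 := by positivity
    exact (mul_eq_zero.1 this).resolve_left h2
  have hca := continuous_avg_scale continuous_kerK (kerK_zero' (N := N)) hg x
  have hlim : avg kerK 0 g x = 0 := by
    have h1 : Tendsto (fun σ => avg kerK σ g x) (𝓝[>] 0) (𝓝 (avg kerK 0 g x)) :=
      hca.continuousAt.tendsto.mono_left nhdsWithin_le_nhds
    have h2 : Tendsto (fun σ => avg kerK σ g x) (𝓝[>] 0) (𝓝 0) :=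
      tendsto_const_nhds.congr' (by
        filter_upwards [self_mem_nhdsWithin] with s hs
        exact (hz s hs).symm)
    exact tendsto_nhds_unique h1 h2
  rw [avg_zero_scale] at hlim
  have hpos : 0 < ∫ z : Euc N, kerK z :=
    continuous_kerK.integral_pos_of_hasCompactSupport_nonneg_nonzero
      (hasCompactSupport_of_zero kerK_zero') kerK_nonneg (x := 0) (by simp [kerK_eq_one])
  have := (mul_eq_zero.1 hlim).resolve_left hpos.ne'
  simp only [g] at this
  linarith

/-- Interior gradient estimate. -/
lemma exists_gradient_bound {N : ℕ} (hN : 0 < N) : ∃ C > 0, ∀ (U : Euc N → ℝ) (x : Euc N)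
    (r r' A B : ℝ), 0 < r → r < r' → ContDiffOn ℝ 2 U (ball x r') →
    (∀ y ∈ closedBall x r, |U y| ≤ A) → (∀ y ∈ closedBall x r, |lap U y| ≤ B) →
    ∀ i, |pd i U x| ≤ C * (A / r + r * B) := by
  let D := ∑ i : Fin N, ((∫ z : Euc N, |pd i kerR z|) + ∫ z : Euc N, |kerR z * z i|)
  have hD : 0 ≤ D := by positivity
  have hM := kerM_pos hN
  refine ⟨(D + 1) / kerM N, by positivity, ?_⟩
  intro U x r r' A B hr hrr hU hA hB i
  obtain ⟨V, hV, hVU, -⟩ := exists_global_ext hr.le hrr hU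
  have hA0 : 0 ≤ A := (abs_nonneg _).trans (hA x (mem_closedBall_self hr.le))
  have hB0 : 0 ≤ B := (abs_nonneg _).trans (hB x (mem_closedBall_self hr.le))
  have hl : Continuous fun y => -lap V y := (continuous_lap hV).neg
  have hR1 : ContDiff ℝ 1 (kerR (N := N)) := contDiff_kerR (n := 1)
  have hd : kerM N * pd i V x = -r⁻¹ * avg (pd i kerR) r V x + dpot i r (fun y => -lap V y) x := by
    have h1 := hasFDerivAt_avg_of_continuous hR1 kerR_eq_zero hV.continuous hr.ne' x
    have h2 := hasFDerivAt_pot hl hr.le x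
    have h3 : HasFDerivAt (fun x => kerM N * V x) _ x :=
      (((hV.differentiable (by norm_num)) x).hasFDerivAt).const_mul (kerM N)
    have h4 : (fun x => kerM N * V x)
        = fun x => avg kerR r V x + pot 0 r (fun y => -lap V y) x :=
      funext fun y => rep_global hV r y
    rw [h4] at h3
    have h5 := h3.unique (h1.add h2)
    have h6 := DFunLike.congr_fun h5 (EuclideanSpace.single i 1)
    simpa [covec_apply, pd] using h6
  have e1 : |avg (pd i kerR) r V x| ≤ (∫ z : Euc N, |pd i kerR z|) * A := by
    refine abs_avg_le (continuous_pd hR1 i) (pd_zero_outside kerR_eq_zero i) fun y hy => ?_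
    rw [abs_of_pos hr] at hy
    rw [(hVU y hy).eq_of_nhds]
    exact hA y hy
  have e2 : |dpot i r (fun y => -lap V y) x| ≤ r * ((∫ z : Euc N, |kerR z * z i|) * B) := by
    refine abs_dpot_le i hr.le fun y hy => ?_
    rw [abs_neg, lap_congr (hVU y hy)]
    exact hB y hy
  have hle : (∫ z : Euc N, |pd i kerR z|) + (∫ z : Euc N, |kerR z * z i|) ≤ D :=
    Finset.single_le_sum (f := fun i : Fin N => (∫ z : Euc N, |pd i kerR z|)
      + ∫ z : Euc N, |kerR z * z i|) (fun _ _ => by positivity) (Finset.mem_univ i)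
  have n1 : 0 ≤ ∫ z : Euc N, |pd i kerR z| := by positivity
  have n2 : 0 ≤ ∫ z : Euc N, |kerR z * z i| := by positivity
  have hpd : pd i U x = pd i V x := by
    rw [pd, pd, (hVU x (mem_closedBall_self hr.le)).fderiv_eq]
  have habs : |pd i V x| * kerM N = |kerM N * pd i V x| := by
    rw [abs_mul, abs_of_pos hM, mul_comm]
  rw [hpd, div_mul_eq_mul_div, le_div_iff₀ hM, habs, hd]
  refine (abs_add_le _ _).trans ?_
  rw [abs_mul, abs_neg, abs_of_pos (inv_pos.2 hr)]
  calc r⁻¹ * |avg (pd i kerR) r V x| + |dpot i r (fun y => -lap V y) x|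
      ≤ r⁻¹ * ((D + 1) * A) + r * ((D + 1) * B) := by
        refine add_le_add (mul_le_mul_of_nonneg_left (e1.trans ?_) (inv_pos.2 hr).le)
          (e2.trans ?_)
        · exact mul_le_mul_of_nonneg_right (by linarith) hA0
        · exact mul_le_mul_of_nonneg_left (mul_le_mul_of_nonneg_right (by linarith) hB0) hr.le
    _ = (D + 1) * (A / r + r * B) := by
        field_simp

/-- Continuous (equivalently, locally uniform) convergence of a sequence of functions. -/
def LocConv {N : ℕ} (f : ℕ → Euc N → ℝ) (g : Euc N → ℝ) : Prop :=
  ∀ x, Tendsto (fun p : ℕ × Euc N => f p.1 p.2) (atTop ×ˢ 𝓝 x) (𝓝 (g x))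

lemma LocConv.eventually_le {N : ℕ} {f : ℕ → Euc N → ℝ} {g : Euc N → ℝ} (h : LocConv f g)
    (hg : Continuous g) {K : Set (Euc N)} (hK : IsCompact K) {ε : ℝ} (hε : 0 < ε) :
    ∀ᶠ n in atTop, ∀ y ∈ K, |f n y - g y| ≤ ε := by
  have h1 : {p : ℕ × Euc N | |f p.1 p.2 - g p.2| ≤ ε} ∈ atTop ×ˢ 𝓝ˢ K := by
    refine hK.mem_prod_nhdsSet_of_forall fun x _ => ?_
    have h2 : Tendsto (fun p : ℕ × Euc N => |f p.1 p.2 - g p.2|) (atTop ×ˢ 𝓝 x) (𝓝 |g x - g x|) :=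
      ((h x).sub ((hg.tendsto x).comp tendsto_snd)).abs
    rw [sub_self, abs_zero] at h2
    exact (h2.eventually_lt_const hε).mono fun _ hp => hp.le
  obtain ⟨s, hs, t, ht, hst⟩ := mem_prod_iff.1 h1
  filter_upwards [hs] with n hn y hy
  exact hst (mk_mem_prod hn (subset_of_mem_nhdsSet ht hy))

lemma eventually_mem_ball {N : ℕ} {r : ℕ → ℝ} (hr : Tendsto r atTop atTop) (x : Euc N) :
    ∀ᶠ p : ℕ × Euc N in atTop ×ˢ 𝓝 x, p.2 ∈ ball (0 : Euc N) (r p.1) := by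
  refine ((hr.eventually_gt_atTop (‖x‖ + 1)).prod_mk (ball_mem_nhds x one_pos)).mono ?_
  rintro ⟨n, y⟩ ⟨h1, h2⟩
  simp only [mem_ball, dist_zero_right] at h2 ⊢
  have : ‖y‖ ≤ ‖x‖ + dist y x := by
    rw [dist_eq_norm]
    simpa using norm_add_le x (y - x)
  simp only at h1
  have h3 : dist y x < 1 := h2
  linarith

lemma LocConv.congr {N : ℕ} {f f' : ℕ → Euc N → ℝ} {g : Euc N → ℝ} (h : LocConv f g) {r : ℕ → ℝ}
    (hr : Tendsto r atTop atTop) (hff : ∀ n, ∀ y ∈ ball (0 : Euc N) (r n), f n y = f' n y) :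
    LocConv f' g := fun x => by
  refine (h x).congr' ?_
  filter_upwards [eventually_mem_ball hr x] with p hp
  exact hff p.1 p.2 hp

lemma LocConv.comp_strictMono {N : ℕ} {f : ℕ → Euc N → ℝ} {g : Euc N → ℝ} (h : LocConv f g)
    {φ : ℕ → ℕ} (hφ : StrictMono φ) : LocConv (fun n => f (φ n)) g := fun x =>
  (h x).comp ((hφ.tendsto_atTop).prodMap tendsto_id)

lemma LocConv.tendsto_at {N : ℕ} {f : ℕ → Euc N → ℝ} {g : Euc N → ℝ} (h : LocConv f g)
    (x : Euc N) : Tendsto (fun n => f n x) atTop (𝓝 (g x)) :=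
  (h x).comp (tendsto_id.prodMk (tendsto_const_nhds : Tendsto (fun _ : ℕ => x) atTop (𝓝 x)))

open scoped NNReal in
lemma isCompact_lipschitz {N : ℕ} (L : ℝ≥0) (B : ℝ) :
    IsCompact {f : C(Euc N, ℝ) | LipschitzWith L f ∧ |f 0| ≤ B} := by
  refine ArzelaAscoli.isCompact_of_equicontinuous _ ?_ ?_
  · have himg : ContinuousMap.toFun '' {f : C(Euc N, ℝ) | LipschitzWith L f ∧ |f 0| ≤ B}
        = {f : Euc N → ℝ | LipschitzWith L f ∧ |f 0| ≤ B} := by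
      ext f
      constructor
      · rintro ⟨g, hg, rfl⟩
        exact hg
      · intro hf
        exact ⟨⟨f, hf.1.continuous⟩, hf, rfl⟩
    rw [himg]
    refine (isCompact_univ_pi fun x : Euc N => isCompact_Icc (a := -(B + L * ‖x‖))
      (b := B + L * ‖x‖)).of_isClosed_subset ?_ ?_
    · simp only [lipschitzWith_iff_dist_le_mul, ofPred_and, ofPred_forall]
      refine IsClosed.inter ?_ ?_
      · refine isClosed_iInter fun x => isClosed_iInter fun y => isClosed_le ?_ continuous_const
        exact (continuous_apply x).dist (continuous_apply y)
      · exact isClosed_le (continuous_apply 0).abs continuous_const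
    · rintro f ⟨h1, h2⟩ x -
      have h3 := h1.dist_le_mul x 0
      rw [Real.dist_eq, dist_zero_right] at h3
      refine abs_le.1 ?_
      calc |f x| = |(f x - f 0) + f 0| := by ring_nf
        _ ≤ |f x - f 0| + |f 0| := abs_add_le _ _
        _ ≤ _ := by linarith
  · exact (LipschitzWith.uniformEquicontinuous _ L fun f => f.2.1).equicontinuous

open scoped NNReal in
lemma exists_locConv_subseq {N : ℕ} {U : ℕ → Euc N → ℝ} {r : ℕ → ℝ} (hr : Tendsto r atTop atTop)
    {L : ℝ≥0} {B : ℝ} (hL : ∀ n, LipschitzOnWith L (U n) (ball 0 (r n)))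
    (hB : ∀ n, ∀ y ∈ ball (0 : Euc N) (r n), |U n y| ≤ B) :
    ∃ (φ : ℕ → ℕ) (g : Euc N → ℝ), StrictMono φ ∧ Continuous g ∧
      LocConv (fun n => U (φ n)) g := by
  choose V hV hVU using fun n => (hL n).extend_real
  obtain ⟨n₀, hn₀⟩ := eventually_atTop.1 (hr.eventually_gt_atTop 0)
  let F : ℕ → C(Euc N, ℝ) := fun n => ⟨V (n + n₀), (hV _).continuous⟩
  have hF : ∀ n, F n ∈ {f : C(Euc N, ℝ) | LipschitzWith L f ∧ |f 0| ≤ B} := fun n => by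
    have h0 : (0 : Euc N) ∈ ball (0 : Euc N) (r (n + n₀)) :=
      mem_ball_self (hn₀ _ (Nat.le_add_left _ _))
    refine ⟨hV _, ?_⟩
    change |V (n + n₀) 0| ≤ B
    rw [← hVU (n + n₀) h0]
    exact hB _ _ h0
  obtain ⟨g, -, φ, hφ, hlim⟩ := (isCompact_lipschitz L B).tendsto_subseq hF
  have hφ' : StrictMono fun n => φ n + n₀ := fun a b hab => Nat.add_lt_add_right (hφ hab) n₀
  refine ⟨fun n => φ n + n₀, g, hφ', g.continuous, ?_⟩
  have h1 : LocConv (fun n => V (φ n + n₀)) g := fun x => by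
    have h2 : Tendsto (fun p : C(Euc N, ℝ) × Euc N => p.1 p.2) (𝓝 g ×ˢ 𝓝 x) (𝓝 (g x)) := by
      rw [← nhds_prod_eq]
      exact (continuous_eval (F := C(Euc N, ℝ))).tendsto (g, x)
    exact h2.comp (hlim.prodMap tendsto_id)
  refine h1.congr (hr.comp hφ'.tendsto_atTop) fun n y hy => ?_
  exact (hVU _ hy).symm

lemma rep_limit {N : ℕ} {U : ℕ → Euc N → ℝ} {r : ℕ → ℝ} (hr : Tendsto r atTop atTop)
    (hU : ∀ n, ContDiffOn ℝ 2 (U n) (ball 0 (r n))) {G h : Euc N → ℝ} (hG : Continuous G)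
    (hh : Continuous h) (hUG : LocConv U G) (hlap : LocConv (fun n y => -lap (U n) y) h)
    {R : ℝ} (hR : 0 ≤ R) (x : Euc N) :
    kerM N * G x = avg kerR R G x + pot 0 R h x := by
  refine eq_of_forall_dist_le fun ε hε => ?_
  let A := kerM N + (∫ z : Euc N, |kerR z|) + 2 * R ^ 2 * ∫ z : Euc N, |kerK z|
  have hM : 0 ≤ kerM N := integral_nonneg kerR_nonneg
  have hA : 0 ≤ A := by positivity
  let δ := ε / (A + 1)
  have hδ : 0 < δ := by positivity
  have hε' : A * δ ≤ ε := by
    simp only [δ]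
    rw [mul_div_assoc', div_le_iff₀ (by positivity)]
    nlinarith
  obtain ⟨n, h1, h2, h3⟩ := ((hUG.eventually_le hG (isCompact_closedBall x R) hδ).and
    ((hlap.eventually_le hh (isCompact_closedBall x R) hδ).and
    (hr.eventually_gt_atTop (‖x‖ + R + 1)))).exists
  have hsub : ball x (R + 1) ⊆ ball 0 (r n) := by
    refine ball_subset_ball' ?_
    rw [dist_zero_right]
    linarith
  obtain ⟨V, hV, hVU, -⟩ := exists_global_ext hR (lt_add_one R) ((hU n).mono hsub)
  have hl : Continuous fun y => -lap V y := (continuous_lap hV).neg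
  have hx := mem_closedBall_self (x := x) hR
  have e1 : |V x - G x| ≤ δ := by
    rw [(hVU x hx).eq_of_nhds]
    exact h1 x hx
  have e2 : |avg kerR R V x - avg kerR R G x| ≤ (∫ z : Euc N, |kerR z|) * δ := by
    rw [← avg_sub continuous_kerR kerR_eq_zero hV.continuous hG]
    refine abs_avg_le continuous_kerR kerR_eq_zero fun y hy => ?_
    rw [abs_of_nonneg hR] at hy
    rw [(hVU y hy).eq_of_nhds]
    exact h1 y hy
  have e3 : |pot 0 R (fun y => -lap V y) x - pot 0 R h x|
      ≤ 2 * R ^ 2 * ((∫ z : Euc N, |kerK z|) * δ) := by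
    rw [← pot_sub hl hh]
    refine abs_pot_le hR fun y hy => ?_
    rw [lap_congr (hVU y hy)]
    exact h2 y hy
  have h4 := rep_global hV R x
  have e1' : |kerM N * V x - kerM N * G x| ≤ kerM N * δ := by
    rw [← mul_sub, abs_mul, abs_of_nonneg hM]
    exact mul_le_mul_of_nonneg_left e1 hM
  rw [Real.dist_eq]
  refine le_trans ?_ hε'
  simp only [A]
  rw [abs_le] at e1' e2 e3 ⊢
  constructor <;> nlinarith

lemma pot_pos {N : ℕ} {h : Euc N → ℝ} (hh : Continuous h) (h0 : ∀ y, 0 ≤ h y) {x y : Euc N}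
    (hy : 0 < h y) {R : ℝ} (hR : dist y x < R) : 0 < pot 0 R h x := by
  have hR0 : 0 < R := dist_nonneg.trans_lt hR
  refine intervalIntegral.integral_pos hR0 (continuous_pot_integrand hh x).continuousOn
    (fun σ hσ => ?_) ⟨R, ⟨hR0.le, le_rfl⟩, ?_⟩
  · have : 0 ≤ avg kerK σ h x := integral_nonneg fun z => mul_nonneg (kerK_nonneg z) (h0 _)
    have := hσ.1
    positivity
  · have : 0 < avg kerK R h x := by
      refine Continuous.integral_pos_of_hasCompactSupport_nonneg_nonzero (x := R⁻¹ • (y - x)) ?_ ?_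
        (fun z => mul_nonneg (kerK_nonneg z) (h0 _)) ?_
      · have := continuous_kerK (N := N)
        fun_prop
      · exact (hasCompactSupport_of_zero kerK_zero').mul_right
      · rw [smul_inv_smul₀ hR0.ne', add_sub_cancel]
        refine (mul_pos (kerK_pos ?_) hy).ne'
        rw [norm_smul, norm_inv, Real.norm_eq_abs, abs_of_pos hR0, ← dist_eq_norm]
        rw [inv_mul_lt_iff₀ hR0]
        simpa using hR
    positivity

lemma eq_zero_of_rep {N : ℕ} {U h : Euc N → ℝ} (hU0 : ∀ y, 0 ≤ U y)
    (hh : Continuous h) (h0 : ∀ y, 0 ≤ h y)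
    (hrep : ∀ R ≥ 0, ∀ x, kerM N * U x = avg kerR R U x + pot 0 R h x) {x : Euc N} (hx : U x = 0)
    (y : Euc N) : h y = 0 := by
  by_contra hne
  have hy : 0 < h y := lt_of_le_of_ne (h0 y) (Ne.symm hne)
  have h1 := pot_pos hh h0 hy (lt_add_one (dist y x))
  have h2 := hrep (dist y x + 1) (by positivity) x
  have h3 : 0 ≤ avg kerR (dist y x + 1) U x :=
    integral_nonneg fun z => mul_nonneg (kerR_nonneg z) (hU0 _)
  rw [hx, mul_zero] at h2
  linarith

lemma exists_lipschitz {N : ℕ} (hN : 0 < N) (A B : ℝ) : ∃ L : NNReal, ∀ (U : Euc N → ℝ) (r : ℝ),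
    ContDiffOn ℝ 2 U (ball 0 r) → (∀ y ∈ ball (0 : Euc N) r, |U y| ≤ A) →
    (∀ y ∈ ball (0 : Euc N) r, |lap U y| ≤ B) → LipschitzOnWith L U (ball 0 (r - 1)) := by
  obtain ⟨C, hC, hgrad⟩ := exists_gradient_bound hN
  refine ⟨Real.toNNReal (N * |C * (A / (1 / 2) + 1 / 2 * B)|), fun U r hU hA hB => ?_⟩
  have hsub : ∀ x ∈ ball (0 : Euc N) (r - 1), ball x 1 ⊆ ball 0 r := fun x hx => by
    refine ball_subset_ball' ?_
    have : dist x 0 < r - 1 := hx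
    linarith
  refine (convex_ball _ _).lipschitzOnWith_of_nnnorm_fderiv_le (𝕜 := ℝ) (fun x hx => ?_)
    fun x hx => ?_
  · exact (hU.contDiffAt (isOpen_ball.mem_nhds (hsub x hx (mem_ball_self one_pos)))).differentiableAt
      (by norm_num)
  · have hc : closedBall x (1 / 2) ⊆ ball x 1 := closedBall_subset_ball (by norm_num)
    have h1 := hgrad U x (1 / 2) 1 A B (by norm_num) (by norm_num) (hU.mono (hsub x hx))
      (fun y hy => hA y (hsub x hx (hc hy))) (fun y hy => hB y (hsub x hx (hc hy)))
    rw [← NNReal.coe_le_coe, coe_nnnorm, Real.coe_toNNReal _ (by positivity), fderiv_eq_covec]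
    exact norm_covec_le (abs_nonneg _) fun i => (h1 i).trans (le_abs_self _)

/-- Compactness for bounded sequences of solutions of asymptotically Lane–Emden systems. -/
lemma exists_limit_solution {N : ℕ} (hN : 0 < N) {p q c d : ℝ} (hp : 0 < p) (hq : 0 < q)
    (hc : 0 < c) (hd : 0 < d) {U V F G : ℕ → Euc N → ℝ} {r : ℕ → ℝ} (hr : Tendsto r atTop atTop)
    {A B : ℝ}
    (hU : ∀ n, ContDiffOn ℝ 2 (U n) (ball 0 (r n))) (hV : ∀ n, ContDiffOn ℝ 2 (V n) (ball 0 (r n)))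
    (hU0 : ∀ n y, 0 ≤ U n y) (hV0 : ∀ n y, 0 ≤ V n y)
    (hUA : ∀ n, ∀ y ∈ ball (0 : Euc N) (r n), U n y ≤ A)
    (hVA : ∀ n, ∀ y ∈ ball (0 : Euc N) (r n), V n y ≤ A)
    (hF : LocConv F fun _ => 1) (hG : LocConv G fun _ => 1)
    (hFB : ∀ n, ∀ y ∈ ball (0 : Euc N) (r n), |F n y| ≤ B)
    (hGB : ∀ n, ∀ y ∈ ball (0 : Euc N) (r n), |G n y| ≤ B)
    (hlU : ∀ n, ∀ y ∈ ball (0 : Euc N) (r n), -lap (U n) y = F n y * V n y ^ p)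
    (hlV : ∀ n, ∀ y ∈ ball (0 : Euc N) (r n), -lap (V n) y = G n y * U n y ^ q)
    (hnorm : ∀ n, U n 0 ^ c + V n 0 ^ d = 1) :
    ∃ (φ : ℕ → ℕ) (u v : Euc N → ℝ), StrictMono φ ∧ ContDiff ℝ (⊤ : ℕ∞) u ∧
      ContDiff ℝ (⊤ : ℕ∞) v ∧ (∀ x, 0 < u x) ∧ (∀ x, 0 < v x) ∧ (∀ x, u x ≤ A) ∧
      (∀ x, v x ≤ A) ∧ IsLESol p q u v ∧
      LocConv (fun n => U (φ n)) u ∧ LocConv (fun n => V (φ n)) v := by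
  have lapbound : ∀ {X Y E : ℕ → Euc N → ℝ} {s : ℝ}, 0 < s → (∀ n y, 0 ≤ Y n y) →
      (∀ n, ∀ y ∈ ball (0 : Euc N) (r n), Y n y ≤ A) →
      (∀ n, ∀ y ∈ ball (0 : Euc N) (r n), |E n y| ≤ B) →
      (∀ n, ∀ y ∈ ball (0 : Euc N) (r n), -lap (X n) y = E n y * Y n y ^ s) →
      ∀ n, ∀ y ∈ ball (0 : Euc N) (r n), |lap (X n) y| ≤ B * A ^ s := by
    intro X Y E s hs hY0 hYA hE hl n y hy
    rw [← abs_neg, hl n y hy, abs_mul, abs_of_nonneg (Real.rpow_nonneg (hY0 n y) s)]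
    exact mul_le_mul (hE n y hy) (Real.rpow_le_rpow (hY0 n y) (hYA n y hy) hs.le)
      (Real.rpow_nonneg (hY0 n y) s) ((abs_nonneg _).trans (hE n y hy))
  obtain ⟨L₁, hL₁⟩ := exists_lipschitz hN A (B * A ^ p)
  obtain ⟨L₂, hL₂⟩ := exists_lipschitz hN A (B * A ^ q)
  have hr1 : Tendsto (fun n => r n - 1) atTop atTop := tendsto_atTop_add_const_right _ _ hr
  have hsub : ∀ n, ball (0 : Euc N) (r n - 1) ⊆ ball 0 (r n) := fun n =>
    ball_subset_ball (by linarith)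
  have habsU : ∀ n, ∀ y ∈ ball (0 : Euc N) (r n), |U n y| ≤ A := fun n y hy => by
    rw [abs_of_nonneg (hU0 n y)]; exact hUA n y hy
  have habsV : ∀ n, ∀ y ∈ ball (0 : Euc N) (r n), |V n y| ≤ A := fun n y hy => by
    rw [abs_of_nonneg (hV0 n y)]; exact hVA n y hy
  obtain ⟨φ₁, u, hφ₁, hu, hUu⟩ := exists_locConv_subseq hr1
    (fun n => hL₁ (U n) (r n) (hU n) (habsU n) (lapbound hp hV0 hVA hFB hlU n))
    (fun n y hy => habsU n y (hsub n hy))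
  obtain ⟨φ₂, v, hφ₂, hv, hVv⟩ := exists_locConv_subseq (hr1.comp hφ₁.tendsto_atTop)
    (fun n => hL₂ (V (φ₁ n)) (r (φ₁ n)) (hV _) (habsV _) (lapbound hq hU0 hUA hGB hlV _))
    (fun n y hy => habsV _ y (hsub _ hy))
  have hφ : StrictMono fun n => φ₁ (φ₂ n) := hφ₁.comp hφ₂
  have hUu' : LocConv (fun n => U (φ₁ (φ₂ n))) u := hUu.comp_strictMono hφ₂
  have hrφ : Tendsto (fun n => r (φ₁ (φ₂ n))) atTop atTop := hr.comp hφ.tendsto_atTop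
  have hu0 : ∀ x, 0 ≤ u x := fun x => ge_of_tendsto' (hUu'.tendsto_at x) fun n => hU0 _ x
  have hv0 : ∀ x, 0 ≤ v x := fun x => ge_of_tendsto' (hVv.tendsto_at x) fun n => hV0 _ x
  have hmem : ∀ x : Euc N, ∀ᶠ n in atTop, x ∈ ball (0 : Euc N) (r (φ₁ (φ₂ n))) := fun x => by
    filter_upwards [hrφ.eventually_gt_atTop ‖x‖] with n hn
    simpa using hn
  have huA : ∀ x, u x ≤ A := fun x => le_of_tendsto (hUu'.tendsto_at x)
    ((hmem x).mono fun n hn => hUA _ x hn)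
  have hvA : ∀ x, v x ≤ A := fun x => le_of_tendsto (hVv.tendsto_at x)
    ((hmem x).mono fun n hn => hVA _ x hn)
  have hvp : Continuous fun x => v x ^ p := hv.rpow_const fun x => Or.inr hp.le
  have huq : Continuous fun x => u x ^ q := hu.rpow_const fun x => Or.inr hq.le
  have hlU' : LocConv (fun n y => -lap (U (φ₁ (φ₂ n))) y) fun x => v x ^ p := by
    have h1 : LocConv (fun n y => F (φ₁ (φ₂ n)) y * V (φ₁ (φ₂ n)) y ^ p) fun x => v x ^ p := by
      intro x
      simpa using (hF.comp_strictMono hφ x).mul ((hVv x).rpow_const (Or.inr hp.le))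
    exact h1.congr hrφ fun n y hy => (hlU _ y hy).symm
  have hlV' : LocConv (fun n y => -lap (V (φ₁ (φ₂ n))) y) fun x => u x ^ q := by
    have h1 : LocConv (fun n y => G (φ₁ (φ₂ n)) y * U (φ₁ (φ₂ n)) y ^ q) fun x => u x ^ q := by
      intro x
      simpa using (hG.comp_strictMono hφ x).mul ((hUu' x).rpow_const (Or.inr hq.le))
    exact h1.congr hrφ fun n y hy => (hlV _ y hy).symm
  have repU : ∀ R ≥ 0, ∀ x, kerM N * u x = avg kerR R u x + pot 0 R (fun x => v x ^ p) x :=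
    fun R hR x => rep_limit hrφ (fun n => hU _) hu hvp hUu' hlU' hR x
  have repV : ∀ R ≥ 0, ∀ x, kerM N * v x = avg kerR R v x + pot 0 R (fun x => u x ^ q) x :=
    fun R hR x => rep_limit hrφ (fun n => hV _) hv huq hVv hlV' hR x
  have hvp0 : ∀ x, 0 ≤ v x ^ p := fun x => Real.rpow_nonneg (hv0 x) p
  have huq0 : ∀ x, 0 ≤ u x ^ q := fun x => Real.rpow_nonneg (hu0 x) q
  have hnorm' : u 0 ^ c + v 0 ^ d = 1 := by
    have h1 := ((hUu'.tendsto_at 0).rpow_const (Or.inr hc.le)).add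
      ((hVv.tendsto_at 0).rpow_const (Or.inr hd.le) : Tendsto _ _ (𝓝 (v 0 ^ d)))
    exact tendsto_nhds_unique h1 (tendsto_const_nhds.congr fun n => (hnorm _).symm)
  have hnot : ¬ ((∀ x, u x = 0) ∧ ∀ x, v x = 0) := fun ⟨h1, h2⟩ => by
    rw [h1, h2, Real.zero_rpow hc.ne', Real.zero_rpow hd.ne'] at hnorm'
    norm_num at hnorm'
  have hzv : ∀ x, u x = 0 → ∀ y, v y = 0 := fun x hx y =>
    (Real.rpow_eq_zero (hv0 y) hp.ne').1 (eq_zero_of_rep hu0 hvp hvp0 repU hx y)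
  have hzu : ∀ x, v x = 0 → ∀ y, u y = 0 := fun x hx y =>
    (Real.rpow_eq_zero (hu0 y) hq.ne').1 (eq_zero_of_rep hv0 huq huq0 repV hx y)
  have hupos : ∀ x, 0 < u x := fun x => lt_of_le_of_ne (hu0 x) fun h =>
    hnot ⟨hzu x (hzv x h.symm x), hzv x h.symm⟩
  have hvpos : ∀ x, 0 < v x := fun x => lt_of_le_of_ne (hv0 x) fun h =>
    hnot ⟨hzu x h.symm, hzv x (hzu x h.symm x)⟩
  have hsm : ∀ n : ℕ, ContDiff ℝ n u ∧ ContDiff ℝ n v := by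
    intro n
    induction n with
    | zero => exact ⟨contDiff_zero.2 hu, contDiff_zero.2 hv⟩
    | succ n ih =>
      exact ⟨contDiff_of_rep hN hu (repU 1 zero_le_one)
          (ih.2.rpow_const_of_ne fun x => (hvpos x).ne'),
        contDiff_of_rep hN hv (repV 1 zero_le_one)
          (ih.1.rpow_const_of_ne fun x => (hupos x).ne')⟩
  have habs : ∀ {t s : ℝ}, 0 < t → t ^ s = |t| ^ (s - 1) * t := fun {t s} ht => by
    rw [abs_of_pos ht, Real.rpow_sub_one ht.ne']
    field_simp
  refine ⟨_, u, v, hφ, contDiff_infty.2 fun n => (hsm n).1, contDiff_infty.2 fun n => (hsm n).2,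
    hupos, hvpos, huA, hvA, ⟨fun x => ?_, fun x => ?_⟩, hUu', hVv⟩
  · rw [neg_lap_eq_of_rep (hsm 2).1 hvp repU x, habs (hvpos x)]
  · rw [neg_lap_eq_of_rep (hsm 2).2 huq repV x, habs (hupos x)]

lemma pot_mono {N : ℕ} {f g : Euc N → ℝ} (hf : Continuous f) (hg : Continuous g) {S : ℝ}
    (hS : 0 ≤ S) {x : Euc N} (h : ∀ y ∈ closedBall x S, f y ≤ g y) :
    pot 0 S f x ≤ pot 0 S g x := by
  refine intervalIntegral.integral_mono_on hS
    ((continuous_pot_integrand hf x).intervalIntegrable _ _)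
    ((continuous_pot_integrand hg x).intervalIntegrable _ _) fun σ hσ => ?_
  refine mul_le_mul_of_nonneg_left ?_ (by linarith [hσ.1])
  refine avg_mono continuous_kerK kerK_nonneg kerK_zero' hf hg fun y hy => h y ?_
  rw [abs_of_nonneg hσ.1] at hy
  exact closedBall_subset_closedBall hσ.2 hy

lemma avg_kerK_nonneg {N : ℕ} {h : Euc N → ℝ} (h0 : ∀ y, 0 ≤ h y) (σ : ℝ) (x : Euc N) :
    0 ≤ avg kerK σ h x :=
  integral_nonneg fun _ => mul_nonneg (kerK_nonneg _) (h0 _)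

lemma pot_nonneg {N : ℕ} {h : Euc N → ℝ} (h0 : ∀ y, 0 ≤ h y) {S : ℝ} (hS : 0 ≤ S) (x : Euc N) :
    0 ≤ pot 0 S h x :=
  intervalIntegral.integral_nonneg hS fun σ hσ =>
    mul_nonneg (by linarith [hσ.1]) (avg_kerK_nonneg h0 σ x)

lemma pot_const_mul {N : ℕ} (a b c : ℝ) (h : Euc N → ℝ) (x : Euc N) :
    pot a b (fun y => c * h y) x = c * pot a b h x := by
  unfold pot
  rw [← intervalIntegral.integral_const_mul]
  congr 1
  ext σ
  rw [avg_const_mul]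
  ring

lemma neg_lap_pot {N : ℕ} {h : Euc N → ℝ} (hh : ContDiff ℝ 1 h) {R : ℝ} (hR : 0 ≤ R)
    (x : Euc N) : -lap (pot 0 R h) x = kerM N * h x - avg kerR R h x := by
  have h2 : ContDiff ℝ 2 (pot 0 R h) := by
    simpa using contDiff_pot hR 1 (h := h) (by simpa using hh)
  have hpd : ∀ i, pd i (pd i (pot 0 R h)) x = dpot i R (pd i h) x := fun i => by
    rw [pd_pot hh.continuous hR, dpot_eq_pot hh, pd_pot (continuous_pd hh i) hR]
  have hc : ∀ i, Continuous fun σ => avg (fun z => kerR z * z i) σ (pd i h) x := fun i =>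
    continuous_avg_scale (continuous_kerR_mul i) (kerR_mul_eq_zero i) (continuous_pd hh i) x
  have hint := intervalIntegral.integral_eq_sub_of_hasDerivAt
    (fun σ _ => hasDerivAt_avg_scale continuous_kerR kerR_eq_zero hh σ x)
    ((continuous_finsetSum _ fun i _ => hc i).intervalIntegrable 0 R)
  rw [lap_eq_sum_pd h2.contDiffAt, Finset.sum_congr rfl fun i _ => hpd i]
  unfold dpot
  rw [← intervalIntegral.integral_finsetSum fun i _ => (hc i).intervalIntegrable 0 R, hint,
    avg_zero_scale]
  unfold kerM
  ring

lemma avg_kerR_eq_zero {N : ℕ} {h : Euc N → ℝ} {r S : ℝ}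
    (hs : ∀ y, r < ‖y‖ → h y = 0) {x : Euc N} (hx : ‖x‖ ≤ r) (hS : 0 ≤ S) (hrS : 4 * r < S) :
    avg kerR S h x = 0 := by
  refine integral_eq_zero_of_ae (Eventually.of_forall fun z => ?_)
  rcases lt_or_ge ‖z‖ (1 / 2) with hz | hz
  · simp [kerR_eq_zero_of_lt z hz]
  · have h1 : ‖S • z‖ ≤ ‖x + S • z‖ + ‖x‖ := by
      have := norm_sub_le (x + S • z) x
      simpa using this
    rw [norm_smul, Real.norm_of_nonneg hS] at h1
    have h2 : S * (1 / 2) ≤ S * ‖z‖ := mul_le_mul_of_nonneg_left hz hS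
    have h3 : h (x + S • z) = 0 := hs _ (by linarith)
    simp [h3]

lemma integral_comp_affine {N : ℕ} (h : Euc N → ℝ) (x : Euc N) {σ : ℝ} (hσ : 0 < σ) :
    ∫ z, h (x + σ • z) = (∫ z, h z) / σ ^ N := by
  have h1 := Measure.integral_comp_smul (volume : Measure (Euc N)) (fun y => h (x + y)) σ
  rw [h1, integral_add_left_eq_self (μ := (volume : Measure (Euc N))) h x, finrank_euclideanSpace]
  simp only [Fintype.card_fin, smul_eq_mul]
  rw [abs_of_nonneg (by positivity)]
  field_simp

lemma integrable_comp_affine {N : ℕ} {h : Euc N → ℝ} (hh : Continuous h) {r : ℝ}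
    (hs : ∀ y, r < ‖y‖ → h y = 0) (x : Euc N) {σ : ℝ} (hσ : 0 < σ) :
    Integrable fun z => h (x + σ • z) := by
  have hi : Integrable h := hh.integrable_of_hasCompactSupport
    (HasCompactSupport.intro (isCompact_closedBall 0 r) fun y hy => hs y (by simpa using hy))
  exact (hi.comp_add_left x).comp_smul hσ.ne'

lemma avg_kerK_le_integral {N : ℕ} {h : Euc N → ℝ} (hh : Continuous h) (h0 : ∀ y, 0 ≤ h y) {r : ℝ}
    (hs : ∀ y, r < ‖y‖ → h y = 0) (x : Euc N) {σ : ℝ} (hσ : 0 < σ) :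
    avg kerK σ h x ≤ (∫ z, h z) / σ ^ N := by
  rw [← integral_comp_affine h x hσ]
  refine integral_mono (avg_integrable continuous_kerK kerK_zero' hh σ x)
    (integrable_comp_affine hh hs x hσ) fun z => ?_
  exact mul_le_of_le_one_left (h0 _) (kerK_le_one z)

lemma integral_le_pot {N : ℕ} {h : Euc N → ℝ} (hh : Continuous h) (h0 : ∀ y, 0 ≤ h y) {r S : ℝ}
    (hs : ∀ y, r < ‖y‖ → h y = 0) {x : Euc N} (hx : ‖x‖ ≤ r) (hS : 0 < S) (hrS : 8 * r ≤ S) :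
    S ^ 2 / 2 / S ^ N * (∫ z, h z) ≤ pot 0 S h x := by
  have hI : 0 ≤ ∫ z, h z := integral_nonneg h0
  have hcont := continuous_pot_integrand hh x
  have hsplit : pot 0 S h x = (∫ σ in (0 : ℝ)..S / 2, 2 * σ * avg kerK σ h x)
      + ∫ σ in S / 2..S, 2 * σ * avg kerK σ h x :=
    (intervalIntegral.integral_add_adjacent_intervals
      (hcont.intervalIntegrable _ _) (hcont.intervalIntegrable _ _)).symm
  have h1 : 0 ≤ ∫ σ in (0 : ℝ)..S / 2, 2 * σ * avg kerK σ h x :=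
    pot_nonneg h0 (by positivity) x
  have h2 : (∫ σ in S / 2..S, S / S ^ N * (∫ z, h z))
      ≤ ∫ σ in S / 2..S, 2 * σ * avg kerK σ h x := by
    refine intervalIntegral.integral_mono_on (by linarith) (by simp)
      (hcont.intervalIntegrable _ _) fun σ hσ => ?_
    have hσ0 : 0 < σ := by linarith [hσ.1]
    have he : avg kerK σ h x = (∫ z, h z) / σ ^ N := by
      rw [← integral_comp_affine h x hσ0]
      refine integral_congr_ae (Eventually.of_forall fun z => ?_)
      rcases le_or_gt ‖z‖ (1 / 2) with hz | hz
      · simp [kerK_eq_one hz]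
      · have h3 : ‖σ • z‖ ≤ ‖x + σ • z‖ + ‖x‖ := by
          simpa using norm_sub_le (x + σ • z) x
        rw [norm_smul, Real.norm_of_nonneg hσ0.le] at h3
        have h4 : σ * (1 / 2) < σ * ‖z‖ := mul_lt_mul_of_pos_left hz hσ0
        have h5 : h (x + σ • z) = 0 := hs _ (by linarith [hσ.1])
        simp [h5]
    rw [he, div_mul_eq_mul_div, mul_div_assoc]
    refine mul_le_mul (by linarith [hσ.1]) ?_ (by positivity) (by positivity)
    exact div_le_div_of_nonneg_left hI (by positivity) (pow_le_pow_left₀ hσ0.le hσ.2 N)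
  rw [intervalIntegral.integral_const, smul_eq_mul] at h2
  have h6 : S ^ 2 / 2 / S ^ N * (∫ z, h z) = (S - S / 2) * (S / S ^ N * ∫ z, h z) := by
    field_simp
    ring
  rw [hsplit, h6]
  linarith

lemma continuous_avg_fixed {N : ℕ} {h : Euc N → ℝ} (hh : Continuous h) (σ : ℝ) :
    Continuous (avg kerK σ h) :=
  (continuous_avg continuous_kerK kerK_zero' hh).comp (continuous_id.prodMk continuous_const)

lemma avg_kerK_comm {N : ℕ} {h : Euc N → ℝ} (hh : Continuous h) (σ τ : ℝ) (x : Euc N) :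
    avg kerK τ (avg kerK σ h) x = avg kerK σ (avg kerK τ h) x := by
  have h1 : ∀ σ τ : ℝ, avg kerK τ (avg kerK σ h) x
      = ∫ z : Euc N, ∫ w : Euc N, kerK z * (kerK w * h (x + τ • z + σ • w)) := fun σ τ => by
    unfold avg
    refine integral_congr_ae (Eventually.of_forall fun z => ?_)
    exact (integral_const_mul _ _).symm
  rw [h1, h1, integral_integral_swap_of_hasCompactSupport]
  · refine integral_congr_ae (Eventually.of_forall fun z => ?_)
    refine integral_congr_ae (Eventually.of_forall fun w => ?_)
    simp only
    rw [mul_left_comm, add_right_comm]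
  · have := continuous_kerK (N := N)
    simp only [Function.uncurry_def]
    fun_prop
  · refine HasCompactSupport.intro
      ((isCompact_closedBall (0 : Euc N) 1).prod (isCompact_closedBall (0 : Euc N) 1))
      fun p hp => ?_
    by_cases h3 : ‖p.1‖ ≤ 1
    · have h4 : 1 < ‖p.2‖ := by
        by_contra h5
        exact hp ⟨by simpa using h3, by simpa using h5⟩
      simp [Function.uncurry_def, kerK_zero' _ h4]
    · simp [Function.uncurry_def, kerK_zero' _ (not_le.1 h3)]

lemma avg_kerK_pot {N : ℕ} {h : Euc N → ℝ} (hh : Continuous h) {S : ℝ} (hS : 0 ≤ S)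
    (τ : ℝ) (x : Euc N) :
    avg kerK τ (pot 0 S h) x = ∫ σ in (0 : ℝ)..S, 2 * σ * avg kerK τ (avg kerK σ h) x := by
  have hcont : Continuous fun p : Euc N × ℝ => avg kerK p.2 h p.1 :=
    continuous_avg continuous_kerK kerK_zero' hh
  rw [avg_eq_setIntegral kerK_zero']
  have h1 : ∀ z : Euc N, kerK z * pot 0 S h (x + τ • z)
      = ∫ σ in Ioc 0 S, kerK z * (2 * σ * avg kerK σ h (x + τ • z)) := fun z => by
    rw [pot, intervalIntegral.integral_of_le hS, integral_const_mul]
  simp_rw [h1]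
  rw [integral_integral_swap, intervalIntegral.integral_of_le hS]
  · refine integral_congr_ae (Eventually.of_forall fun σ => ?_)
    simp only
    rw [avg_eq_setIntegral kerK_zero', ← integral_const_mul]
    refine integral_congr_ae (Eventually.of_forall fun z => ?_)
    simp only
    ring
  · rw [Measure.prod_restrict]
    have hc : Continuous (Function.uncurry fun (z : Euc N) (σ : ℝ) =>
        kerK z * (2 * σ * avg kerK σ h (x + τ • z))) := by
      have h2 := continuous_kerK (N := N)
      have h3 : Continuous fun p : Euc N × ℝ => avg kerK p.2 h (x + τ • p.1) :=
        hcont.comp (f := fun p : Euc N × ℝ => (x + τ • p.1, p.2)) (by fun_prop)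
      simp only [Function.uncurry_def]
      fun_prop
    exact (hc.continuousOn.integrableOn_compact
      ((isCompact_closedBall (0 : Euc N) 1).prod isCompact_Icc)).mono_set
      (prod_mono_right Ioc_subset_Icc_self)

lemma avg_kerK_le {N : ℕ} {h : Euc N → ℝ} (hh : Continuous h) {c : ℝ} (hc : ∀ y, h y ≤ c)
    (σ : ℝ) (x : Euc N) : avg kerK σ h x ≤ (∫ z : Euc N, kerK z) * c := by
  rw [← avg_const kerK σ c x]
  exact avg_mono continuous_kerK kerK_nonneg kerK_zero' hh continuous_const fun y _ => hc y

/-- The averages of `h` over balls of radius `σ` grow at most like `D / σ ^ k`. -/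
def AvgBound {N : ℕ} (D : ℝ) (k : ℕ) (h : Euc N → ℝ) : Prop :=
  ∀ σ > 0, ∀ x, avg kerK σ h x ≤ D / σ ^ k

lemma AvgBound.pot {N : ℕ} {h : Euc N → ℝ} (hh : Continuous h) {D : ℝ} {k : ℕ} (hD : 0 ≤ D)
    (hb : AvgBound D (k + 1) h) {S : ℝ} (hS : 0 ≤ S) :
    AvgBound (2 * S * ((∫ z : Euc N, kerK z) * D)) k (pot 0 S h) := by
  intro τ hτ x
  rw [avg_kerK_pot hh hS]
  set κ := ∫ z : Euc N, kerK z
  have hκ : 0 ≤ κ := integral_nonneg kerK_nonneg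
  have h1 : ∀ σ ∈ Icc 0 S, 2 * σ * avg kerK τ (avg kerK σ h) x ≤ 2 * (κ * D) / τ ^ k := by
    intro σ hσ
    rcases hσ.1.eq_or_lt with h0 | hσ0
    · rw [← h0]
      simp only [mul_zero, zero_mul]
      positivity
    have h2 : avg kerK τ (avg kerK σ h) x ≤ κ * (D / (σ * τ ^ k)) := by
      rcases le_total σ τ with hst | hst
      · rw [avg_kerK_comm hh]
        refine (avg_kerK_le (continuous_avg_fixed hh τ) (fun y => hb τ hτ y) _ _).trans ?_
        refine mul_le_mul_of_nonneg_left ?_ hκ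
        refine div_le_div_of_nonneg_left hD (by positivity) ?_
        rw [pow_succ, mul_comm]
        exact mul_le_mul_of_nonneg_left hst (by positivity)
      · refine (avg_kerK_le (continuous_avg_fixed hh σ) (fun y => hb σ hσ0 y) _ _).trans ?_
        refine mul_le_mul_of_nonneg_left ?_ hκ
        refine div_le_div_of_nonneg_left hD (by positivity) ?_
        rw [pow_succ, mul_comm]
        exact mul_le_mul_of_nonneg_right (pow_le_pow_left₀ hτ.le hst k) hσ0.le
    calc 2 * σ * avg kerK τ (avg kerK σ h) x ≤ 2 * σ * (κ * (D / (σ * τ ^ k))) :=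
          mul_le_mul_of_nonneg_left h2 (by positivity)
      _ = 2 * (κ * D) / τ ^ k := by field_simp
  have h3 : Continuous fun σ => 2 * σ * avg kerK τ (avg kerK σ h) x := by
    have hcont : Continuous fun p : Euc N × ℝ => avg kerK p.2 h p.1 :=
      continuous_avg continuous_kerK kerK_zero' hh
    have : Continuous fun σ => avg kerK τ (avg kerK σ h) x := by
      simp_rw [avg_kerK_comm hh _ τ x]
      exact continuous_avg_scale continuous_kerK kerK_zero' (continuous_avg_fixed hh τ) x
    fun_prop
  calc _ ≤ ∫ _σ in (0 : ℝ)..S, 2 * (κ * D) / τ ^ k :=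
        intervalIntegral.integral_mono_on hS (h3.intervalIntegrable _ _) (by simp) h1
    _ = 2 * S * (κ * D) / τ ^ k := by
        rw [intervalIntegral.integral_const, smul_eq_mul]
        ring

lemma AvgBound.const_mul {N : ℕ} {h g : Euc N → ℝ} (hh : Continuous h) (hg : Continuous g)
    {D c : ℝ} {k : ℕ} (hb : AvgBound D k h) (hc : 0 ≤ c) (hgh : ∀ y, g y ≤ c * h y) :
    AvgBound (c * D) k g := by
  intro σ hσ x
  calc avg kerK σ g x ≤ avg kerK σ (fun y => c * h y) x :=
        avg_mono continuous_kerK kerK_nonneg kerK_zero' hg (continuous_const.mul hh)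
          fun y _ => hgh y
    _ = c * avg kerK σ h x := avg_const_mul _ _ _ _ _
    _ ≤ c * (D / σ ^ k) := mul_le_mul_of_nonneg_left (hb σ hσ x) hc
    _ = c * D / σ ^ k := by ring

lemma integral_kerK_pos (N : ℕ) : 0 < ∫ z : Euc N, kerK z :=
  continuous_kerK.integral_pos_of_hasCompactSupport_nonneg_nonzero
    (hasCompactSupport_of_zero kerK_zero') kerK_nonneg (x := 0)
    (by rw [kerK_eq_one (by simp)]; exact one_ne_zero)

lemma AvgBound.le {N : ℕ} {h : Euc N → ℝ} (hh : Continuous h) {D : ℝ}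
    (hb : AvgBound D 0 h) (x : Euc N) : h x ≤ (∫ z : Euc N, kerK z)⁻¹ * D := by
  have h1 : Tendsto (fun σ => avg kerK σ h x) (𝓝[>] 0) (𝓝 ((∫ z : Euc N, kerK z) * h x)) := by
    rw [← avg_zero_scale]
    exact ((continuous_avg_scale continuous_kerK kerK_zero' hh x).tendsto 0).mono_left
      nhdsWithin_le_nhds
  have h2 : (∫ z : Euc N, kerK z) * h x ≤ D := by
    refine le_of_tendsto h1 ?_
    filter_upwards [self_mem_nhdsWithin] with σ hσ
    simpa using hb σ hσ x
  rw [inv_mul_eq_div, le_div_iff₀ (integral_kerK_pos N)]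
  linarith

/-- The iterates of the integral operator `X ↦ (x ↦ m⁻¹ ∫ F b · X (!b))` given by the truncated
Newtonian potential, for a pair of weights `F` and a pair of functions `X`. -/
def iterPot {N : ℕ} (S : ℝ) (F X : Bool → Euc N → ℝ) : ℕ → Bool → Euc N → ℝ
  | 0 => X
  | n + 1 => fun b => pot 0 S fun y => (kerM N)⁻¹ * (F b y * iterPot S F X n (!b) y)

section iterPot

variable {N : ℕ} {F X : Bool → Euc N → ℝ} {r S : ℝ}

lemma iterPot_succ (n : ℕ) (b : Bool) (x : Euc N) : iterPot S F X (n + 1) b x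
    = (kerM N)⁻¹ * pot 0 S (fun y => F b y * iterPot S F X n (!b) y) x :=
  pot_const_mul _ _ _ _ _

lemma iterPot_nonneg (hN : 0 < N) (hF0 : ∀ b y, 0 ≤ F b y) (hX0 : ∀ b y, 0 ≤ X b y)
    (hS : 0 ≤ S) (n : ℕ) : ∀ b x, 0 ≤ iterPot S F X n b x := by
  induction n with
  | zero => exact hX0
  | succ n ih =>
    exact fun b x => pot_nonneg (fun y => mul_nonneg (inv_nonneg.2 (kerM_pos hN).le)
      (mul_nonneg (hF0 b y) (ih (!b) y))) hS x

lemma contDiff_iterPot (hF : ∀ b, ContDiff ℝ 1 (F b)) (hX : ∀ b, ContDiff ℝ 2 (X b))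
    (hS : 0 ≤ S) (n : ℕ) : ∀ b, ContDiff ℝ 2 (iterPot S F X n b) := by
  induction n with
  | zero => exact hX
  | succ n ih =>
    intro b
    have h1 : ContDiff ℝ ((1 : ℕ) : WithTop ℕ∞)
        (fun y => (kerM N)⁻¹ * (F b y * iterPot S F X n (!b) y)) := by
      have := (ih (!b)).of_le (m := 1) (by norm_num)
      simpa using contDiff_const.mul ((hF b).mul this)
    have h2 := contDiff_pot hS 1 h1
    simpa [iterPot] using h2

lemma iterPot_succ_le (hN : 0 < N) (hF : ∀ b, ContDiff ℝ 1 (F b)) (hF0 : ∀ b y, 0 ≤ F b y)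
    (hFs : ∀ b y, r < ‖y‖ → F b y = 0) (hX : ∀ b, ContDiff ℝ 2 (X b)) (hX0 : ∀ b y, 0 ≤ X b y)
    (hS : 0 ≤ S) (hlap : ∀ b y, ‖y‖ ≤ r + S → F b y * X (!b) y ≤ -lap (X b) y) (n : ℕ) :
    ∀ b x, ‖x‖ ≤ r → iterPot S F X (n + 1) b x ≤ iterPot S F X n b x := by
  have hm := kerM_pos hN
  have hc : ∀ n b, Continuous fun y => F b y * iterPot S F X n (!b) y := fun n b =>
    (hF b).continuous.mul (contDiff_iterPot hF hX hS n (!b)).continuous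
  induction n with
  | zero =>
    intro b x hx
    rw [iterPot_succ, inv_mul_eq_div, div_le_iff₀ hm, mul_comm]
    have h1 := rep_global (hX b) S x
    have h2 : 0 ≤ avg kerR S (X b) x :=
      integral_nonneg fun z => mul_nonneg (kerR_nonneg _) (hX0 _ _)
    have h3 : pot 0 S (fun y => F b y * X (!b) y) x ≤ pot 0 S (fun y => -lap (X b) y) x := by
      refine pot_mono (hc 0 b) (continuous_lap (hX b)).neg hS fun y hy => hlap b y ?_
      rw [mem_closedBall, dist_eq_norm] at hy
      have := norm_add_le (y - x) x
      rw [sub_add_cancel] at this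
      linarith
    change pot 0 S (fun y => F b y * X (!b) y) x ≤ kerM N * X b x
    linarith
  | succ n ih =>
    intro b x _
    rw [iterPot_succ, iterPot_succ]
    refine mul_le_mul_of_nonneg_left ?_ (inv_nonneg.2 hm.le)
    refine pot_mono (hc _ b) (hc _ b) hS fun y _ => ?_
    rcases le_or_gt ‖y‖ r with hy | hy
    · exact mul_le_mul_of_nonneg_left (ih _ y hy) (hF0 b y)
    · simp [hFs b y hy]

lemma neg_lap_iterPot (hN : 0 < N) (hF : ∀ b, ContDiff ℝ 1 (F b))
    (hFs : ∀ b y, r < ‖y‖ → F b y = 0) (hX : ∀ b, ContDiff ℝ 2 (X b)) (hS : 0 ≤ S)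
    (hrS : 4 * r < S) (n : ℕ) (b : Bool) {x : Euc N} (hx : ‖x‖ ≤ r) :
    -lap (iterPot S F X (n + 1) b) x = F b x * iterPot S F X n (!b) x := by
  have h1 : ContDiff ℝ 1 (fun y => (kerM N)⁻¹ * (F b y * iterPot S F X n (!b) y)) :=
    contDiff_const.mul ((hF b).mul ((contDiff_iterPot hF hX hS n (!b)).of_le (by norm_num)))
  rw [iterPot, neg_lap_pot h1 hS, avg_kerR_eq_zero (r := r) (fun y hy => by simp [hFs b y hy])
    hx hS hrS, sub_zero, mul_inv_cancel_left₀ (kerM_pos hN).ne']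

lemma iterPot_le (hN : 0 < N) (hF : ∀ b, ContDiff ℝ 1 (F b)) (hF0 : ∀ b y, 0 ≤ F b y)
    (hFs : ∀ b y, r < ‖y‖ → F b y = 0) (hX : ∀ b, ContDiff ℝ 2 (X b)) (hX0 : ∀ b y, 0 ≤ X b y)
    (hS : 0 ≤ S) {C H : ℝ} (hC : 0 ≤ C) (hFC : ∀ b y, F b y ≤ C)
    (hH : ∀ b, ∫ y, F b y * X (!b) y ≤ H) (b : Bool) (x : Euc N) :
    iterPot S F X N b x ≤ (∫ z : Euc N, kerK z)⁻¹ *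
      ((C * ((kerM N)⁻¹ * (2 * S * ∫ z : Euc N, kerK z))) ^ (N - 1) *
        ((kerM N)⁻¹ * (2 * S * ∫ z : Euc N, kerK z)) * H) := by
  have hm := inv_nonneg.2 (kerM_pos hN).le
  set κ := ∫ z : Euc N, kerK z with hκdef
  have hκ : 0 < κ := integral_kerK_pos N
  set L := (kerM N)⁻¹ * (2 * S * κ) with hL
  have hL0 : 0 ≤ L := by positivity
  have hW0 := iterPot_nonneg hN hF0 hX0 hS
  have hWc := fun n b => (contDiff_iterPot hF hX hS n b).continuous
  have hc : ∀ n b, Continuous fun y => F b y * iterPot S F X n (!b) y := fun n b =>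
    (hF b).continuous.mul (hWc n (!b))
  have hI0 : 0 ≤ H := (integral_nonneg fun y => mul_nonneg (hF0 b y) (hX0 (!b) y)).trans (hH b)
  have hstep : ∀ n b D k, 0 ≤ D → AvgBound D (k + 1) (fun y => F b y * iterPot S F X n (!b) y) →
      AvgBound (L * D) k (iterPot S F X (n + 1) b) := fun n b D k hD h => by
    have h1 := (h.pot (hc n b) hD hS).const_mul (g := iterPot S F X (n + 1) b)
      (continuous_pot (hc n b) _ _) (hWc _ b) hm fun y => (iterPot_succ n b y).le
    have h2 : (kerM N)⁻¹ * (2 * S * ((∫ z : Euc N, kerK z) * D)) = L * D := by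
      rw [hL, hκdef]
      ring
    rwa [h2] at h1
  have hind : ∀ j, j + 1 ≤ N → ∀ b,
      AvgBound ((C * L) ^ j * L * H) (N - 1 - j) (iterPot S F X (j + 1) b) := by
    intro j
    induction j with
    | zero =>
      intro _ b
      simp only [pow_zero, one_mul, Nat.sub_zero]
      refine hstep 0 b H (N - 1) hI0 fun σ hσ x => ?_
      rw [Nat.sub_add_cancel hN]
      refine (avg_kerK_le_integral (r := r) (hc 0 b) (fun y => mul_nonneg (hF0 b y) (hW0 0 _ y))
        (fun y hy => by simp [hFs b y hy]) x hσ).trans ?_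
      exact div_le_div_of_nonneg_right (hH b) (by positivity)
    | succ j ih =>
      intro hj b
      have h1 := (ih (by lia) (!b)).const_mul (g := fun y => F b y * iterPot S F X (j + 1) (!b) y)
        (hWc _ _) (hc _ b) hC fun y => mul_le_mul_of_nonneg_right (hFC b y) (hW0 _ _ y)
      have h2 : N - 1 - j = N - 1 - (j + 1) + 1 := by lia
      rw [h2] at h1
      have h3 := hstep (j + 1) b _ _ (by positivity) h1
      have h4 : L * (C * ((C * L) ^ j * L * H)) = (C * L) ^ (j + 1) * L * H := by ring
      rwa [h4] at h3
  have h5 := hind (N - 1) (by lia) b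
  rw [Nat.sub_self, Nat.sub_add_cancel hN] at h5
  exact h5.le (hWc N b) x

lemma le_iterPot (hN : 0 < N) (hF : ∀ b, ContDiff ℝ 1 (F b)) (hF0 : ∀ b y, 0 ≤ F b y)
    (hFs : ∀ b y, r < ‖y‖ → F b y = 0) (hX : ∀ b, ContDiff ℝ 2 (X b)) (hX0 : ∀ b y, 0 ≤ X b y)
    (hS : 0 < S) (hrS : 8 * r ≤ S)
    (hlap : ∀ b y, ‖y‖ ≤ r + S → F b y * X (!b) y ≤ -lap (X b) y)
    {e : ℝ} (he0 : 0 ≤ e) (he1 : e ≤ 1)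
    (he : ∀ b, e ≤ (∫ y, F b y) * ((kerM N)⁻¹ * (S ^ 2 / 2 / S ^ N))) (n : ℕ) (b : Bool)
    {x : Euc N} (hx : ‖x‖ ≤ r) :
    (kerM N)⁻¹ * (S ^ 2 / 2 / S ^ N) * (e ^ (2 * n + 1) / 2 *
      ((∫ y, F b y * X (!b) y) + ∫ y, F (!b) y * X b y)) ≤ iterPot S F X (n + 1) b x := by
  have hm := inv_nonneg.2 (kerM_pos hN).le
  set k := (kerM N)⁻¹ * (S ^ 2 / 2 / S ^ N) with hk
  have hk0 : 0 ≤ k := by positivity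
  have hW0 := iterPot_nonneg hN hF0 hX0 hS.le
  have hc : ∀ n b, Continuous fun y => F b y * iterPot S F X n (!b) y := fun n b =>
    (hF b).continuous.mul (contDiff_iterPot hF hX hS.le n (!b)).continuous
  have hsupp : ∀ n b y, r < ‖y‖ → F b y * iterPot S F X n (!b) y = 0 := fun n b y hy => by
    simp [hFs b y hy]
  have hintg : ∀ {g : Euc N → ℝ}, Continuous g → (∀ y, r < ‖y‖ → g y = 0) → Integrable g :=
    fun hg hs => hg.integrable_of_hasCompactSupport
      (HasCompactSupport.intro (isCompact_closedBall 0 r) fun y hy => hs y (by simpa using hy))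
  set J : ℕ → Bool → ℝ := fun n b => ∫ y, F b y * iterPot S F X n (!b) y with hJ
  have hJ0 : ∀ n b, 0 ≤ J n b := fun n b =>
    integral_nonneg fun y => mul_nonneg (hF0 b y) (hW0 n _ y)
  have hlow : ∀ n b x, ‖x‖ ≤ r → k * J n b ≤ iterPot S F X (n + 1) b x := fun n b x hx => by
    rw [iterPot_succ, hk, mul_assoc]
    exact mul_le_mul_of_nonneg_left (integral_le_pot (hc n b)
      (fun y => mul_nonneg (hF0 b y) (hW0 n _ y)) (hsupp n b) hx hS hrS) hm
  have hanti : ∀ n b, J (n + 1) b ≤ J n b := fun n b => by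
    refine integral_mono (hintg (hc _ b) (hsupp _ b)) (hintg (hc _ b) (hsupp _ b)) fun y => ?_
    rcases le_or_gt ‖y‖ r with hy | hy
    · exact mul_le_mul_of_nonneg_left (iterPot_succ_le hN hF hF0 hFs hX hX0 hS.le hlap n _ y hy)
        (hF0 b y)
    · simp [hFs b y hy]
  have hrec : ∀ n b, e * J n (!b) ≤ J (n + 1) b := fun n b => by
    have h1 : (∫ y, F b y * (k * J n (!b))) ≤ J (n + 1) b := by
      refine integral_mono ((hintg (hF b).continuous (hFs b)).mul_const _)
        (hintg (hc _ b) (hsupp _ b)) fun y => ?_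
      rcases le_or_gt ‖y‖ r with hy | hy
      · exact mul_le_mul_of_nonneg_left (hlow n _ y hy) (hF0 b y)
      · simp [hFs b y hy]
    rw [integral_mul_const] at h1
    calc e * J n (!b) ≤ (∫ y, F b y) * k * J n (!b) :=
          mul_le_mul_of_nonneg_right (he b) (hJ0 _ _)
      _ = (∫ y, F b y) * (k * J n (!b)) := by ring
      _ ≤ J (n + 1) b := h1
  have hrec' : ∀ n b, e ^ 2 * J n b ≤ J (n + 1) b := fun n b => by
    have h1 := hrec n (!b)
    rw [Bool.not_not] at h1
    have h2 := hanti n (!b)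
    have h3 : e * (e * J n b) ≤ e * J n (!b) := mul_le_mul_of_nonneg_left (h1.trans h2) he0
    have h4 := hrec n b
    nlinarith
  have hpow : e ^ (2 * n) * J 0 b ≤ J n b := by
    clear hx
    induction n with
    | zero => simp
    | succ n ih =>
      calc e ^ (2 * (n + 1)) * J 0 b = e ^ 2 * (e ^ (2 * n) * J 0 b) := by ring
        _ ≤ e ^ 2 * J n b := mul_le_mul_of_nonneg_left ih (by positivity)
        _ ≤ _ := hrec' n b
  have hzero : e / 2 * (J 0 b + J 0 (!b)) ≤ J 0 b := by
    have h1 := (hrec 0 b).trans (hanti 0 b)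
    have h2 : e * J 0 b ≤ 1 * J 0 b := mul_le_mul_of_nonneg_right he1 (hJ0 0 b)
    linarith
  have hJb : J 0 (!b) = ∫ y, F (!b) y * X b y := by
    simp only [hJ, Bool.not_not]
    rfl
  rw [hJb] at hzero
  refine le_trans (mul_le_mul_of_nonneg_left ?_ hk0) (hlow n b x hx)
  calc _ = e ^ (2 * n) * (e / 2 * (J 0 b + ∫ y, F (!b) y * X b y)) := by
        simp only [hJ, iterPot]
        ring
    _ ≤ e ^ (2 * n) * J 0 b := mul_le_mul_of_nonneg_left hzero (by positivity)
    _ ≤ J n b := hpow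

end iterPot

/-- If the linear cooperative system `-Δ(X b) ≥ (1 - ε) f b · X (!b)` has a positive supersolution
on a large ball and `ε` is small enough (depending only on the coefficients), then the system with
`ε = 0` has a positive supersolution on a smaller ball. -/
theorem exists_supersolution_of_almost {N : ℕ} (hN : 0 < N) {f : Bool → Euc N → ℝ}
    (hf : ∀ b, ContDiff ℝ 1 (f b)) (hf0 : ∀ b x, 0 < f b x) {R : ℝ} (hR : 0 < R) :
    ∃ ε₀ > 0, ∀ ε, 0 ≤ ε → ε ≤ ε₀ → ∀ U : Bool → Euc N → ℝ,
      (∀ b, ContDiffOn ℝ 2 (U b) (ball 0 (20 * R))) →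
      (∀ b, ∀ x ∈ ball (0 : Euc N) (20 * R), 0 < U b x) →
      (∀ b, ∀ x ∈ ball (0 : Euc N) (20 * R), (1 - ε) * f b x * U (!b) x ≤ -lap (U b) x) →
      ∃ Y : Bool → Euc N → ℝ, (∀ b, ContDiff ℝ 2 (Y b)) ∧
        (∀ b, ∀ x ∈ ball (0 : Euc N) R, 0 < Y b x) ∧
        ∀ b, ∀ x ∈ ball (0 : Euc N) R, f b x * Y (!b) x ≤ -lap (Y b) x := by
  have hm := kerM_pos hN
  set χ : Euc N → ℝ := fun x => kerK ((2 * R)⁻¹ • x) with hχ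
  have hnorm : ∀ x : Euc N, ‖(2 * R)⁻¹ • x‖ = ‖x‖ / (2 * R) := fun x => by
    rw [norm_smul, Real.norm_of_nonneg (by positivity), inv_mul_eq_div]
  have hχ1 : ContDiff ℝ 1 χ := by
    have := contDiff_kerK (N := N) (n := 1)
    exact ContDiff.comp (g := kerK) (by exact_mod_cast this) (contDiff_const_smul _)
  have hχR : ∀ x, ‖x‖ ≤ R → χ x = 1 := fun x hx => by
    refine kerK_eq_one ?_
    rw [hnorm, div_le_iff₀ (by positivity)]
    linarith
  have hχ0 : ∀ x, 2 * R < ‖x‖ → χ x = 0 := fun x hx => by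
    refine kerK_eq_zero ?_
    rw [hnorm, le_div_iff₀ (by positivity)]
    linarith
  set g : Bool → Euc N → ℝ := fun b x => χ x * f b x with hg
  have hg1 : ∀ b, ContDiff ℝ 1 (g b) := fun b => hχ1.mul (hf b)
  have hg0 : ∀ b x, 0 ≤ g b x := fun b x => mul_nonneg (kerK_nonneg _) (hf0 b x).le
  have hgf : ∀ b x, g b x ≤ f b x := fun b x =>
    mul_le_of_le_one_left (hf0 b x).le (kerK_le_one _)
  have hgs : ∀ b x, 2 * R < ‖x‖ → g b x = 0 := fun b x hx => by simp [hg, hχ0 x hx]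
  have hgc : ∀ b, HasCompactSupport (g b) := fun b =>
    HasCompactSupport.intro (isCompact_closedBall 0 (2 * R)) fun y hy =>
      hgs b y (by simpa using hy)
  have hgR : ∀ b x, ‖x‖ ≤ R → g b x = f b x := fun b x hx => by simp [hg, hχR x hx]
  have hgpos : ∀ b, 0 < ∫ y, g b y := fun b =>
    (hg1 b).continuous.integral_pos_of_hasCompactSupport_nonneg_nonzero (hgc b) (hg0 b) (x := 0)
      (by rw [hgR b 0 (by simpa using hR.le)]; exact (hf0 b 0).ne')
  obtain ⟨C, hC0, hgC⟩ : ∃ C, 0 ≤ C ∧ ∀ b x, g b x ≤ C := by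
    choose C hC using fun b => (hgc b).exists_bound_of_continuous (hg1 b).continuous
    have hC0 : ∀ b, 0 ≤ C b := fun b => (norm_nonneg _).trans (hC b 0)
    refine ⟨C true + C false, add_nonneg (hC0 _) (hC0 _), fun b x => ?_⟩
    have h1 := (le_abs_self _).trans (hC b x)
    cases b <;> linarith [hC0 true, hC0 false]
  set S := 16 * R with hS
  have hS0 : 0 < S := by positivity
  set k := (kerM N)⁻¹ * (S ^ 2 / 2 / S ^ N) with hk
  have hk0 : 0 < k := by positivity
  obtain ⟨e, he0, he1, he⟩ : ∃ e, 0 < e ∧ e ≤ 1 ∧ ∀ b, e ≤ (∫ y, g b y) / 2 * k := by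
    have h1 : ∀ b, 0 < (∫ y, g b y) / 2 * k := fun b => by
      have := hgpos b
      positivity
    refine ⟨min 1 (min ((∫ y, g true y) / 2 * k) ((∫ y, g false y) / 2 * k)),
      lt_min one_pos (lt_min (h1 _) (h1 _)), min_le_left _ _, fun b => ?_⟩
    cases b
    · exact (min_le_right _ _).trans (min_le_right _ _)
    · exact (min_le_right _ _).trans (min_le_left _ _)
  have hκ := integral_kerK_pos N
  set κ := ∫ z : Euc N, kerK z with hκdef
  set C₁ := κ⁻¹ * ((C * ((kerM N)⁻¹ * (2 * S * κ))) ^ (N - 1) * ((kerM N)⁻¹ * (2 * S * κ))) with hC₁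
  have hC₁0 : 0 ≤ C₁ := by positivity
  set c₁ := k * (e ^ (2 * N + 1) / 2) with hc₁
  have hc₁0 : 0 < c₁ := by positivity
  refine ⟨min (1 / 2) (c₁ / (2 * (C₁ + 1))), lt_min (by norm_num) (by positivity),
    fun ε hε0 hε U hU hU0 hUlap => ?_⟩
  have hε1 : ε ≤ 1 / 2 := hε.trans (min_le_left _ _)
  have hε2 : ε * C₁ < c₁ := by
    have h1 := hε.trans (min_le_right _ _)
    rw [le_div_iff₀ (by positivity)] at h1
    nlinarith
  choose X hX hXU hX0 using fun b =>
    exists_global_ext (R := 18 * R) (by positivity) (by linarith) (hU b)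
  replace hX0 : ∀ b y, 0 ≤ X b y := fun b => hX0 b fun y hy => (hU0 b y hy).le
  have hmem : ∀ y : Euc N, ‖y‖ ≤ 18 * R → y ∈ ball (0 : Euc N) (20 * R) := fun y hy => by
    rw [mem_ball_zero_iff]
    linarith
  have hXpos : ∀ b y, ‖y‖ ≤ 18 * R → 0 < X b y := fun b y hy => by
    rw [(hXU b y (by simpa using hy)).eq_of_nhds]
    exact hU0 b y (hmem y hy)
  set F : Bool → Euc N → ℝ := fun b y => (1 - ε) * g b y with hF
  have hF1 : ∀ b, ContDiff ℝ 1 (F b) := fun b => contDiff_const.mul (hg1 b)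
  have hF0 : ∀ b y, 0 ≤ F b y := fun b y => mul_nonneg (by linarith) (hg0 b y)
  have hFs : ∀ b y, 2 * R < ‖y‖ → F b y = 0 := fun b y hy => by simp [hF, hgs b y hy]
  have hFC : ∀ b y, F b y ≤ C := fun b y =>
    (mul_le_of_le_one_left (hg0 b y) (by linarith)).trans (hgC b y)
  have hlap : ∀ b y, ‖y‖ ≤ 2 * R + S → F b y * X (!b) y ≤ -lap (X b) y := fun b y hy => by
    have hy' : ‖y‖ ≤ 18 * R := by linarith
    rw [lap_congr (hXU b y (by simpa using hy')),
      (hXU (!b) y (by simpa using hy')).eq_of_nhds]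
    refine le_trans ?_ (hUlap b y (hmem y hy'))
    exact mul_le_mul_of_nonneg_right (mul_le_mul_of_nonneg_left (hgf b y) (by linarith))
      (hU0 _ y (hmem y hy')).le
  set I : Bool → ℝ := fun b => ∫ y, F b y * X (!b) y with hI
  have hIpos : ∀ b, 0 < I b := fun b => by
    refine ((hF1 b).continuous.mul
      (hX (!b)).continuous).integral_pos_of_hasCompactSupport_nonneg_nonzero
      (HasCompactSupport.intro (isCompact_closedBall 0 (2 * R)) fun y hy => ?_)
      (fun y => mul_nonneg (hF0 b y) (hX0 (!b) y)) (x := 0) ?_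
    · simp [hFs b y (by simpa using hy)]
    · have h1 := hXpos (!b) 0 (by simpa using hR.le)
      have h2 : F b 0 = (1 - ε) * f b 0 := by
        simp only [hF]
        rw [hgR b 0 (by simpa using hR.le)]
      rw [h2]
      have h3 := hf0 b 0
      have h4 : 0 < 1 - ε := by linarith
      positivity
  set H := I true + I false with hH
  have hH0 : 0 < H := add_pos (hIpos _) (hIpos _)
  have hHb : ∀ b, I b + I (!b) = H := fun b => by
    cases b
    · simp [hH, add_comm]
    · simp [hH]
  set W := iterPot S F X with hW
  have hW2 : ∀ n b, ContDiff ℝ 2 (W n b) := contDiff_iterPot hF1 hX hS0.le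
  have hup : ∀ b x, W N b x ≤ C₁ * H := fun b x => by
    have h1 := iterPot_le hN hF1 hF0 hFs hX hX0 hS0.le hC0 hFC (H := H)
      (fun b => by
        have h2 := hHb b
        have h3 := hIpos (!b)
        simp only [hI] at h2 h3 ⊢
        linarith) b x
    rw [hC₁]
    rw [← mul_assoc] at h1
    exact h1
  have hanti : ∀ n b x, ‖x‖ ≤ 2 * R → W (n + 1) b x ≤ W n b x :=
    iterPot_succ_le hN hF1 hF0 hFs hX hX0 hS0.le hlap
  have hlow : ∀ b x, ‖x‖ ≤ 2 * R → c₁ * H ≤ W (N + 1) b x := fun b x hx => by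
    have h1 := le_iterPot hN hF1 hF0 hFs hX hX0 hS0 (by linarith) hlap he0.le he1 (fun b => by
      refine (he b).trans ?_
      simp only [hF, integral_const_mul]
      refine mul_le_mul_of_nonneg_right ?_ hk0.le
      have := hgpos b
      nlinarith) N b hx
    have h2 : (∫ y, F b y * X (!b) y) + ∫ y, F (!b) y * X b y = H := by
      rw [← hHb b]
      simp [hI]
    rw [h2, ← mul_assoc] at h1
    exact h1
  refine ⟨fun b x => W (N + 1) b x - ε * (C₁ * H), fun b => (hW2 _ b).sub contDiff_const,
    fun b x hx => ?_, fun b x hx => ?_⟩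
  · rw [mem_ball_zero_iff] at hx
    have h1 := hlow b x (by linarith)
    have h2 : ε * C₁ * H < c₁ * H := mul_lt_mul_of_pos_right hε2 hH0
    linarith
  · rw [mem_ball_zero_iff] at hx
    have h1 : -lap (fun x => W (N + 1) b x - ε * (C₁ * H)) x = -lap (W (N + 1) b) x := by
      rw [lap_eq_sum_pd ((hW2 _ b).sub contDiff_const).contDiffAt,
        lap_eq_sum_pd (hW2 _ b).contDiffAt]
      have : ∀ i, pd i (fun x => W (N + 1) b x - ε * (C₁ * H)) = pd i (W (N + 1) b) := fun i => by
        ext y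
        unfold pd
        rw [fderiv_sub_const]
      simp_rw [this]
    rw [h1, hW, neg_lap_iterPot hN hF1 hFs hX hS0.le (by linarith) N b (by linarith), ← hW]
    have h2 : F b x = (1 - ε) * f b x := by
      simp only [hF]
      rw [hgR b x hx.le]
    rw [h2]
    have h3 := hanti N (!b) x (by linarith)
    have h4 := hup (!b) x
    have h5 : W (N + 1) (!b) x - ε * (C₁ * H) ≤ (1 - ε) * W N (!b) x := by nlinarith
    have h6 := mul_le_mul_of_nonneg_left h5 (hf0 b x).le
    linarith

lemma lap_comp_affine_of_contDiff {N : ℕ} {g : Euc N → ℝ} (hg : ContDiff ℝ 2 g) (c σ : ℝ)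
    (x y : Euc N) : lap (fun y => c * g (x + σ • y)) y = c * σ ^ 2 * lap g (x + σ • y) := by
  have h1 : ∀ i, pd i (fun y => c * g (x + σ • y)) = fun y => c * σ * pd i g (x + σ • y) :=
    fun i => by
      ext y
      have hd : DifferentiableAt ℝ (fun y => g (x + σ • y)) y :=
        ((hg.differentiable two_ne_zero).comp (by fun_prop : Differentiable ℝ
          fun y : Euc N => x + σ • y)) y
      have h2 := pd_comp_affine (hg.of_le (by norm_num)) i σ x y
      unfold pd at h2 ⊢
      rw [fderiv_const_mul hd, smul_apply, h2, smul_eq_mul]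
      ring
  have h3 : ∀ i, pd i (pd i fun y => c * g (x + σ • y)) y
      = c * σ ^ 2 * pd i (pd i g) (x + σ • y) := fun i => by
    have hpd : ContDiff ℝ 1 (pd i g) := contDiff_pd hg (by norm_num) i
    have hd : DifferentiableAt ℝ (fun y => pd i g (x + σ • y)) y :=
      ((hpd.differentiable one_ne_zero).comp (by fun_prop : Differentiable ℝ
        fun y : Euc N => x + σ • y)) y
    have h2 := pd_comp_affine hpd i σ x y
    rw [h1]
    generalize pd i g = w at *
    unfold pd at h2 ⊢
    rw [fderiv_const_mul hd, smul_apply, h2, smul_eq_mul]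
    ring
  have h4 : ContDiff ℝ 2 fun y => c * g (x + σ • y) := by fun_prop
  rw [lap_eq_sum_pd h4.contDiffAt, lap_eq_sum_pd hg.contDiffAt, Finset.mul_sum]
  exact Finset.sum_congr rfl fun i _ => h3 i

lemma lap_comp_affine {N : ℕ} {u : Euc N → ℝ} {c σ ρ : ℝ} {x y : Euc N} (hρ : 0 < ρ)
    (hu : ContDiffOn ℝ 2 u (ball (x + σ • y) ρ)) :
    lap (fun y => c * u (x + σ • y)) y = c * σ ^ 2 * lap u (x + σ • y) := by
  obtain ⟨V, hV, hVu, -⟩ := exists_global_ext (R := 0) le_rfl hρ hu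
  have h1 := hVu (x + σ • y) (by simp)
  have hc : Continuous fun y : Euc N => x + σ • y := by fun_prop
  have h2 : (fun y => c * V (x + σ • y)) =ᶠ[𝓝 y] fun y => c * u (x + σ • y) := by
    filter_upwards [hc.continuousAt.eventually h1] with w hw
    rw [hw]
  rw [← lap_congr h2, ← lap_congr h1, lap_comp_affine_of_contDiff hV]

lemma rpow_le_two_rpow_abs {ρ : ℝ} (h1 : 1 / 2 ≤ ρ) (h2 : ρ ≤ 2) (t : ℝ) : ρ ^ t ≤ 2 ^ |t| := by
  have h0 : 0 < ρ := by linarith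
  rcases le_total 0 t with ht | ht
  · rw [abs_of_nonneg ht]
    exact Real.rpow_le_rpow h0.le h2 ht
  · rw [abs_of_nonpos ht, ← inv_inv ρ, Real.inv_rpow (by positivity), ← Real.rpow_neg (by positivity)]
    refine Real.rpow_le_rpow (by positivity) ?_ (by linarith)
    rw [inv_le_comm₀ h0 two_pos]
    linarith

/-- A doubling property: if `‖x‖ * M x` is large, then `M` is controlled, on a large ball in the
scale `1 / M z`, by its value at the centre `z`. -/
lemma exists_doubling {N : ℕ} {M : Euc N → ℝ} (hM : ContinuousOn M {x | x ≠ 0}) {k : ℝ} (hk : 0 < k)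
    {x : Euc N} (hx : x ≠ 0) (h : 2 * k ≤ ‖x‖ * M x) :
    ∃ (z : Euc N) (d : ℝ), 0 < d ∧ d ≤ ‖z‖ ∧ ‖x‖ / 2 ≤ ‖z‖ ∧ k ≤ d * M z ∧
      ∀ y ∈ ball z (d / 2), M y ≤ 2 * M z := by
  have hx0 : 0 < ‖x‖ := norm_pos_iff.2 hx
  have hsub : closedBall x (‖x‖ / 2) ⊆ {x | x ≠ 0} := fun y hy h0 => by
    rw [mem_closedBall, dist_eq_norm, show y = 0 from h0, zero_sub, norm_neg] at hy
    linarith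
  obtain ⟨z, hz, hmax⟩ := (isCompact_closedBall x (‖x‖ / 2)).exists_isMaxOn
    ⟨x, mem_closedBall_self (by positivity)⟩
    (f := fun y => (‖x‖ / 2 - dist y x) * M y)
    ((by fun_prop : Continuous fun y => ‖x‖ / 2 - dist y x).continuousOn.mul (hM.mono hsub))
  have h1 : k ≤ (‖x‖ / 2 - dist z x) * M z := by
    have := hmax (mem_closedBall_self (x := x) (by positivity : 0 ≤ ‖x‖ / 2))
    simp only [dist_self, mem_ofPred_eq] at this
    linarith
  have hz' := hz
  rw [mem_closedBall] at hz'
  have hd : 0 < ‖x‖ / 2 - dist z x := by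
    rcases hz'.eq_or_lt with h0 | h0
    · rw [h0] at h1
      linarith
    · linarith
  have hn : ‖x‖ ≤ ‖z‖ + dist z x := by
    rw [dist_eq_norm, norm_sub_rev]
    have := norm_add_le z (x - z)
    rwa [add_sub_cancel] at this
  have hdn : 0 ≤ dist z x := dist_nonneg
  refine ⟨z, ‖x‖ / 2 - dist z x, hd, by linarith, by linarith, h1, fun y hy => ?_⟩
  rw [mem_ball] at hy
  have h2 : dist y x ≤ dist y z + dist z x := dist_triangle _ _ _
  have h3 : y ∈ closedBall x (‖x‖ / 2) := by
    rw [mem_closedBall]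
    linarith
  have h4 := hmax h3
  simp only [mem_ofPred_eq] at h4
  rcases le_or_gt (M y) 0 with h0 | h0
  · have : 0 < M z := by
      by_contra hneg
      nlinarith
    linarith
  · nlinarith

lemma exists_rescaling {N : ℕ} {p q a b α β s t : ℝ} (hα : 0 < α) (hβ : 0 < β)
    (hαβ : α + 2 = p * β) (hβα : β + 2 = q * α) (hst : s + a = p * t) (hts : t + b = q * s)
    {u v : Euc N → ℝ} (hu : Continuous u) (hv : Continuous v) (hu0 : ∀ x, 0 < u x)
    (hv0 : ∀ x, 0 < v x) {k : ℝ} (hk : 0 < k) {x : Euc N} (hx : x ≠ 0)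
    (h : 2 * k ≤ ‖x‖ * ((‖x‖ ^ s * u x) ^ (1 / α) + (‖x‖ ^ t * v x) ^ (1 / β))) :
    ∃ (z : Euc N) (μ c₁ c₂ : ℝ), 0 < μ ∧ 0 < c₁ ∧ 0 < c₂ ∧ z ≠ 0 ∧ ‖x‖ / 2 ≤ ‖z‖ ∧ μ * k ≤ ‖z‖ ∧
      (∀ y : Euc N, ‖y‖ < k / 2 → c₁ * u (z + μ • y) ≤ 2 ^ α * 2 ^ |s| ∧
        c₂ * v (z + μ • y) ≤ 2 ^ β * 2 ^ |t|) ∧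
      (c₁ * u z) ^ (1 / α) + (c₂ * v z) ^ (1 / β) = 1 ∧
      (∀ w : Euc N, c₁ * μ ^ 2 * ‖w‖ ^ a = (‖w‖ / ‖z‖) ^ a * c₂ ^ p) ∧
      (∀ w : Euc N, c₂ * μ ^ 2 * ‖w‖ ^ b = (‖w‖ / ‖z‖) ^ b * c₁ ^ q) := by
  set M : Euc N → ℝ := fun x => (‖x‖ ^ s * u x) ^ (1 / α) + (‖x‖ ^ t * v x) ^ (1 / β) with hM
  have hcont : ∀ (s α : ℝ) (u : Euc N → ℝ), Continuous u → (∀ x, 0 < u x) →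
      ContinuousOn (fun x => (‖x‖ ^ s * u x) ^ (1 / α)) {x | x ≠ 0} := fun s α u hu hu0 => by
    refine ContinuousOn.rpow_const ((continuous_norm.continuousOn.rpow_const fun x hx =>
      Or.inl (norm_ne_zero_iff.2 hx)).mul hu.continuousOn) fun x hx => Or.inl ?_
    have h1 := hu0 x
    have h2 : 0 < ‖x‖ := norm_pos_iff.2 hx
    positivity
  obtain ⟨z, d, hd, hdz, hxz, hkd, hmax⟩ :=
    exists_doubling ((hcont s α u hu hu0).add (hcont t β v hv hv0)) hk hx h
  change k ≤ d * M z at hkd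
  change ∀ y ∈ ball z (d / 2), M y ≤ 2 * M z at hmax
  have hz0 : 0 < ‖z‖ := hd.trans_le hdz
  have hz : z ≠ 0 := norm_pos_iff.1 hz0
  have hMz : 0 < M z := by
    by_contra h0
    nlinarith
  have hμ : 0 < (M z)⁻¹ := inv_pos.2 hMz
  set μ := (M z)⁻¹ with hμdef
  have hμk : μ * k ≤ d := by
    rw [hμdef, inv_mul_eq_div, div_le_iff₀ hMz]
    exact hkd
  have hbound : ∀ (s α : ℝ) (u : Euc N → ℝ), 0 < α → (∀ x, 0 < u x) →
      (∀ y, (‖y‖ ^ s * u y) ^ (1 / α) ≤ M y) → ∀ y : Euc N, ‖y‖ < k / 2 →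
      μ ^ α * ‖z‖ ^ s * u (z + μ • y) ≤ 2 ^ α * 2 ^ |s| := fun s α u hα hu0 huM y hy => by
    have h1 : ‖μ • y‖ < d / 2 := by
      rw [norm_smul, Real.norm_of_nonneg hμ.le]
      nlinarith
    have h2 : M (z + μ • y) ≤ 2 * M z := hmax _ (by simpa [mem_ball, dist_eq_norm] using h1)
    set w := z + μ • y with hw
    have h3 : ‖w‖ ≤ ‖z‖ + ‖μ • y‖ := norm_add_le _ _
    have h4 : ‖z‖ ≤ ‖w‖ + ‖μ • y‖ := by
      have := norm_sub_le w (μ • y)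
      rwa [hw, add_sub_cancel_right] at this
    have hw0 : 0 < ‖w‖ := by linarith
    have h5 : ‖w‖ ^ s * u w ≤ (2 / μ) ^ α := by
      have h6 := (huM w).trans h2
      have h7 : 2 * M z = 2 / μ := by
        rw [hμdef]
        field_simp
      rw [h7] at h6
      have h8 : 0 < ‖w‖ ^ s * u w := mul_pos (Real.rpow_pos_of_pos hw0 _) (hu0 w)
      have h9 := Real.rpow_le_rpow (by positivity) h6 hα.le
      rwa [← Real.rpow_mul h8.le, one_div_mul_cancel hα.ne', Real.rpow_one] at h9
    have h6 : (‖z‖ / ‖w‖) ^ s ≤ 2 ^ |s| := by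
      refine rpow_le_two_rpow_abs ?_ ?_ s
      · rw [le_div_iff₀ hw0]
        linarith
      · rw [div_le_iff₀ hw0]
        linarith
    rw [Real.div_rpow hz0.le hw0.le, div_le_iff₀ (Real.rpow_pos_of_pos hw0 _)] at h6
    rw [Real.div_rpow two_pos.le hμ.le, le_div_iff₀ (Real.rpow_pos_of_pos hμ _)] at h5
    have h10 := hu0 w
    have h11 : 0 < μ ^ α := Real.rpow_pos_of_pos hμ _
    calc μ ^ α * ‖z‖ ^ s * u w ≤ μ ^ α * (2 ^ |s| * ‖w‖ ^ s) * u w := by gcongr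
      _ = 2 ^ |s| * (‖w‖ ^ s * u w * μ ^ α) := by ring
      _ ≤ 2 ^ |s| * 2 ^ α := mul_le_mul_of_nonneg_left h5 (by positivity)
      _ = _ := mul_comm _ _
  have hpos : ∀ (s α : ℝ) (u : Euc N → ℝ), (∀ x, 0 < u x) → ∀ y, 0 ≤ (‖y‖ ^ s * u y) ^ (1 / α) :=
    fun s α u hu0 y => Real.rpow_nonneg (mul_nonneg (Real.rpow_nonneg (norm_nonneg _) _) (hu0 y).le) _
  have hval : ∀ (s α : ℝ) (u : Euc N → ℝ), 0 < α → (∀ x, 0 < u x) →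
      (μ ^ α * ‖z‖ ^ s * u z) ^ (1 / α) = μ * (‖z‖ ^ s * u z) ^ (1 / α) := fun s α u hα hu0 => by
    have h1 : 0 < ‖z‖ ^ s := Real.rpow_pos_of_pos hz0 _
    rw [mul_assoc, Real.mul_rpow (by positivity) (mul_pos h1 (hu0 z)).le, ← Real.rpow_mul hμ.le,
      mul_one_div_cancel hα.ne', Real.rpow_one]
  have heq : ∀ p a α β s t : ℝ, α + 2 = p * β → s + a = p * t → ∀ w : Euc N,
      μ ^ α * ‖z‖ ^ s * μ ^ 2 * ‖w‖ ^ a = (‖w‖ / ‖z‖) ^ a * (μ ^ β * ‖z‖ ^ t) ^ p :=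
    fun p a α β s t h1 h2 w => by
      rw [Real.mul_rpow (by positivity) (by positivity), ← Real.rpow_mul hμ.le,
        ← Real.rpow_mul hz0.le, mul_comm β, mul_comm t, ← h1, ← h2, Real.rpow_add hμ,
        Real.rpow_add hz0, Real.div_rpow (norm_nonneg _) hz0.le, Real.rpow_two]
      have h3 : 0 < ‖z‖ ^ a := Real.rpow_pos_of_pos hz0 _
      field_simp
  refine ⟨z, μ, μ ^ α * ‖z‖ ^ s, μ ^ β * ‖z‖ ^ t, hμ, by positivity, by positivity, hz, hxz,
    hμk.trans hdz, fun y hy => ⟨?_, ?_⟩, ?_, heq p a α β s t hαβ hst, heq q b β α t s hβα hts⟩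
  · exact hbound s α u hα hu0 (fun y => le_add_of_nonneg_right (hpos t β v hv0 y)) y hy
  · exact hbound t β v hβ hv0 (fun y => le_add_of_nonneg_left (hpos s α u hu0 y)) y hy
  · rw [hval s α u hα hu0, hval t β v hβ hv0, ← mul_add]
    exact inv_mul_cancel₀ hMz.ne'

lemma abs_rpow_mul_self {x : ℝ} (hx : 0 < x) (p : ℝ) : |x| ^ (p - 1) * x = x ^ p := by
  rw [abs_of_pos hx, Real.rpow_sub_one hx.ne', div_mul_cancel₀ _ hx.ne']

/-- Rescaled stable solutions converging to a solution of the Lane–Emden system make the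
limit stable on bounded sets. -/
lemma leStableOn_of_locConv {N : ℕ} (hN : 0 < N) {p q : ℝ} (hp : 0 < p) (hq : 0 < q)
    {U V F G ξ ζ : ℕ → Euc N → ℝ} {u v : Euc N → ℝ} {r : ℕ → ℝ} (hr : Tendsto r atTop atTop)
    (hu : ContDiff ℝ 1 u) (hv : ContDiff ℝ 1 v) (hu0 : ∀ x, 0 < u x) (hv0 : ∀ x, 0 < v x)
    (hF : LocConv F fun _ => 1) (hG : LocConv G fun _ => 1)
    (hU : LocConv U u) (hV : LocConv V v)
    (hξ : ∀ n, ContDiffOn ℝ 2 (ξ n) (ball 0 (r n))) (hζ : ∀ n, ContDiffOn ℝ 2 (ζ n) (ball 0 (r n)))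
    (hξ0 : ∀ n, ∀ y ∈ ball (0 : Euc N) (r n), 0 < ξ n y)
    (hζ0 : ∀ n, ∀ y ∈ ball (0 : Euc N) (r n), 0 < ζ n y)
    (hlξ : ∀ n, ∀ y ∈ ball (0 : Euc N) (r n),
      p * (F n y * V n y ^ (p - 1)) * ζ n y ≤ -lap (ξ n) y)
    (hlζ : ∀ n, ∀ y ∈ ball (0 : Euc N) (r n),
      q * (G n y * U n y ^ (q - 1)) * ξ n y ≤ -lap (ζ n) y)
    {Ω : Set (Euc N)} (hΩ : Bornology.IsBounded Ω) : LEStableOn p q u v Ω := by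
  obtain ⟨R, hR0, hR⟩ : ∃ R, 0 < R ∧ Ω ⊆ ball 0 R := by
    obtain ⟨R, hR⟩ := hΩ.subset_ball 0
    exact ⟨max R 1, lt_max_of_lt_right one_pos, hR.trans (ball_subset_ball (le_max_left _ _))⟩
  have hsm : ∀ {w : Euc N → ℝ} (c e : ℝ), ContDiff ℝ 1 w → (∀ x, 0 < w x) →
      ContDiff ℝ 1 fun x => c * w x ^ e := fun c e hw hw0 =>
    contDiff_const.mul (hw.rpow_const_of_ne fun x => (hw0 x).ne')
  have hpw : ∀ {w : Euc N → ℝ} {c : ℝ} (e : ℝ), 0 < c → (∀ x, 0 < w x) →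
      ∀ x, 0 < c * w x ^ e := fun e hc hw0 x => mul_pos hc (Real.rpow_pos_of_pos (hw0 x) _)
  obtain ⟨ε, hε, H⟩ := exists_supersolution_of_almost hN
    (f := fun b x => bif b then p * v x ^ (p - 1) else q * u x ^ (q - 1))
    (fun b => by cases b; exacts [hsm q _ hu hu0, hsm p _ hv hv0])
    (fun b => by cases b; exacts [hpw _ hq hu0, hpw _ hp hv0]) hR0
  have hconv : ∀ {W E : ℕ → Euc N → ℝ} {w : Euc N → ℝ} {c : ℝ} (e : ℝ), 0 < c → ContDiff ℝ 1 w →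
      (∀ x, 0 < w x) → LocConv W w → LocConv E (fun _ => 1) →
      ∀ᶠ n in atTop, ∀ y ∈ closedBall (0 : Euc N) (20 * R),
        (1 - ε) * (c * w y ^ e) ≤ c * (E n y * W n y ^ e) := by
    intro W E w c e hc hw hw0 hW hE
    have h1 : LocConv (fun n y => c * (E n y * W n y ^ e)) fun y => c * w y ^ e := fun x => by
      have h2 := ((hE x).mul ((hW x).rpow_const (p := e) (Or.inl (hw0 x).ne'))).const_mul c
      simpa using h2
    obtain ⟨x₀, -, hx₀⟩ := (isCompact_closedBall (0 : Euc N) (20 * R)).exists_isMinOn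
      ⟨0, mem_closedBall_self (by positivity)⟩ (hsm c e hw hw0).continuous.continuousOn
    filter_upwards [h1.eventually_le (hsm c e hw hw0).continuous
      (isCompact_closedBall (0 : Euc N) (20 * R)) (mul_pos hε (hpw e hc hw0 x₀))] with n hn y hy
    have h3 := (abs_le.1 (hn y hy)).1
    have h4 : c * w x₀ ^ e ≤ c * w y ^ e := hx₀ hy
    have h5 := mul_le_mul_of_nonneg_left h4 hε.le
    linarith
  obtain ⟨n, hn1, hn2, hn3⟩ := ((hconv (p - 1) hp hv hv0 hV hF).and
    ((hconv (q - 1) hq hu hu0 hU hG).and (hr.eventually_ge_atTop (20 * R)))).exists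
  have hsub : ball (0 : Euc N) (20 * R) ⊆ ball 0 (r n) := ball_subset_ball hn3
  obtain ⟨Y, hY, hY0, hYl⟩ := H ε hε.le le_rfl (fun b => bif b then ξ n else ζ n)
    (fun b => by cases b; exacts [(hζ n).mono hsub, (hξ n).mono hsub])
    (fun b x hx => by cases b; exacts [hζ0 n x (hsub hx), hξ0 n x (hsub hx)])
    (fun b x hx => by
      cases b
      · exact (mul_le_mul_of_nonneg_right (hn2 x (ball_subset_closedBall hx))
          (hξ0 n x (hsub hx)).le).trans (hlζ n x (hsub hx))
      · exact (mul_le_mul_of_nonneg_right (hn1 x (ball_subset_closedBall hx))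
          (hζ0 n x (hsub hx)).le).trans (hlξ n x (hsub hx)))
  exact ⟨Y true, Y false, (hY _).contDiffOn, (hY _).contDiffOn, fun x hx => hY0 _ x (hR hx),
    fun x hx => hY0 _ x (hR hx), fun x hx => hYl true x (hR hx), fun x hx => hYl false x (hR hx)⟩

lemma contDiffOn_comp_affine {N : ℕ} {u : Euc N → ℝ} {D : Set (Euc N)} (hu : ContDiffOn ℝ 2 u D)
    (c μ : ℝ) (z : Euc N) {r : ℝ} (hD : ∀ y ∈ ball (0 : Euc N) r, z + μ • y ∈ D) :
    ContDiffOn ℝ 2 (fun y => c * u (z + μ • y)) (ball 0 r) :=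
  contDiffOn_const.mul (hu.comp (by fun_prop : ContDiff ℝ 2 fun y : Euc N => z + μ • y).contDiffOn hD)

theorem exists_scaled_decay {N : ℕ} (hN : 0 < N) {p q a b α β s t : ℝ} (hp : 0 < p) (hq : 0 < q)
    (hα : 0 < α) (hβ : 0 < β)
    (hαβ : α + 2 = p * β) (hβα : β + 2 = q * α) (hst : s + a = p * t) (hts : t + b = q * s)
    (hLE : ¬ ∃ u v : Euc N → ℝ, ContDiff ℝ (⊤ : ℕ∞) u ∧ ContDiff ℝ (⊤ : ℕ∞) v ∧
        (∀ x, 0 < u x) ∧ (∀ x, 0 < v x) ∧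
        (∃ M : ℝ, ∀ x, u x ≤ M ∧ v x ≤ M) ∧ IsLESol p q u v ∧
        ∀ Ω : Set (Euc N), IsOpen Ω → Bornology.IsBounded Ω → LEStableOn p q u v Ω)
    {u v : Euc N → ℝ} {K : Set (Euc N)} (hsol : IsHLESol p q a b u v) (hu0 : ∀ x, 0 < u x)
    (hv0 : ∀ x, 0 < v x) (hstab : HLEStableOutside p q a b u v K) :
    ∃ C R₀ : ℝ, 0 < R₀ ∧ ∀ x : Euc N, R₀ ≤ ‖x‖ →
      ‖x‖ * ((‖x‖ ^ s * u x) ^ (1 / α) + (‖x‖ ^ t * v x) ^ (1 / β)) ≤ C := by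
  obtain ⟨hu2, hv2, huc, hvc, hlu, hlv⟩ := hsol
  obtain ⟨hK, hst'⟩ := hstab
  obtain ⟨R₁, hR₁0, hR₁⟩ : ∃ R, 0 < R ∧ K ⊆ closedBall 0 R := by
    obtain ⟨R, hR⟩ := hK.isBounded.subset_closedBall 0
    exact ⟨max R 1, lt_max_of_lt_right one_pos,
      hR.trans (closedBall_subset_closedBall (le_max_left _ _))⟩
  by_contra! hcon
  have hk : ∀ n : ℕ, (0 : ℝ) < n + 1 := fun n => by positivity
  choose x hx hxM using fun n : ℕ => hcon (2 * (n + 1)) (8 * R₁) (by positivity)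
  have hx0 : ∀ n, x n ≠ 0 := fun n => norm_pos_iff.1 (lt_of_lt_of_le (by positivity) (hx n))
  choose z μ c₁ c₂ hμ hc₁ hc₂ hz hxz hμk hbd hnorm he₁ he₂ using fun n : ℕ =>
    exists_rescaling hα hβ hαβ hβα hst hts huc hvc hu0 hv0 (hk n) (hx0 n) (hxM n).le
  have hzpos : ∀ n, 0 < ‖z n‖ := fun n => norm_pos_iff.2 (hz n)
  have hzR : ∀ n, 4 * R₁ ≤ ‖z n‖ := fun n => by linarith [hx n, hxz n]
  set r : ℕ → ℝ := fun n => (n + 1) / 2 with hr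
  have hrt : Tendsto r atTop atTop :=
    (tendsto_atTop_add_const_right _ _ tendsto_natCast_atTop_atTop).atTop_div_const two_pos
  have hrn : ∀ n, ∀ y ∈ ball (0 : Euc N) (r n), ‖y‖ < (n + 1) / 2 := fun n y hy => by
    simpa [hr] using hy
  have hμy : ∀ n (y : Euc N), ‖μ n • y‖ * (n + 1) ≤ ‖z n‖ * ‖y‖ := fun n y => by
    rw [norm_smul, Real.norm_of_nonneg (hμ n).le]
    have := mul_le_mul_of_nonneg_right (hμk n) (norm_nonneg y)
    linarith
  have hball : ∀ n, ∀ y ∈ ball (0 : Euc N) (r n), z n + μ n • y ∈ ball (z n) (‖z n‖ / 2) :=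
    fun n y hy => by
      have h1 := hμy n y
      have h2 := hrn n y hy
      have h3 := mul_lt_mul_of_pos_left h2 (hzpos n)
      rw [mem_ball, dist_eq_norm, add_sub_cancel_left]
      have h4 := hk n
      by_contra h5
      have h6 := mul_le_mul_of_nonneg_right (not_lt.1 h5) h4.le
      linarith
  set D : ℕ → Set (Euc N) := fun n => ball (z n) (‖z n‖ / 2) with hD
  have hcl : ∀ n, closure (D n) ⊆ closedBall (z n) (‖z n‖ / 2) := fun n => closure_ball_subset_closedBall
  have hfar : ∀ n, ∀ w ∈ closedBall (z n) (‖z n‖ / 2), ‖z n‖ / 2 ≤ ‖w‖ := fun n w hw => by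
    rw [mem_closedBall, dist_eq_norm, norm_sub_rev] at hw
    have := norm_add_le w (z n - w)
    rw [add_sub_cancel] at this
    linarith
  have hD0 : ∀ n, D n ⊆ {x | x ≠ 0} := fun n w hw h0 => by
    have h1 := hfar n w (ball_subset_closedBall hw)
    rw [show w = 0 from h0, norm_zero] at h1
    linarith [hzpos n]
  have hstD : ∀ n, HLEStableOn p q a b u v (D n) := fun n => by
    refine hst' (D n) isOpen_ball
      ((isCompact_closedBall _ _).of_isClosed_subset isClosed_closure (hcl n)) fun w hw hwK => ?_
    have h1 := hfar n w (hcl n hw)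
    have h2 := hR₁ hwK
    rw [mem_closedBall_zero_iff] at h2
    linarith [hzR n]
  choose ξ ζ hξ hζ hξ0 hζ0 hlξ hlζ using hstD
  have hscale : ∀ n, ∀ w : Euc N → ℝ, ContDiffOn ℝ 2 w (D n) → ∀ c, ∀ y ∈ ball (0 : Euc N) (r n),
      -lap (fun y => c * w (z n + μ n • y)) y = c * μ n ^ 2 * -lap w (z n + μ n • y) :=
    fun n w hw c y hy => by
      obtain ⟨ρ, hρ, hsub⟩ := Metric.isOpen_iff.1 isOpen_ball _ (hball n y hy)
      rw [lap_comp_affine hρ (hw.mono hsub)]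
      ring
  set F : ℝ → ℕ → Euc N → ℝ := fun a n y => (‖z n + μ n • y‖ / ‖z n‖) ^ a with hF
  have hratio : ∀ n (y : Euc N), |‖z n + μ n • y‖ / ‖z n‖ - 1| ≤ ‖y‖ / (n + 1) := fun n y => by
    have h1 : |‖z n + μ n • y‖ - ‖z n‖| ≤ ‖μ n • y‖ := by
      simpa using abs_norm_sub_norm_le (z n + μ n • y) (z n)
    have h2 : ‖z n + μ n • y‖ / ‖z n‖ - 1 = (‖z n + μ n • y‖ - ‖z n‖) / ‖z n‖ := by
      have := (hzpos n).ne'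
      field_simp
    rw [h2, abs_div, abs_of_pos (hzpos n), div_le_div_iff₀ (hzpos n) (hk n)]
    have h3 := mul_le_mul_of_nonneg_right h1 (hk n).le
    linarith [hμy n y]
  have hFconv : ∀ a, LocConv (F a) fun _ => 1 := fun a w => by
    have h1 : Tendsto (fun p : ℕ × Euc N => ‖p.2‖ * (1 / ((p.1 : ℝ) + 1))) (atTop ×ˢ 𝓝 w)
        (𝓝 (‖w‖ * 0)) :=
      ((continuous_norm.tendsto w).comp tendsto_snd).mul
        (tendsto_one_div_add_atTop_nhds_zero_nat.comp tendsto_fst)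
    rw [mul_zero] at h1
    have h2 : Tendsto (fun p : ℕ × Euc N => ‖z p.1 + μ p.1 • p.2‖ / ‖z p.1‖) (atTop ×ˢ 𝓝 w)
        (𝓝 1) := by
      rw [tendsto_iff_norm_sub_tendsto_zero]
      refine squeeze_zero (fun _ => norm_nonneg _) (fun p => ?_) h1
      rw [mul_one_div]
      exact hratio p.1 p.2
    have h3 := h2.rpow_const (p := a) (Or.inl one_ne_zero)
    rwa [Real.one_rpow] at h3
  have hFB : ∀ a n, ∀ y ∈ ball (0 : Euc N) (r n), |F a n y| ≤ 2 ^ |a| := fun a n y hy => by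
    have h1 := abs_le.1 (hratio n y)
    have h2 : ‖y‖ / (n + 1) ≤ 1 / 2 := by
      rw [div_le_iff₀ (hk n)]
      linarith [hrn n y hy]
    rw [abs_of_nonneg (by positivity)]
    exact rpow_le_two_rpow_abs (by linarith) (by linarith) a
  set U : ℕ → Euc N → ℝ := fun n y => c₁ n * u (z n + μ n • y) with hU
  set V : ℕ → Euc N → ℝ := fun n y => c₂ n * v (z n + μ n • y) with hV
  set A : ℝ := max (2 ^ α * 2 ^ |s|) (2 ^ β * 2 ^ |t|) with hA
  set B : ℝ := max (2 ^ |a|) (2 ^ |b|) with hB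
  have hne : ∀ n, ∀ y ∈ ball (0 : Euc N) (r n), z n + μ n • y ≠ 0 := fun n y hy =>
    hD0 n (hball n y hy)
  obtain ⟨φ, u', v', hφ, hu', hv', hu'0, hv'0, hu'A, hv'A, hsol', hUc, hVc⟩ :=
    exists_limit_solution hN hp hq (one_div_pos.2 hα) (one_div_pos.2 hβ) (U := U) (V := V)
    (F := F a) (G := F b) hrt (A := A) (B := B)
    (fun n => contDiffOn_comp_affine (hu2.mono (hD0 n)) _ _ _ (hball n))
    (fun n => contDiffOn_comp_affine (hv2.mono (hD0 n)) _ _ _ (hball n))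
    (fun n y => (mul_pos (hc₁ n) (hu0 _)).le) (fun n y => (mul_pos (hc₂ n) (hv0 _)).le)
    (fun n y hy => ((hbd n y (hrn n y hy)).1).trans (le_max_left _ _))
    (fun n y hy => ((hbd n y (hrn n y hy)).2).trans (le_max_right _ _))
    (hFconv a) (hFconv b)
    (fun n y hy => (hFB a n y hy).trans (le_max_left _ _))
    (fun n y hy => (hFB b n y hy).trans (le_max_right _ _))
    (fun n y hy => by
      rw [hU, hscale n u (hu2.mono (hD0 n)) _ y hy, hlu _ (hne n y hy), abs_rpow_mul_self (hv0 _),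
        ← mul_assoc, he₁, mul_assoc, ← Real.mul_rpow (hc₂ n).le (hv0 _).le])
    (fun n y hy => by
      rw [hV, hscale n v (hv2.mono (hD0 n)) _ y hy, hlv _ (hne n y hy), abs_rpow_mul_self (hu0 _),
        ← mul_assoc, he₂, mul_assoc, ← Real.mul_rpow (hc₁ n).le (hu0 _).le])
    (fun n => by simpa [hU, hV] using hnorm n)
  refine hLE ⟨u', v', hu', hv', hu'0, hv'0, ⟨A, fun x => ⟨hu'A x, hv'A x⟩⟩, hsol',
    fun Ω _ hΩ => ?_⟩
  have hlin : ∀ p c d m E w g h : ℝ, 0 < c → 0 < w → d * m * E = g * c ^ p →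
      p * (g * (c * w) ^ (p - 1)) * (c * h) = d * m * (p * E * w ^ (p - 1) * h) :=
    fun p c d m E w g h hc hw he => by
      rw [Real.mul_rpow hc.le hw.le, Real.rpow_sub_one hc.ne']
      calc _ = g * c ^ p * (p * w ^ (p - 1) * h) := by field_simp
        _ = _ := by
          rw [← he]
          ring
  refine leStableOn_of_locConv hN hp hq (r := fun n => r (φ n)) (U := fun n => U (φ n))
    (V := fun n => V (φ n)) (F := fun n => F a (φ n)) (G := fun n => F b (φ n))
    (ξ := fun n y => c₁ (φ n) * ξ (φ n) (z (φ n) + μ (φ n) • y))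
    (ζ := fun n y => c₂ (φ n) * ζ (φ n) (z (φ n) + μ (φ n) • y))
    (hrt.comp hφ.tendsto_atTop) (hu'.of_le (by exact_mod_cast le_top))
    (hv'.of_le (by exact_mod_cast le_top)) hu'0 hv'0
    ((hFconv a).comp_strictMono hφ) ((hFconv b).comp_strictMono hφ) hUc hVc
    (fun n => contDiffOn_comp_affine (hξ _) _ _ _ (hball _))
    (fun n => contDiffOn_comp_affine (hζ _) _ _ _ (hball _))
    (fun n y hy => mul_pos (hc₁ _) (hξ0 _ _ (hball _ y hy)))
    (fun n y hy => mul_pos (hc₂ _) (hζ0 _ _ (hball _ y hy)))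
    (fun n y hy => ?_) (fun n y hy => ?_) hΩ
  · rw [hscale _ _ (hξ _) _ y hy]
    rw [hlin p (c₂ (φ n)) (c₁ (φ n)) (μ (φ n) ^ 2) _ _ _ _ (hc₂ _) (hv0 _) (he₁ _ _)]
    exact mul_le_mul_of_nonneg_left (hlξ _ _ (hball _ y hy))
      (mul_nonneg (hc₁ _).le (sq_nonneg _))
  · rw [hscale _ _ (hζ _) _ y hy]
    rw [hlin q (c₁ (φ n)) (c₂ (φ n)) (μ (φ n) ^ 2) _ _ _ _ (hc₁ _) (hu0 _) (he₂ _ _)]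
    exact mul_le_mul_of_nonneg_left (hlζ _ _ (hball _ y hy))
      (mul_nonneg (hc₂ _).le (sq_nonneg _))

lemma isOpen_ne_zero {N : ℕ} : IsOpen {x : Euc N | x ≠ 0} := isOpen_ne

lemma continuous_mul_of_eq_zero_near {N : ℕ} {φ h : Euc N → ℝ} (hφ : Continuous φ) {δ : ℝ}
    (hδ : 0 < δ) (hφ0 : ∀ x, ‖x‖ < δ → φ x = 0) (hh : ContinuousOn h {x | x ≠ 0}) :
    Continuous fun x => φ x * h x := by
  refine continuous_iff_continuousAt.2 fun x => ?_
  by_cases hx : x = 0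
  · have h1 : (fun x => φ x * h x) =ᶠ[𝓝 x] fun _ => 0 := by
      filter_upwards [ball_mem_nhds x hδ] with y hy
      rw [hx, mem_ball_zero_iff] at hy
      rw [hφ0 y hy, zero_mul]
    exact continuousAt_const.congr h1.symm
  · exact hφ.continuousAt.mul (hh.continuousAt (isOpen_ne_zero.mem_nhds hx))

lemma contDiff_mul_of_eq_zero_near {N : ℕ} {φ h : Euc N → ℝ} (hφ : ContDiff ℝ 1 φ) {δ : ℝ}
    (hδ : 0 < δ) (hφ0 : ∀ x, ‖x‖ < δ → φ x = 0) (hh : ContDiffOn ℝ 1 h {x | x ≠ 0}) :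
    ContDiff ℝ 1 fun x => φ x * h x := by
  refine contDiff_iff_contDiffAt.2 fun x => ?_
  by_cases hx : x = 0
  · have h1 : (fun x => φ x * h x) =ᶠ[𝓝 x] fun _ => 0 := by
      filter_upwards [ball_mem_nhds x hδ] with y hy
      rw [hx, mem_ball_zero_iff] at hy
      rw [hφ0 y hy, zero_mul]
    exact contDiffAt_const.congr_of_eventuallyEq h1
  · exact hφ.contDiffAt.mul (hh.contDiffAt (isOpen_ne_zero.mem_nhds hx))

/-- A smooth radial cutoff at scale `ρ`. -/
def cutoff {N : ℕ} (ρ : ℝ) (x : Euc N) : ℝ := kerK (ρ⁻¹ • x)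

section cutoff

variable {N : ℕ} {ρ : ℝ} {x : Euc N}

lemma contDiff_cutoff (ρ : ℝ) : ContDiff ℝ 1 (cutoff (N := N) ρ) := by
  have := contDiff_kerK (N := N) (n := 1)
  exact ContDiff.comp (g := kerK) (by exact_mod_cast this) (contDiff_const_smul _)

lemma norm_inv_smul (hρ : 0 < ρ) (x : Euc N) : ‖ρ⁻¹ • x‖ = ‖x‖ / ρ := by
  rw [norm_smul, Real.norm_of_nonneg (inv_pos.2 hρ).le, inv_mul_eq_div]

lemma cutoff_eq_one (hρ : 0 < ρ) (hx : ‖x‖ ≤ ρ / 2) : cutoff ρ x = 1 := by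
  refine kerK_eq_one ?_
  rw [norm_inv_smul hρ, div_le_iff₀ hρ]
  linarith

lemma cutoff_eq_zero (hρ : 0 < ρ) (hx : ρ ≤ ‖x‖) : cutoff ρ x = 0 := by
  refine kerK_eq_zero ?_
  rwa [norm_inv_smul hρ, one_le_div hρ]

lemma pd_cutoff (i : Fin N) (ρ : ℝ) (x : Euc N) :
    pd i (cutoff ρ) x = ρ⁻¹ * pd i kerK (ρ⁻¹ • x) := by
  have h1 : ContDiff ℝ 1 (kerK (N := N)) := by exact_mod_cast contDiff_kerK (N := N) (n := 1)
  have h2 := pd_comp_affine h1 i ρ⁻¹ 0 x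
  simp only [zero_add] at h2
  exact h2

lemma pd_cutoff_eq_zero (hρ : 0 < ρ) (i : Fin N) (hx : ‖x‖ < ρ / 2 ∨ ρ < ‖x‖) :
    pd i (cutoff ρ) x = 0 := by
  rw [pd_cutoff, pd_kerK]
  have : kerR (ρ⁻¹ • x) = 0 := by
    rcases hx with hx | hx
    · refine kerR_eq_zero_of_lt _ ?_
      rw [norm_inv_smul hρ, div_lt_iff₀ hρ]
      linarith
    · refine kerR_eq_zero _ ?_
      rwa [norm_inv_smul hρ, one_lt_div hρ]
  simp [this]

lemma hasCompactSupport_of_norm {f : Euc N → ℝ} (ρ : ℝ) (hf : ∀ x, ρ < ‖x‖ → f x = 0) :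
    HasCompactSupport f :=
  HasCompactSupport.intro (isCompact_closedBall 0 ρ) fun x hx => hf x (by simpa using hx)

lemma cutoff_diff_nonneg {ε R : ℝ} (hε : 0 < ε) (hεR : 2 * ε ≤ R) (x : Euc N) :
    0 ≤ cutoff R x - cutoff ε x := by
  rcases le_total ‖x‖ ε with h | h
  · rw [cutoff_eq_one (by linarith : 0 < R) (by linarith)]
    exact sub_nonneg.2 (kerK_le_one _)
  · rw [cutoff_eq_zero hε h, sub_zero]
    exact kerK_nonneg _

end cutoff

lemma integral_mul_pd_of_eq_zero_near {N : ℕ} {φ f : Euc N → ℝ} (hφ : ContDiff ℝ 1 φ)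
    (hφs : HasCompactSupport φ) {δ : ℝ} (hδ : 0 < δ) (hφ0 : ∀ x, ‖x‖ ≤ δ → φ x = 0)
    (hf : ContDiffOn ℝ 1 f {x | x ≠ 0}) (i : Fin N) :
    ∫ x, φ x * pd i f x = -∫ x, pd i φ x * f x := by
  set ψ : Euc N → ℝ := fun x => 1 - cutoff δ x with hψ
  have hg : ContDiff ℝ 1 fun x => ψ x * f x :=
    contDiff_mul_of_eq_zero_near (contDiff_const.sub (contDiff_cutoff δ)) (half_pos hδ)
      (fun x hx => by simp [hψ, cutoff_eq_one hδ hx.le]) hf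
  have h1 := integral_mul_pd hφ hg hφs i
  have hψ1 : ∀ x, δ ≤ ‖x‖ → ψ x = 1 := fun x hx => by simp [hψ, cutoff_eq_zero hδ hx]
  have h2 : ∀ x, φ x * pd i (fun x => ψ x * f x) x = φ x * pd i f x := fun x => by
    rcases le_or_gt ‖x‖ δ with hx | hx
    · simp [hφ0 x hx]
    · have : (fun x => ψ x * f x) =ᶠ[𝓝 x] f := by
        filter_upwards [(isOpen_lt continuous_const continuous_norm).mem_nhds hx] with y hy
        rw [hψ1 y (le_of_lt hy), one_mul]
      unfold pd
      rw [this.fderiv_eq]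
  have h3 : ∀ x, pd i φ x * (ψ x * f x) = pd i φ x * f x := fun x => by
    rcases lt_or_ge ‖x‖ δ with hx | hx
    · have : φ =ᶠ[𝓝 x] fun _ => 0 := by
        filter_upwards [(isOpen_lt continuous_norm continuous_const).mem_nhds hx] with y hy
        exact hφ0 y (le_of_lt hy)
      have h4 : pd i φ x = 0 := by
        unfold pd
        rw [this.fderiv_eq]
        simp
      simp [h4]
    · rw [hψ1 x hx, one_mul]
  simp_rw [h2, h3] at h1
  exact h1

lemma integrable_pd_cutoff_mul {N : ℕ} {ρ : ℝ} (hρ : 0 < ρ) {f : Euc N → ℝ}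
    (hf : ContinuousOn f {x | x ≠ 0}) (i : Fin N) :
    Integrable fun x => pd i (cutoff ρ) x * f x :=
  (continuous_mul_of_eq_zero_near (continuous_pd (contDiff_cutoff ρ) i) (half_pos hρ)
    (fun _ hx => pd_cutoff_eq_zero hρ i (Or.inl hx)) hf).integrable_of_hasCompactSupport
    (hasCompactSupport_of_norm ρ fun _ hx => by rw [pd_cutoff_eq_zero hρ i (Or.inr hx), zero_mul])

lemma abs_integral_pd_cutoff_mul_le {N : ℕ} (hN : 0 < N) {ρ η : ℝ} (hρ : 0 < ρ) {f : Euc N → ℝ}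
    (i : Fin N)
    (hη : ∀ x : Euc N, ρ / 2 ≤ ‖x‖ → ‖x‖ ≤ ρ → ρ ^ (N - 1) * |f x| ≤ η) :
    |∫ x, pd i (cutoff ρ) x * f x| ≤ (∫ z : Euc N, |pd i kerK z|) * η := by
  have hK1 : ContDiff ℝ 1 (kerK (N := N)) := by exact_mod_cast contDiff_kerK (N := N) (n := 1)
  have h1 := integral_comp_affine (fun x => pd i (cutoff ρ) x * f x) 0 hρ
  have h2 : ∫ x, pd i (cutoff ρ) x * f x
      = ∫ z : Euc N, ρ ^ N * (pd i (cutoff ρ) (0 + ρ • z) * f (0 + ρ • z)) := by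
    rw [integral_const_mul, h1]
    field_simp
  have h3 : Integrable fun z : Euc N => |pd i kerK z| * η :=
    ((continuous_pd hK1 i).abs.integrable_of_hasCompactSupport (hasCompactSupport_of_norm 1
      fun z hz => by rw [pd_zero_outside kerK_zero' i z hz, abs_zero])).mul_const η
  rw [h2, ← integral_mul_const, ← Real.norm_eq_abs]
  refine norm_integral_le_of_norm_le h3 (Eventually.of_forall fun z => ?_)
  rw [zero_add, pd_cutoff, inv_smul_smul₀ hρ.ne', Real.norm_eq_abs]
  have h4 : ρ ^ N = ρ ^ (N - 1) * ρ := by rw [← pow_succ, Nat.sub_add_cancel hN]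
  have h5 : ρ ^ N * (ρ⁻¹ * pd i kerK z * f (ρ • z)) = pd i kerK z * (ρ ^ (N - 1) * f (ρ • z)) := by
    rw [h4]
    field_simp
  rw [h5, abs_mul, abs_mul, abs_of_nonneg (by positivity : 0 ≤ ρ ^ (N - 1))]
  by_cases hz : ‖z‖ < 1 / 2 ∨ 1 < ‖z‖
  · have h6 : pd i kerK z = 0 := by
      have h7 := pd_cutoff_eq_zero one_pos i hz
      rwa [pd_cutoff, inv_one, one_smul, one_mul] at h7
    simp [h6]
  · push Not at hz
    refine mul_le_mul_of_nonneg_left (hη _ ?_ ?_) (abs_nonneg _)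
    · rw [norm_smul, Real.norm_of_nonneg hρ.le]
      nlinarith [hz.1]
    · rw [norm_smul, Real.norm_of_nonneg hρ.le]
      nlinarith [hz.2]

/-- A vector field on `ℝ^N ∖ {0}` with small flux at the origin and at infinity cannot have a
positive divergence. -/
theorem not_forall_div_pos {N : ℕ} (hN : 0 < N) {Y : Fin N → Euc N → ℝ}
    (hY : ∀ i, ContDiffOn ℝ 1 (Y i) {x | x ≠ 0})
    (hinf : ∀ η > 0, ∃ ρ : ℝ, 8 ≤ ρ ∧ ∀ i x, ρ / 2 ≤ ‖x‖ → ‖x‖ ≤ ρ → ρ ^ (N - 1) * |Y i x| ≤ η)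
    (hzero : ∀ η > 0, ∃ ρ : ℝ, 0 < ρ ∧ ρ ≤ 1 / 2 ∧
      ∀ i x, ρ / 2 ≤ ‖x‖ → ‖x‖ ≤ ρ → ρ ^ (N - 1) * |Y i x| ≤ η)
    (hdiv : ∀ x ≠ 0, 0 < ∑ i, pd i (Y i) x) : False := by
  have hYc : ∀ i, ContinuousOn (pd i (Y i)) {x | x ≠ 0} := fun i =>
    ((hY i).continuousOn_fderiv_of_isOpen isOpen_ne_zero le_rfl).clm_apply continuousOn_const
  have hdc : ContinuousOn (fun x => ∑ i, pd i (Y i) x) {x | x ≠ 0} :=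
    continuousOn_finsetSum _ fun i _ => hYc i
  have hΨ : ∀ ε R : ℝ, 0 < ε → 2 * ε ≤ R → ∀ {h : Euc N → ℝ}, ContinuousOn h {x | x ≠ 0} →
      Continuous (fun x => (cutoff R x - cutoff ε x) * h x) ∧
      HasCompactSupport fun x => (cutoff R x - cutoff ε x) * h x := fun ε R hε hR h hh => by
    have hR0 : 0 < R := by linarith
    refine ⟨continuous_mul_of_eq_zero_near
      ((contDiff_cutoff R).continuous.sub (contDiff_cutoff ε).continuous) (half_pos hε)
      (fun x hx => ?_) hh, hasCompactSupport_of_norm R fun x hx => ?_⟩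
    · rw [cutoff_eq_one hε hx.le, cutoff_eq_one hR0 (by linarith), sub_self]
    · rw [cutoff_eq_zero hR0 hx.le, cutoff_eq_zero hε (by linarith), sub_self, zero_mul]
  set c₀ := ∫ x : Euc N, (cutoff 4 x - cutoff 1 x) * ∑ i, pd i (Y i) x with hc₀
  have hnn : ∀ ε R : ℝ, 0 < ε → 2 * ε ≤ R → ∀ x : Euc N,
      0 ≤ (cutoff R x - cutoff ε x) * ∑ i, pd i (Y i) x := fun ε R hε hR x => by
    by_cases hx : x = 0
    · rw [hx, cutoff_eq_one (by linarith) (by rw [norm_zero]; linarith),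
        cutoff_eq_one hε (by rw [norm_zero]; linarith), sub_self, zero_mul]
    · exact mul_nonneg (cutoff_diff_nonneg hε hR x) (hdiv x hx).le
  have hc₀pos : 0 < c₀ := by
    obtain ⟨h1, h2⟩ := hΨ 1 4 one_pos (by norm_num) hdc
    set x₀ : Euc N := EuclideanSpace.single ⟨0, hN⟩ (3 / 2 : ℝ) with hx₀
    have hn : ‖x₀‖ = 3 / 2 := by
      rw [hx₀, PiLp.norm_single]
      norm_num
    refine h1.integral_pos_of_hasCompactSupport_nonneg_nonzero h2
      (hnn 1 4 one_pos (by norm_num)) (x := x₀) ?_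
    rw [cutoff_eq_one (by norm_num) (by rw [hn]; norm_num),
      cutoff_eq_zero one_pos (by rw [hn]; norm_num), sub_zero, one_mul]
    exact (hdiv x₀ (norm_pos_iff.1 (by rw [hn]; norm_num))).ne'
  set κ := ∑ i : Fin N, ∫ z : Euc N, |pd i kerK z| with hκ
  have hκ0 : 0 ≤ κ := Finset.sum_nonneg fun i _ => integral_nonneg fun z => abs_nonneg _
  set η := c₀ / (4 * (κ + 1)) with hη
  have hη0 : 0 < η := by positivity
  obtain ⟨R, hR, hRη⟩ := hinf η hη0
  obtain ⟨ε, hε, hε2, hεη⟩ := hzero η hη0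
  have hR0 : 0 < R := by linarith
  have hεR : 2 * ε ≤ R := by linarith
  have hlow : c₀ ≤ ∫ x : Euc N, (cutoff R x - cutoff ε x) * ∑ i, pd i (Y i) x := by
    obtain ⟨h1, h2⟩ := hΨ 1 4 one_pos (by norm_num) hdc
    obtain ⟨h3, h4⟩ := hΨ ε R hε hεR hdc
    refine integral_mono (h1.integrable_of_hasCompactSupport h2)
      (h3.integrable_of_hasCompactSupport h4) fun x => ?_
    have h5 := hnn ε R hε hεR x
    simp only
    rcases lt_or_ge ‖x‖ (1 / 2) with hx | hx
    · rw [cutoff_eq_one one_pos hx.le, cutoff_eq_one four_pos (by linarith), sub_self, zero_mul]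
      exact h5
    · rcases le_or_gt ‖x‖ 4 with hx4 | hx4
      · refine mul_le_mul_of_nonneg_right ?_
          (hdiv x (norm_pos_iff.1 (by linarith))).le
        rw [cutoff_eq_one hR0 (by linarith), cutoff_eq_zero hε (by linarith)]
        have h6 := kerK_le_one ((4 : ℝ)⁻¹ • x)
        have h7 := kerK_nonneg ((1 : ℝ)⁻¹ • x)
        unfold cutoff
        linarith
      · rw [cutoff_eq_zero four_pos hx4.le, cutoff_eq_zero one_pos (by linarith), sub_self,
          zero_mul]
        exact h5
  have hparts : ∫ x : Euc N, (cutoff R x - cutoff ε x) * ∑ i, pd i (Y i) x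
      = ∑ i, ((∫ x, pd i (cutoff ε) x * Y i x) - ∫ x, pd i (cutoff R) x * Y i x) := by
    simp_rw [Finset.mul_sum]
    rw [integral_finsetSum _ fun i _ => by
      obtain ⟨h3, h4⟩ := hΨ ε R hε hεR (hYc i)
      exact h3.integrable_of_hasCompactSupport h4]
    refine Finset.sum_congr rfl fun i _ => ?_
    have h1 := integral_mul_pd_of_eq_zero_near
      ((contDiff_cutoff (N := N) R).sub (contDiff_cutoff ε))
      (hasCompactSupport_of_norm R fun x hx => by
        rw [cutoff_eq_zero hR0 hx.le, cutoff_eq_zero hε (by linarith), sub_self])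
      (half_pos hε) (fun x hx => by
        rw [cutoff_eq_one hε hx, cutoff_eq_one hR0 (by linarith), sub_self]) (hY i) i
    have h2 : ∀ x, pd i (fun x => cutoff R x - cutoff ε x) x * Y i x
        = pd i (cutoff R) x * Y i x - pd i (cutoff ε) x * Y i x := fun x => by
      have h3 := (contDiff_cutoff (N := N) R).differentiable one_ne_zero x
      have h4 := (contDiff_cutoff (N := N) ε).differentiable one_ne_zero x
      unfold pd
      rw [fderiv_fun_sub h3 h4, _root_.sub_apply, sub_mul]
    rw [h1]
    simp_rw [h2]
    rw [integral_sub (integrable_pd_cutoff_mul hR0 (hY i).continuousOn i)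
      (integrable_pd_cutoff_mul hε (hY i).continuousOn i)]
    ring
  have hup : ∑ i, ((∫ x, pd i (cutoff ε) x * Y i x) - ∫ x, pd i (cutoff R) x * Y i x)
      ≤ 2 * (κ * η) := by
    rw [hκ, Finset.sum_mul, Finset.mul_sum]
    refine Finset.sum_le_sum fun i _ => ?_
    have h1 := abs_le.1 (abs_integral_pd_cutoff_mul_le hN hR0 i (hRη i))
    have h2 := abs_le.1 (abs_integral_pd_cutoff_mul_le hN hε i (hεη i))
    linarith
  have h1 : 2 * (κ * η) < c₀ := by
    rw [hη, mul_div_assoc', mul_div_assoc', div_lt_iff₀ (by positivity)]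
    nlinarith
  linarith

lemma contDiffOn_pd {N : ℕ} {f : Euc N → ℝ} (hf : ContDiffOn ℝ 2 f {x | x ≠ 0}) (i : Fin N) :
    ContDiffOn ℝ 1 (pd i f) {x | x ≠ 0} :=
  (hf.fderiv_of_isOpen isOpen_ne_zero (by norm_num)).clm_apply contDiffOn_const

lemma contDiffOn_norm_rpow {N : ℕ} (a : ℝ) :
    ContDiffOn ℝ 2 (fun x : Euc N => ‖x‖ ^ a) {x | x ≠ 0} := fun _ hx =>
  ((contDiffAt_norm ℝ hx).rpow_const_of_ne (norm_ne_zero_iff.2 hx)).contDiffWithinAt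

lemma sum_mul_pd_norm_rpow {N : ℕ} (a : ℝ) {x : Euc N} (hx : x ≠ 0) :
    ∑ i, x i * pd i (fun y : Euc N => ‖y‖ ^ a) x = a * ‖x‖ ^ a := by
  have hd : DifferentiableAt ℝ (fun y : Euc N => ‖y‖ ^ a) x :=
    ((contDiffOn_norm_rpow a).contDiffAt (isOpen_ne_zero.mem_nhds hx)).differentiableAt
      (by norm_num)
  rw [← fderiv_eq_sum_pd]
  have h1 : HasDerivAt (fun t : ℝ => ‖x + t • x‖ ^ a) (fderiv ℝ (fun y : Euc N => ‖y‖ ^ a) x x) 0 :=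
    hd.hasFDerivAt.hasLineDerivAt x
  have h2 : HasDerivAt (fun t : ℝ => (1 + t) ^ a * ‖x‖ ^ a)
      ((1 * a * (1 + 0) ^ (a - 1)) * ‖x‖ ^ a) 0 :=
    (((hasDerivAt_id (0 : ℝ)).const_add 1).rpow_const (Or.inl (by norm_num))).mul_const _
  have h3 : (fun t : ℝ => ‖x + t • x‖ ^ a) =ᶠ[𝓝 0] fun t : ℝ => (1 + t) ^ a * ‖x‖ ^ a := by
    filter_upwards [Ioi_mem_nhds (by norm_num : (-1 : ℝ) < 0)] with t ht
    have ht' : 0 ≤ 1 + t := by linarith [mem_Ioi.1 ht]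
    rw [show x + t • x = (1 + t) • x by rw [add_smul, one_smul], norm_smul,
      Real.norm_of_nonneg ht', Real.mul_rpow ht' (norm_nonneg _)]
  rw [h1.unique (h2.congr_of_eventuallyEq h3)]
  simp

lemma pd_pd_comm {N : ℕ} {f : Euc N → ℝ} {x : Euc N} (hf : ContDiffAt ℝ 2 f x) (i j : Fin N) :
    pd i (pd j f) x = pd j (pd i f) x := by
  have h1 : DifferentiableAt ℝ (fderiv ℝ f) x :=
    (hf.fderiv_right (m := 1) (by norm_num)).differentiableAt (by norm_num)
  unfold pd
  rw [fderiv_clm_apply h1 (differentiableAt_const _), fderiv_clm_apply h1 (differentiableAt_const _)]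
  simpa using hf.isSymmSndFDerivAt (by simp) (EuclideanSpace.single i 1) (EuclideanSpace.single j 1)

/-- The Pohozaev vector field with potentials `P`, `Q` and weights `θ₁`, `θ₂`. -/
def pohozaev {N : ℕ} (θ₁ θ₂ : ℝ) (u v W : Euc N → ℝ) (i : Fin N) (x : Euc N) : ℝ :=
  pd i u x * ∑ j, x j * pd j v x + pd i v x * ∑ j, x j * pd j u x
    - x i * (∑ j, pd j u x * pd j v x - W x) + θ₁ * (v x * pd i u x) + θ₂ * (u x * pd i v x)

lemma contDiffOn_pohozaev {N : ℕ} {θ₁ θ₂ : ℝ} {u v W : Euc N → ℝ}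
    (hu : ContDiffOn ℝ 2 u {x | x ≠ 0}) (hv : ContDiffOn ℝ 2 v {x | x ≠ 0})
    (hW : ContDiffOn ℝ 1 W {x | x ≠ 0}) (i : Fin N) :
    ContDiffOn ℝ 1 (pohozaev θ₁ θ₂ u v W i) {x | x ≠ 0} := by
  have hx : ∀ j, ContDiffOn ℝ 1 (fun x : Euc N => x j) {x | x ≠ 0} := fun j =>
    (contDiff_euclidean.1 contDiff_id j).contDiffOn
  have hu1 := contDiffOn_pd hu
  have hv1 := contDiffOn_pd hv
  have hu0 : ContDiffOn ℝ 1 u {x | x ≠ 0} := hu.of_le (by norm_num)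
  have hv0 : ContDiffOn ℝ 1 v {x | x ≠ 0} := hv.of_le (by norm_num)
  exact (((((hu1 i).mul (ContDiffOn.sum fun j _ => (hx j).mul (hv1 j))).add
    ((hv1 i).mul (ContDiffOn.sum fun j _ => (hx j).mul (hu1 j)))).sub
    ((hx i).mul ((ContDiffOn.sum fun j _ => (hu1 j).mul (hv1 j)).sub hW))).add
    (contDiffOn_const.mul (hv0.mul (hu1 i)))).add (contDiffOn_const.mul (hu0.mul (hv1 i)))

lemma hasDerivAt_pd {N : ℕ} {f : Euc N → ℝ} {x : Euc N} (hf : DifferentiableAt ℝ f x)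
    (i : Fin N) :
    HasDerivAt (fun t : ℝ => f (x + t • EuclideanSpace.single i 1)) (pd i f x) 0 :=
  hf.hasFDerivAt.hasLineDerivAt _

lemma hasDerivAt_coord {N : ℕ} (x : Euc N) (i j : Fin N) :
    HasDerivAt (fun t : ℝ => (x + t • EuclideanSpace.single i (1 : ℝ) : Euc N) j)
      (if j = i then 1 else 0) 0 := by
  have h := ((hasDerivAt_id (0 : ℝ)).mul_const (if j = i then (1 : ℝ) else 0)).const_add (x j)
  simpa [Pi.single_apply] using h

lemma hasDerivAt_sum_coord_mul {N : ℕ} {f : Fin N → Euc N → ℝ} {x : Euc N}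
    (hf : ∀ j, DifferentiableAt ℝ (f j) x) (i : Fin N) :
    HasDerivAt (fun t : ℝ => ∑ j, (x + t • EuclideanSpace.single i (1 : ℝ) : Euc N) j
      * f j (x + t • EuclideanSpace.single i 1)) (f i x + ∑ j, x j * pd i (f j) x) 0 := by
  have h := HasDerivAt.fun_sum (u := Finset.univ) fun j _ =>
    (hasDerivAt_coord x i j).mul (hasDerivAt_pd (hf j) i)
  refine h.congr_deriv ?_
  simp [Finset.sum_add_distrib]

lemma pd_pohozaev {N : ℕ} {θ₁ θ₂ : ℝ} {u v W : Euc N → ℝ}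
    (hu : ContDiffOn ℝ 2 u {x | x ≠ 0}) (hv : ContDiffOn ℝ 2 v {x | x ≠ 0})
    (hW : ContDiffOn ℝ 1 W {x | x ≠ 0}) (i : Fin N) {x : Euc N} (hx : x ≠ 0) :
    pd i (pohozaev θ₁ θ₂ u v W i) x =
      pd i (pd i u) x * ∑ j, x j * pd j v x + pd i u x * (pd i v x + ∑ j, x j * pd i (pd j v) x)
      + (pd i (pd i v) x * ∑ j, x j * pd j u x
        + pd i v x * (pd i u x + ∑ j, x j * pd i (pd j u) x))
      - (1 * (∑ j, pd j u x * pd j v x - W x)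
        + x i * (∑ j, (pd i (pd j u) x * pd j v x + pd j u x * pd i (pd j v) x) - pd i W x))
      + θ₁ * (pd i v x * pd i u x + v x * pd i (pd i u) x)
      + θ₂ * (pd i u x * pd i v x + u x * pd i (pd i v) x) := by
  have hm := isOpen_ne_zero.mem_nhds hx
  have hd : ∀ {f : Euc N → ℝ}, ContDiffOn ℝ 1 f {x | x ≠ 0} → DifferentiableAt ℝ f x :=
    fun hf => (hf.contDiffAt hm).differentiableAt (by norm_num)
  have hu1 := fun j => hd (contDiffOn_pd hu j)
  have hv1 := fun j => hd (contDiffOn_pd hv j)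
  have hu0 := hasDerivAt_pd (hd (hu.of_le (by norm_num))) i
  have hv0 := hasDerivAt_pd (hd (hv.of_le (by norm_num))) i
  have hui := fun j => hasDerivAt_pd (hu1 j) i
  have hvi := fun j => hasDerivAt_pd (hv1 j) i
  have h1 := hasDerivAt_pd (hd (contDiffOn_pohozaev (θ₁ := θ₁) (θ₂ := θ₂) hu hv hW i)) i
  have h2 := ((((hui i).mul (hasDerivAt_sum_coord_mul hv1 i)).add
    ((hvi i).mul (hasDerivAt_sum_coord_mul hu1 i))).sub
    ((hasDerivAt_coord x i i).mul ((HasDerivAt.fun_sum (u := Finset.univ) fun j _ =>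
      (hui j).mul (hvi j)).sub (hasDerivAt_pd (hd hW) i)))).add
    ((hv0.mul (hui i)).const_mul θ₁) |>.add ((hu0.mul (hvi i)).const_mul θ₂)
  have h3 := h1.unique h2
  simpa using h3

lemma sum_pd_pohozaev {N : ℕ} {θ₁ θ₂ : ℝ} {u v W : Euc N → ℝ}
    (hu : ContDiffOn ℝ 2 u {x | x ≠ 0}) (hv : ContDiffOn ℝ 2 v {x | x ≠ 0})
    (hW : ContDiffOn ℝ 1 W {x | x ≠ 0}) {x : Euc N} (hx : x ≠ 0) :
    ∑ i, pd i (pohozaev θ₁ θ₂ u v W i) x =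
      lap u x * ∑ j, x j * pd j v x + lap v x * ∑ j, x j * pd j u x
      + (2 - N + θ₁ + θ₂) * ∑ j, pd j u x * pd j v x + N * W x + ∑ i, x i * pd i W x
      + θ₁ * (v x * lap u x) + θ₂ * (u x * lap v x) := by
  have hm := isOpen_ne_zero.mem_nhds hx
  rw [lap_eq_sum_pd (hu.contDiffAt hm), lap_eq_sum_pd (hv.contDiffAt hm)]
  have hvs : ∑ i, pd i u x * ∑ j, x j * pd i (pd j v) x
      = ∑ i, x i * ∑ j, pd j u x * pd i (pd j v) x := by
    simp_rw [Finset.mul_sum]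
    rw [Finset.sum_comm]
    refine Finset.sum_congr rfl fun i _ => Finset.sum_congr rfl fun j _ => ?_
    rw [pd_pd_comm (hv.contDiffAt hm) i j]
    ring
  have hus : ∑ i, pd i v x * ∑ j, x j * pd i (pd j u) x
      = ∑ i, x i * ∑ j, pd i (pd j u) x * pd j v x := by
    simp_rw [Finset.mul_sum]
    rw [Finset.sum_comm]
    refine Finset.sum_congr rfl fun i _ => Finset.sum_congr rfl fun j _ => ?_
    rw [pd_pd_comm (hu.contDiffAt hm) i j]
    ring
  have hc : ∑ i, pd i v x * pd i u x = ∑ i, pd i u x * pd i v x :=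
    Finset.sum_congr rfl fun i _ => mul_comm _ _
  simp_rw [pd_pohozaev hu hv hW _ hx]
  simp only [Finset.sum_add_distrib, Finset.sum_sub_distrib, mul_sub, mul_add, ← Finset.mul_sum,
    ← Finset.sum_mul, Finset.sum_const, Finset.card_univ, Fintype.card_fin, nsmul_eq_mul]
  rw [hvs, hus, hc]
  ring

lemma contDiffOn_norm_rpow_mul {N : ℕ} {v : Euc N → ℝ} (hv : ContDiffOn ℝ 2 v {x | x ≠ 0})
    (hv0 : ∀ x, 0 < v x) (a p : ℝ) :
    ContDiffOn ℝ 1 (fun x : Euc N => ‖x‖ ^ a * v x ^ (p + 1)) {x | x ≠ 0} :=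
  ((contDiffOn_norm_rpow a).of_le (by norm_num)).mul
    ((hv.of_le (by norm_num)).rpow_const_of_ne fun x _ => (hv0 x).ne')

lemma sum_mul_pd_norm_rpow_mul {N : ℕ} {v : Euc N → ℝ} (hv : ContDiffOn ℝ 2 v {x | x ≠ 0})
    (hv0 : ∀ x, 0 < v x) (a p : ℝ) {x : Euc N} (hx : x ≠ 0) :
    ∑ i, x i * pd i (fun x : Euc N => ‖x‖ ^ a * v x ^ (p + 1)) x =
      a * (‖x‖ ^ a * v x ^ (p + 1)) + (p + 1) * (‖x‖ ^ a * v x ^ p * ∑ i, x i * pd i v x) := by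
  have hm := isOpen_ne_zero.mem_nhds hx
  have h1 : ∀ i, pd i (fun x : Euc N => ‖x‖ ^ a * v x ^ (p + 1)) x
      = pd i (fun x : Euc N => ‖x‖ ^ a) x * v x ^ (p + 1)
        + ‖x‖ ^ a * (pd i v x * (p + 1) * v x ^ p) := fun i => by
    have h2 := hasDerivAt_pd (((contDiffOn_norm_rpow_mul hv hv0 a p).contDiffAt
      hm).differentiableAt (by norm_num)) i
    have h3 := hasDerivAt_pd (((contDiffOn_norm_rpow a).contDiffAt hm).differentiableAt
      (by norm_num)) i
    have h4 := (hasDerivAt_pd ((hv.contDiffAt hm).differentiableAt (by norm_num)) i).rpow_const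
      (p := p + 1) (Or.inl (hv0 _).ne')
    have h5 := h2.unique (h3.mul h4)
    simpa using h5
  have h6 := sum_mul_pd_norm_rpow a hx
  calc _ = ∑ i, (x i * pd i (fun x : Euc N => ‖x‖ ^ a) x * v x ^ (p + 1)
        + (p + 1) * (‖x‖ ^ a * v x ^ p) * (x i * pd i v x)) :=
        Finset.sum_congr rfl fun i _ => by rw [h1]; ring
    _ = _ := by
      rw [Finset.sum_add_distrib, ← Finset.sum_mul, ← Finset.mul_sum, h6]
      ring

/-- The Pohozaev identity, in divergence form. -/
lemma sum_pd_pohozaev_of_sol {N : ℕ} {p q a b θ₁ θ₂ : ℝ} {u v : Euc N → ℝ} (hp : 0 < p)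
    (hq : 0 < q) (hsol : IsHLESol p q a b u v) (hu0 : ∀ x, 0 < u x) (hv0 : ∀ x, 0 < v x)
    (hθ : θ₁ + θ₂ = N - 2) {x : Euc N} (hx : x ≠ 0) :
    ∑ i, pd i (pohozaev θ₁ θ₂ u v (fun x => (p + 1)⁻¹ * (‖x‖ ^ a * v x ^ (p + 1))
      + (q + 1)⁻¹ * (‖x‖ ^ b * u x ^ (q + 1))) i) x =
      ((N + a) / (p + 1) - θ₁) * (‖x‖ ^ a * v x ^ (p + 1))
      + ((N + b) / (q + 1) - θ₂) * (‖x‖ ^ b * u x ^ (q + 1)) := by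
  obtain ⟨hu, hv, -, -, hlu, hlv⟩ := hsol
  have hP := contDiffOn_norm_rpow_mul hv hv0 a p
  have hQ := contDiffOn_norm_rpow_mul hu hu0 b q
  have hm := isOpen_ne_zero.mem_nhds hx
  have hW : ContDiffOn ℝ 1 (fun x : Euc N => (p + 1)⁻¹ * (‖x‖ ^ a * v x ^ (p + 1))
      + (q + 1)⁻¹ * (‖x‖ ^ b * u x ^ (q + 1))) {x | x ≠ 0} :=
    (contDiffOn_const.mul hP).add (contDiffOn_const.mul hQ)
  have h1 : ∀ i, pd i (fun x : Euc N => (p + 1)⁻¹ * (‖x‖ ^ a * v x ^ (p + 1))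
      + (q + 1)⁻¹ * (‖x‖ ^ b * u x ^ (q + 1))) x
      = (p + 1)⁻¹ * pd i (fun x : Euc N => ‖x‖ ^ a * v x ^ (p + 1)) x
        + (q + 1)⁻¹ * pd i (fun x : Euc N => ‖x‖ ^ b * u x ^ (q + 1)) x := fun i =>
    (hasDerivAt_pd ((hW.contDiffAt hm).differentiableAt (by norm_num)) i).unique
      (((hasDerivAt_pd ((hP.contDiffAt hm).differentiableAt (by norm_num)) i).const_mul _).add
      ((hasDerivAt_pd ((hQ.contDiffAt hm).differentiableAt (by norm_num)) i).const_mul _))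
  have h2 : ∑ i, x i * pd i (fun x : Euc N => (p + 1)⁻¹ * (‖x‖ ^ a * v x ^ (p + 1))
      + (q + 1)⁻¹ * (‖x‖ ^ b * u x ^ (q + 1))) x
      = (p + 1)⁻¹ * ∑ i, x i * pd i (fun x : Euc N => ‖x‖ ^ a * v x ^ (p + 1)) x
        + (q + 1)⁻¹ * ∑ i, x i * pd i (fun x : Euc N => ‖x‖ ^ b * u x ^ (q + 1)) x := by
    rw [Finset.mul_sum, Finset.mul_sum, ← Finset.sum_add_distrib]
    exact Finset.sum_congr rfl fun i _ => by rw [h1]; ring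
  rw [sum_pd_pohozaev hu hv hW hx, h2, sum_mul_pd_norm_rpow_mul hv hv0 a p hx,
    sum_mul_pd_norm_rpow_mul hu hu0 b q hx]
  have hlu' : lap u x = -(‖x‖ ^ a * v x ^ p) := by
    rw [← abs_rpow_mul_self (hv0 x), ← hlu x hx, neg_neg]
  have hlv' : lap v x = -(‖x‖ ^ b * u x ^ q) := by
    rw [← abs_rpow_mul_self (hu0 x), ← hlv x hx, neg_neg]
  have hθ' : (2 - N + θ₁ + θ₂ : ℝ) = 0 := by linarith
  have hp1 : p + 1 ≠ 0 := by positivity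
  have hq1 : q + 1 ≠ 0 := by positivity
  rw [hlu', hlv', hθ', Real.rpow_add_one (hv0 x).ne', Real.rpow_add_one (hu0 x).ne']
  field_simp
  ring

/-- Scale-invariant bound for the Pohozaev vector field on a dyadic annulus. -/
lemma exists_pohozaev_bound {N : ℕ} (hN : 0 < N) {p q a b : ℝ} (hp : 0 < p) (hq : 0 < q)
    (θ₁ θ₂ : ℝ) {u v : Euc N → ℝ} (hsol : IsHLESol p q a b u v) (hu0 : ∀ x, 0 < u x)
    (hv0 : ∀ x, 0 < v x) :
    ∃ C > 0, ∀ ρ E F : ℝ, 0 < ρ →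
      (∀ y : Euc N, ρ / 4 ≤ ‖y‖ → ‖y‖ ≤ 2 * ρ → u y ≤ E ∧ v y ≤ F ∧
        ‖y‖ ^ a * v y ^ p ≤ E / ρ ^ 2 ∧ ‖y‖ ^ b * u y ^ q ≤ F / ρ ^ 2) →
      ∀ i (x : Euc N), ρ / 2 ≤ ‖x‖ → ‖x‖ ≤ ρ →
        |pohozaev θ₁ θ₂ u v (fun x => (p + 1)⁻¹ * (‖x‖ ^ a * v x ^ (p + 1))
          + (q + 1)⁻¹ * (‖x‖ ^ b * u x ^ (q + 1))) i x| ≤ C * (E * F / ρ) := by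
  obtain ⟨C, hC, hgrad⟩ := exists_gradient_bound hN
  obtain ⟨hu, hv, -, -, hlu, hlv⟩ := hsol
  refine ⟨3 * N * (9 * C) ^ 2 + 2 + |θ₁| * (9 * C) + |θ₂| * (9 * C), by positivity,
    fun ρ E F hρ hb i x hx1 hx2 => ?_⟩
  have hx0 : x ≠ 0 := norm_pos_iff.1 (by linarith)
  have hball : ∀ y, dist y x ≤ ρ / 8 → ρ / 4 ≤ ‖y‖ ∧ ‖y‖ ≤ 2 * ρ := fun y hy => by
    rw [dist_eq_norm] at hy
    have h1 := norm_sub_norm_le y x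
    have h2 := norm_sub_norm_le x y
    rw [norm_sub_rev] at h2
    constructor <;> linarith
  have hsub : ball x (ρ / 4) ⊆ {y | y ≠ 0} := fun y hy h0 => by
    rw [mem_ball, h0, dist_zero_left] at hy
    linarith
  have hlu' : ∀ y, y ≠ 0 → |lap u y| = ‖y‖ ^ a * v y ^ p := fun y hy => by
    have := hv0 y
    rw [← abs_neg, hlu y hy, abs_rpow_mul_self this, abs_of_nonneg (by positivity)]
  have hlv' : ∀ y, y ≠ 0 → |lap v y| = ‖y‖ ^ b * u y ^ q := fun y hy => by
    have := hu0 y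
    rw [← abs_neg, hlv y hy, abs_rpow_mul_self this, abs_of_nonneg (by positivity)]
  have hne : ∀ y, dist y x ≤ ρ / 8 → y ≠ 0 := fun y hy =>
    norm_pos_iff.1 (by linarith [(hball y hy).1])
  obtain ⟨hux, hvx, hPx, hQx⟩ := hb x (by linarith) (by linarith)
  have hE : 0 < E := (hu0 x).trans_le hux
  have hF : 0 < F := (hv0 x).trans_le hvx
  have key : ∀ A : ℝ, C * (A / (ρ / 8) + ρ / 8 * (A / ρ ^ 2)) = 9 * C * (A / ρ) - 7 / 8 * C * (A / ρ)
    := fun A => by field_simp; ring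
  have hgu : ∀ j, |pd j u x| ≤ 9 * C * (E / ρ) := fun j => by
    refine (hgrad u x (ρ / 8) (ρ / 4) E (E / ρ ^ 2) (by positivity) (by linarith)
      (hu.mono hsub) (fun y hy => ?_) (fun y hy => ?_) j).trans ?_
    · rw [abs_of_pos (hu0 y)]
      exact (hb y (hball y hy).1 (hball y hy).2).1
    · rw [hlu' y (hne y hy)]
      exact (hb y (hball y hy).1 (hball y hy).2).2.2.1
    · rw [key]
      have : 0 < C * (E / ρ) := by positivity
      linarith
  have hgv : ∀ j, |pd j v x| ≤ 9 * C * (F / ρ) := fun j => by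
    refine (hgrad v x (ρ / 8) (ρ / 4) F (F / ρ ^ 2) (by positivity) (by linarith)
      (hv.mono hsub) (fun y hy => ?_) (fun y hy => ?_) j).trans ?_
    · rw [abs_of_pos (hv0 y)]
      exact (hb y (hball y hy).1 (hball y hy).2).2.1
    · rw [hlv' y (hne y hy)]
      exact (hb y (hball y hy).1 (hball y hy).2).2.2.2
    · rw [key]
      have : 0 < C * (F / ρ) := by positivity
      linarith
  have hsum : ∀ {f : Fin N → ℝ} {B : ℝ}, (∀ j, |f j| ≤ B) → |∑ j, f j| ≤ N * B := fun {f B} h => by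
    refine (Finset.abs_sum_le_sum_abs _ _).trans ((Finset.sum_le_sum fun j _ => h j).trans ?_)
    simp
  have hmul : ∀ {s t S T : ℝ}, |s| ≤ S → |t| ≤ T → |s * t| ≤ S * T := fun {s t S T} h1 h2 => by
    rw [abs_mul]
    exact mul_le_mul h1 h2 (abs_nonneg _) ((abs_nonneg _).trans h1)
  have hxi : ∀ j, |x j| ≤ ρ := fun j => (abs_coord_le x j).trans hx2
  have t1 := hmul (hgu i) (hsum fun j => hmul (hxi j) (hgv j))
  have t2 := hmul (hgv i) (hsum fun j => hmul (hxi j) (hgu j))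
  have hv0x := hv0 x
  have hu0x := hu0 x
  have hW : |(p + 1)⁻¹ * (‖x‖ ^ a * v x ^ (p + 1)) + (q + 1)⁻¹ * (‖x‖ ^ b * u x ^ (q + 1))|
      ≤ 2 * (E / ρ ^ 2 * F) := by
    rw [abs_of_nonneg (by positivity), Real.rpow_add_one hv0x.ne', Real.rpow_add_one hu0x.ne',
      ← mul_assoc (‖x‖ ^ a), ← mul_assoc (‖x‖ ^ b)]
    have e1 : ‖x‖ ^ a * v x ^ p * v x ≤ E / ρ ^ 2 * F :=
      mul_le_mul hPx hvx hv0x.le (by positivity)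
    have e2 : ‖x‖ ^ b * u x ^ q * u x ≤ F / ρ ^ 2 * E :=
      mul_le_mul hQx hux hu0x.le (by positivity)
    have e3 : F / ρ ^ 2 * E = E / ρ ^ 2 * F := by ring
    have e4 : (p + 1)⁻¹ ≤ 1 := inv_le_one_of_one_le₀ (by linarith)
    have e5 : (q + 1)⁻¹ ≤ 1 := inv_le_one_of_one_le₀ (by linarith)
    have e6 := mul_le_of_le_one_left (by positivity : 0 ≤ ‖x‖ ^ a * v x ^ p * v x) e4
    have e7 := mul_le_of_le_one_left (by positivity : 0 ≤ ‖x‖ ^ b * u x ^ q * u x) e5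
    linarith
  have t3 := hmul (hxi i) ((abs_sub _ _).trans (add_le_add (hsum fun j => hmul (hgu j) (hgv j)) hW))
  have t4 := hmul (le_refl |θ₁|) (hmul ((abs_of_pos hv0x).le.trans hvx) (hgu i))
  have t5 := hmul (le_refl |θ₂|) (hmul ((abs_of_pos hu0x).le.trans hux) (hgv i))
  have hEq : 9 * C * (E / ρ) * (N * (ρ * (9 * C * (F / ρ))))
      + 9 * C * (F / ρ) * (N * (ρ * (9 * C * (E / ρ))))
      + ρ * (N * (9 * C * (E / ρ) * (9 * C * (F / ρ))) + 2 * (E / ρ ^ 2 * F))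
      + |θ₁| * (F * (9 * C * (E / ρ))) + |θ₂| * (E * (9 * C * (F / ρ)))
      = (3 * N * (9 * C) ^ 2 + 2 + |θ₁| * (9 * C) + |θ₂| * (9 * C)) * (E * F / ρ) := by
    field_simp
    ring
  rw [← hEq, pohozaev]
  refine (abs_add_le _ _).trans (add_le_add ((abs_add_le _ _).trans (add_le_add
    ((abs_sub _ _).trans (add_le_add ((abs_add_le _ _).trans (add_le_add t1 t2)) t3)) t4)) t5)

lemma rpow_le_four_rpow_abs_mul {r ρ : ℝ} (hρ : 0 < ρ) (h1 : ρ / 4 ≤ r) (h2 : r ≤ 2 * ρ) (t : ℝ) :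
    r ^ t ≤ 4 ^ |t| * ρ ^ t := by
  have hr : 0 < r := by linarith
  have h3 : |Real.log (r / ρ)| ≤ Real.log 4 := by
    rw [abs_le, ← Real.log_inv]
    exact ⟨Real.log_le_log (by norm_num) (by rw [le_div_iff₀ hρ]; linarith),
      Real.log_le_log (by positivity) (by rw [div_le_iff₀ hρ]; linarith)⟩
  have h4 : (r / ρ) ^ t ≤ 4 ^ |t| := by
    rw [Real.rpow_def_of_pos (by positivity), Real.rpow_def_of_pos (by norm_num)]
    refine Real.exp_le_exp.2 ((le_abs_self _).trans ?_)
    rw [abs_mul]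
    exact mul_le_mul_of_nonneg_right h3 (abs_nonneg _)
  rwa [Real.div_rpow hr.le hρ.le, div_le_iff₀ (by positivity)] at h4

lemma le_mul_rpow_neg_of_scaled_le {r s α C w : ℝ} (hr : 0 < r) (hα : 0 < α) (hw : 0 < w)
    (hC : 0 < C) (h : r * (r ^ s * w) ^ (1 / α) ≤ C) : w ≤ C ^ α * r ^ (-(α + s)) := by
  have h1 : (r ^ s * w) ^ (1 / α) ≤ C / r := by rwa [le_div_iff₀' hr]
  have h2 := Real.rpow_le_rpow (by positivity) h1 hα.le
  rw [← Real.rpow_mul (by positivity), one_div_mul_cancel hα.ne', Real.rpow_one,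
    Real.div_rpow hC.le hr.le] at h2
  rw [Real.rpow_neg hr.le, Real.rpow_add hr, ← div_eq_mul_inv, le_div_iff₀ (by positivity)]
  rw [le_div_iff₀ (by positivity)] at h2
  linarith

lemma rpow_weight_bound {r ρ a p A B D w : ℝ} (hρ : 0 < ρ) (h1 : ρ / 4 ≤ r) (h2 : r ≤ 2 * ρ)
    (hp : 0 < p) (hD : 0 < D) (hw : 0 < w) (hwD : w ≤ D * r ^ (-B)) (hAB : A + 2 = p * B - a) :
    r ^ a * w ^ p ≤ D ^ p * 4 ^ |A + 2| * ρ ^ (-A) / ρ ^ 2 := by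
  have hr : 0 < r := by linarith
  have h3 : w ^ p ≤ D ^ p * r ^ (-B * p) := by
    refine (Real.rpow_le_rpow hw.le hwD hp.le).trans_eq ?_
    rw [Real.mul_rpow hD.le (by positivity), ← Real.rpow_mul hr.le]
  calc r ^ a * w ^ p ≤ r ^ a * (D ^ p * r ^ (-B * p)) := by gcongr
    _ = D ^ p * r ^ (-(A + 2)) := by
      rw [mul_left_comm, ← Real.rpow_add hr]
      congr 2
      linarith
    _ ≤ D ^ p * (4 ^ |A + 2| * ρ ^ (-(A + 2))) := by
      gcongr
      have := rpow_le_four_rpow_abs_mul hρ h1 h2 (-(A + 2))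
      rwa [abs_neg] at this
    _ = _ := by
      rw [neg_add, Real.rpow_add hρ, Real.rpow_neg hρ.le 2, Real.rpow_two]
      ring

lemma bound_of_scaled_le {r ρ A D w : ℝ} (hρ : 0 < ρ) (h1 : ρ / 4 ≤ r) (h2 : r ≤ 2 * ρ)
    (hD : 0 < D) (hwD : w ≤ D * r ^ (-A)) : w ≤ D * 4 ^ |A| * ρ ^ (-A) := by
  have := rpow_le_four_rpow_abs_mul hρ h1 h2 (-A)
  rw [abs_neg] at this
  rw [mul_assoc]
  exact hwD.trans (mul_le_mul_of_nonneg_left this hD.le)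

section decay

variable {N : ℕ} {p q a b : ℝ} {u v : Euc N → ℝ}

lemma exists_pohozaev_small_at_infinity (hN : 2 ≤ N) (hp : 0 < p) (hq : 0 < q) (θ₁ θ₂ : ℝ)
    (hsol : IsHLESol p q a b u v) (hu0 : ∀ x, 0 < u x) (hv0 : ∀ x, 0 < v x) {A B D D' R₀ : ℝ}
    (hA : A + 2 = p * B - a) (hB : B + 2 = q * A - b) (hAB : N - 2 < A + B)
    (hD : 0 < D) (hD' : 0 < D') (hu : ∀ x : Euc N, R₀ ≤ ‖x‖ → u x ≤ D * ‖x‖ ^ (-A))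
    (hv : ∀ x : Euc N, R₀ ≤ ‖x‖ → v x ≤ D' * ‖x‖ ^ (-B)) {η : ℝ} (hη : 0 < η) :
    ∃ ρ, 8 ≤ ρ ∧ ∀ i (x : Euc N), ρ / 2 ≤ ‖x‖ → ‖x‖ ≤ ρ →
      ρ ^ (N - 1) * |pohozaev θ₁ θ₂ u v (fun x => (p + 1)⁻¹ * (‖x‖ ^ a * v x ^ (p + 1))
        + (q + 1)⁻¹ * (‖x‖ ^ b * u x ^ (q + 1))) i x| ≤ η := by
  obtain ⟨C, hC, hbd⟩ := exists_pohozaev_bound (by omega) hp hq θ₁ θ₂ hsol hu0 hv0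
  set E := D * 4 ^ |A| + D' ^ p * 4 ^ |A + 2| with hE
  set F := D' * 4 ^ |B| + D ^ q * 4 ^ |B + 2| with hF
  have hlim : Tendsto (fun ρ : ℝ => C * (E * F) * ρ ^ (-(A + B - (N - 2)))) atTop (𝓝 0) := by
    simpa using (tendsto_rpow_neg_atTop (sub_pos.2 hAB)).const_mul (C * (E * F))
  obtain ⟨ρ, hρη, hρ8, hρR⟩ := ((hlim.eventually_le_const hη).and
    ((eventually_ge_atTop 8).and (eventually_ge_atTop (4 * R₀)))).exists
  have hρ : 0 < ρ := by linarith
  refine ⟨ρ, hρ8, fun i x hx1 hx2 => ?_⟩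
  have h1 := hbd ρ (E * ρ ^ (-A)) (F * ρ ^ (-B)) hρ (fun y hy1 hy2 => ?_) i x hx1 hx2
  · refine (mul_le_mul_of_nonneg_left h1 (by positivity)).trans (le_trans (le_of_eq ?_) hρη)
    have h2 : ρ ^ (-(A + B - (N - 2))) = ρ ^ (-A) * ρ ^ (-B) * (ρ ^ (N - 1) / ρ) := by
      rw [← Real.rpow_natCast, ← Real.rpow_sub_one hρ.ne', ← Real.rpow_add hρ, ← Real.rpow_add hρ]
      congr 1
      rw [Nat.cast_sub (by omega)]
      push_cast
      ring
    rw [h2]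
    ring
  · have hyu := hu y (by linarith)
    have hyv := hv y (by linarith)
    refine ⟨?_, ?_, ?_, ?_⟩
    · refine (bound_of_scaled_le hρ hy1 hy2 hD hyu).trans ?_
      gcongr
      exact le_add_of_nonneg_right (by positivity)
    · refine (bound_of_scaled_le hρ hy1 hy2 hD' hyv).trans ?_
      gcongr
      exact le_add_of_nonneg_right (by positivity)
    · refine (rpow_weight_bound hρ hy1 hy2 hp hD' (hv0 y) hyv hA).trans ?_
      gcongr
      exact le_add_of_nonneg_left (by positivity)
    · refine (rpow_weight_bound hρ hy1 hy2 hq hD (hu0 y) hyu hB).trans ?_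
      gcongr
      exact le_add_of_nonneg_left (by positivity)

lemma rpow_weight_bound_of_le_one {r ρ a p M w : ℝ} (hρ : 0 < ρ) (hρ1 : ρ ≤ 1) (h1 : ρ / 4 ≤ r)
    (h2 : r ≤ 2 * ρ) (ha : -2 < a) (hp : 0 < p) (hw : 0 < w) (hwM : w ≤ M) :
    r ^ a * w ^ p ≤ 4 ^ |a| * M ^ p / ρ ^ 2 := by
  have h3 : ρ ^ a ≤ (ρ ^ 2)⁻¹ := by
    rw [← Real.rpow_two, ← Real.rpow_neg hρ.le]
    exact Real.rpow_le_rpow_of_exponent_ge hρ hρ1 ha.le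
  have hM : 0 < M := hw.trans_le hwM
  calc r ^ a * w ^ p ≤ (4 ^ |a| * (ρ ^ 2)⁻¹) * M ^ p :=
        mul_le_mul ((rpow_le_four_rpow_abs_mul hρ h1 h2 a).trans (by gcongr))
          (Real.rpow_le_rpow hw.le hwM hp.le) (by positivity) (by positivity)
    _ = _ := by ring

lemma exists_pohozaev_small_at_zero (hN : 3 ≤ N) (hp : 0 < p) (hq : 0 < q) (ha : -2 < a)
    (hb : -2 < b) (θ₁ θ₂ : ℝ)
    (hsol : IsHLESol p q a b u v) (hu0 : ∀ x, 0 < u x) (hv0 : ∀ x, 0 < v x) {η : ℝ} (hη : 0 < η) :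
    ∃ ρ, 0 < ρ ∧ ρ ≤ 1 / 2 ∧ ∀ i (x : Euc N), ρ / 2 ≤ ‖x‖ → ‖x‖ ≤ ρ →
      ρ ^ (N - 1) * |pohozaev θ₁ θ₂ u v (fun x => (p + 1)⁻¹ * (‖x‖ ^ a * v x ^ (p + 1))
        + (q + 1)⁻¹ * (‖x‖ ^ b * u x ^ (q + 1))) i x| ≤ η := by
  obtain ⟨C, hC, hbd⟩ := exists_pohozaev_bound (by omega) hp hq θ₁ θ₂ hsol hu0 hv0
  obtain ⟨M, hM⟩ := (isCompact_closedBall (0 : Euc N) 1).exists_bound_of_continuousOn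
    hsol.2.2.1.continuousOn
  obtain ⟨M', hM'⟩ := (isCompact_closedBall (0 : Euc N) 1).exists_bound_of_continuousOn
    hsol.2.2.2.1.continuousOn
  have hMu : ∀ x : Euc N, ‖x‖ ≤ 1 → u x ≤ M := fun x hx =>
    (le_abs_self _).trans (hM x (by simpa using hx))
  have hMv : ∀ x : Euc N, ‖x‖ ≤ 1 → v x ≤ M' := fun x hx =>
    (le_abs_self _).trans (hM' x (by simpa using hx))
  have hM0 : 0 < M := (hu0 0).trans_le (hMu 0 (by simp))
  have hM0' : 0 < M' := (hv0 0).trans_le (hMv 0 (by simp))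
  set E := M + 4 ^ |a| * M' ^ p with hE
  set F := M' + 4 ^ |b| * M ^ q with hF
  have hlim : Tendsto (fun ρ : ℝ => C * (E * F) * ρ ^ (N - 2)) (𝓝[>] 0) (𝓝 0) := by
    have h : Continuous fun ρ : ℝ => C * (E * F) * ρ ^ (N - 2) := by fun_prop
    have h' := h.tendsto 0
    rw [zero_pow (by omega), mul_zero] at h'
    exact h'.mono_left nhdsWithin_le_nhds
  obtain ⟨ρ, hρη, hρ : 0 < ρ, hρ2⟩ := ((hlim.eventually_le_const hη).and
    ((eventually_mem_nhdsWithin : ∀ᶠ ρ in 𝓝[>] (0 : ℝ), ρ ∈ Ioi (0 : ℝ)).and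
      ((eventually_le_nhds (by norm_num : (0 : ℝ) < 1 / 2)).filter_mono
        nhdsWithin_le_nhds))).exists
  refine ⟨ρ, hρ, hρ2, fun i x hx1 hx2 => ?_⟩
  have h1 := hbd ρ E F hρ (fun y hy1 hy2 => ?_) i x hx1 hx2
  · refine (mul_le_mul_of_nonneg_left h1 (by positivity)).trans (le_trans (le_of_eq ?_) hρη)
    rw [show N - 1 = N - 2 + 1 by omega, pow_succ]
    field_simp
  · have hy : ‖y‖ ≤ 1 := by linarith
    refine ⟨(hMu y hy).trans ?_, (hMv y hy).trans ?_, ?_, ?_⟩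
    · exact le_add_of_nonneg_right (by positivity)
    · exact le_add_of_nonneg_right (by positivity)
    · refine (rpow_weight_bound_of_le_one hρ (by linarith) hy1 hy2 ha hp (hv0 y)
        (hMv y hy)).trans ?_
      gcongr
      exact le_add_of_nonneg_left hM0.le
    · refine (rpow_weight_bound_of_le_one hρ (by linarith) hy1 hy2 hb hq (hu0 y)
        (hMu y hy)).trans ?_
      gcongr
      exact le_add_of_nonneg_left hM0'.le

end decay

/-- Theorem 1.4 (iii): if the Lane–Emden system has no bounded positive smooth solution that
is stable in every bounded open set, then the subcritical Hénon–Lane–Emden system has no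
positive solution stable outside a compact set. -/
theorem stmt_2 (N : ℕ) (hN : 3 ≤ N) (p q a b : ℝ)
    (hp : 0 < p) (hq : 0 < q) (hpq : 1 < p * q)
    (ha : -2 < a) (hb : -2 < b)
    (hsub : ((N : ℝ) + a) / (p + 1) + ((N : ℝ) + b) / (q + 1) > (N : ℝ) - 2)
    (hLE : ¬ ∃ u v : Euc N → ℝ, ContDiff ℝ (⊤ : ℕ∞) u ∧ ContDiff ℝ (⊤ : ℕ∞) v ∧
        (∀ x, 0 < u x) ∧ (∀ x, 0 < v x) ∧
        (∃ M : ℝ, ∀ x, u x ≤ M ∧ v x ≤ M) ∧ IsLESol p q u v ∧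
        ∀ Ω : Set (Euc N), IsOpen Ω → Bornology.IsBounded Ω → LEStableOn p q u v Ω) :
    ¬ ∃ (u v : Euc N → ℝ) (K : Set (Euc N)),
        IsHLESol p q a b u v ∧ (∀ x, 0 < u x) ∧ (∀ x, 0 < v x) ∧
        HLEStableOutside p q a b u v K := by
  rintro ⟨u, v, K, hsol, hu0, hv0, hstab⟩
  have hm : 0 < p * q - 1 := by linarith
  have hm' : q * p - 1 ≠ 0 := by
    rw [mul_comm]
    exact hm.ne'
  have hp1 : 0 < p + 1 := by linarith
  have hq1 : 0 < q + 1 := by linarith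
  set α := 2 * (p + 1) / (p * q - 1) with hα
  set β := 2 * (q + 1) / (p * q - 1) with hβ
  set s := (a + p * b) / (p * q - 1) with hs
  set t := (b + q * a) / (p * q - 1) with ht
  have hα0 : 0 < α := by positivity
  have hβ0 : 0 < β := by positivity
  have hαβ : α + 2 = p * β := by
    rw [hα, hβ]
    field_simp
    ring
  have hβα : β + 2 = q * α := by
    rw [hα, hβ]
    field_simp
    ring
  have hst : s + a = p * t := by
    rw [hs, ht]
    field_simp
    ring
  have hts : t + b = q * s := by
    rw [hs, ht]
    field_simp
    ring
  have hAB : (N : ℝ) - 2 < (α + s) + (β + t) := by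
    have h1 : (α + s) + (β + t) = ((2 + a) * (q + 1) + (2 + b) * (p + 1)) / (p * q - 1) := by
      rw [hα, hβ, hs, ht]
      field_simp
      ring
    rw [h1, lt_div_iff₀ hm]
    rw [gt_iff_lt, div_add_div _ _ hp1.ne' hq1.ne', lt_div_iff₀ (by positivity)] at hsub
    linarith
  obtain ⟨C, R₀, hR₀, hdecay⟩ := exists_scaled_decay (by omega) hp hq hα0 hβ0 hαβ hβα hst hts hLE
    hsol hu0 hv0 hstab
  have hC : ∀ x : Euc N, R₀ ≤ ‖x‖ → ‖x‖ * (‖x‖ ^ s * u x) ^ (1 / α) ≤ |C| + 1 ∧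
      ‖x‖ * (‖x‖ ^ t * v x) ^ (1 / β) ≤ |C| + 1 := fun x hx => by
    have h1 := hdecay x hx
    have hux := hu0 x
    have hvx := hv0 x
    have h2 : 0 ≤ ‖x‖ * (‖x‖ ^ s * u x) ^ (1 / α) := by positivity
    have h3 : 0 ≤ ‖x‖ * (‖x‖ ^ t * v x) ^ (1 / β) := by positivity
    have h4 := le_abs_self C
    constructor <;> linarith
  have hC0 : 0 < |C| + 1 := by positivity
  obtain ⟨δ, hδ⟩ : ∃ δ, 2 * δ = (N + a) / (p + 1) + (N + b) / (q + 1) - (N - 2) :=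
    ⟨_, mul_div_cancel₀ _ two_ne_zero⟩
  have hδ0 : 0 < δ := by linarith
  have hθ : ((N + a) / (p + 1) - δ) + ((N + b) / (q + 1) - δ) = (N : ℝ) - 2 := by linarith
  refine not_forall_div_pos (by omega)
    (Y := pohozaev ((N + a) / (p + 1) - δ) ((N + b) / (q + 1) - δ) u v
      (fun x => (p + 1)⁻¹ * (‖x‖ ^ a * v x ^ (p + 1)) + (q + 1)⁻¹ * (‖x‖ ^ b * u x ^ (q + 1))))
    (fun i => contDiffOn_pohozaev hsol.1 hsol.2.1
      ((contDiffOn_const.mul (contDiffOn_norm_rpow_mul hsol.2.1 hv0 a p)).add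
        (contDiffOn_const.mul (contDiffOn_norm_rpow_mul hsol.1 hu0 b q))) i)
    (fun η hη => exists_pohozaev_small_at_infinity (A := α + s) (B := β + t) (R₀ := R₀)
      (D := (|C| + 1) ^ α) (D' := (|C| + 1) ^ β) (by omega) hp hq _ _ hsol hu0 hv0
      (by linarith) (by linarith) hAB (by positivity) (by positivity)
      (fun x hx => le_mul_rpow_neg_of_scaled_le (hR₀.trans_le hx) hα0 (hu0 x) hC0 (hC x hx).1)
      (fun x hx => le_mul_rpow_neg_of_scaled_le (hR₀.trans_le hx) hβ0 (hv0 x) hC0 (hC x hx).2) hη)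
    (fun η hη => exists_pohozaev_small_at_zero hN hp hq ha hb _ _ hsol hu0 hv0 hη)
    fun x hx => ?_
  rw [sum_pd_pohozaev_of_sol hp hq hsol hu0 hv0 hθ hx, sub_sub_cancel, sub_sub_cancel]
  have hx0 := norm_pos_iff.2 hx
  have hux := hu0 x
  have hvx := hv0 x
  positivity
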